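/- Let A be a commutative ring, S = Spec(A), and let T be a quasi-compact open subscheme of S. Let g : Y → T be a proper morphism of schemes of finite presentation. Then there exists a proper morphism of schemes f : X → S of finite presentation such that X ×_S T is isomorphic to Y as a scheme over T. -/

import Mathlib

universe u

section


structure Site (A : Type u) [CommRing A] (ι : Type) (f : ι → A) where
  L : Type u
  [lat : SemilatticeInf L]
  R : L → Type u
  [ring : ∀ V, CommRing (R V)]
  al : ∀ V, A →+* R V
  res : ∀ {V W : L}, V ≤ W → (R W →+* R V)
  res_self : ∀ {V : L} (h : V ≤ V) (x : R V), res h x = x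
  res_res : ∀ {U V W : L} (h : U ≤ V) (k : V ≤ W) (x : R W),
    res h (res k x) = res (h.trans k) x
  res_al : ∀ {V W : L} (h : V ≤ W) (a : A), res h (al W a) = al V a
  D : ∀ V : L, R V → L
  D_le : ∀ (V : L) (g : R V), D V g ≤ V
  D_unit : ∀ (V : L) (g : R V), IsUnit (res (D_le V g) g)
  le_D : ∀ {V W : L} (h : W ≤ V) (g : R V), IsUnit (res h g) → W ≤ D V g
  D_surj : ∀ (V : L) (g : R V) (x : R (D V g)), ∃ (n : ℕ) (y : R V),
    res (D_le V g) y = res (D_le V g) g ^ n * x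
  D_inj : ∀ (V : L) (g : R V) (y : R V), res (D_le V g) y = 0 → ∃ n : ℕ, g ^ n * y = 0
  inf_surj : ∀ (V W : L) (x : R (V ⊓ W)), x ∈ Subring.closure
    (Set.range (res (inf_le_left : V ⊓ W ≤ V)) ∪ Set.range (res (inf_le_right : V ⊓ W ≤ W)))
  cov : ∀ V W : L, ∃ s : Finset (R V), (∀ a ∈ s, D V a ≤ W) ∧
    Ideal.span (res (inf_le_left : V ⊓ W ≤ V) '' s) = ⊤

attribute [instance] Site.lat Site.ring

namespace Site
variable {A : Type u} [CommRing A] {ι : Type} {f : ι → A} (Y : Site A ι f)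

structure Chart where
  V : Y.L
  i : ι
  B : Subring (Y.R V)
  fg : ∃ s : Set (Y.R V), s.Finite ∧ Subring.closure s = B
  unit : IsUnit (Y.al V (f i))
  fmem : Y.al V (f i) ∈ B
  good : ∀ x : Y.R V, ∃ (n : ℕ) (s : Set A), s.Finite ∧
    Y.al V (f i) ^ n * x ∈ B ⊔ Subring.closure (Y.al V '' s)
  div : ∀ l, ∃ b ∈ B, Y.al V (f l) = Y.al V (f i) * b

variable {Y}
namespace Chart

instance : Preorder Y.Chart where
  le c d := ∃ h : c.V ≤ d.V, ∀ x ∈ d.B, Y.res h x ∈ c.B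
  le_refl c := ⟨le_rfl, fun x hx => by rwa [Y.res_self]⟩
  le_trans a b c h k := ⟨h.1.trans k.1, fun x hx => by
    rw [← Y.res_res h.1 k.1]; exact h.2 _ (k.2 _ hx)⟩

lemma V_le {c d : Y.Chart} (h : c ≤ d) : c.V ≤ d.V := h.1

def rs {c d : Y.Chart} (h : c ≤ d) : d.B →+* c.B :=
  ((Y.res h.1).comp d.B.subtype).codRestrict c.B (fun x => h.2 _ x.2)

@[simp] lemma rs_val {c d : Y.Chart} (h : c ≤ d) (x : d.B) :
    (rs h x : Y.R c.V) = Y.res h.1 x := rfl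

@[simp] lemma rs_rs {c d e : Y.Chart} (h : c ≤ d) (k : d ≤ e) (x : e.B) :
    rs h (rs k x) = rs (h.trans k) x := Subtype.ext (Y.res_res _ _ _)

@[simp] lemma rs_self {c : Y.Chart} (h : c ≤ c) (x : c.B) : rs h x = x :=
  Subtype.ext (Y.res_self _ _)

lemma rs_comp {c d e : Y.Chart} (h : c ≤ d) (k : d ≤ e) :
    (rs h).comp (rs k) = rs (h.trans k) := RingHom.ext fun x => rs_rs h k x

/-- the distinguished element -/
def fm (c : Y.Chart) : c.B := ⟨_, c.fmem⟩

@[simp] lemma fm_val (c : Y.Chart) : (c.fm : Y.R c.V) = Y.al c.V (f c.i) := rfl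

lemma unit_res {V W : Y.L} (h : V ≤ W) {x : Y.R W} (hx : IsUnit x) : IsUnit (Y.res h x) :=
  hx.map _

lemma closure_image {V W : Y.L} (h : V ≤ W) (s : Set (Y.R W)) :
    Subring.closure (Y.res h '' s) = (Subring.closure s).map (Y.res h) :=
  ((Y.res h).map_closure s).symm

/-- monotonicity of the good span -/
lemma good_mono {V : Y.L} {B B' : Subring (Y.R V)} (h : B ≤ B') (s : Set A) :
    B ⊔ Subring.closure (Y.al V '' s) ≤ B' ⊔ Subring.closure (Y.al V '' s) :=
  sup_le_sup_right h _

lemma good_set_mono {V : Y.L} (B : Subring (Y.R V)) {s t : Set A} (h : s ⊆ t) :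
    B ⊔ Subring.closure (Y.al V '' s) ≤ B ⊔ Subring.closure (Y.al V '' t) :=
  sup_le_sup_left (Subring.closure_mono (Set.image_mono h)) _

lemma good_res {V W : Y.L} (h : V ≤ W) {B : Subring (Y.R W)} {B' : Subring (Y.R V)}
    (hB : ∀ x ∈ B, Y.res h x ∈ B') (s : Set A) {x : Y.R W}
    (hx : x ∈ B ⊔ Subring.closure (Y.al W '' s)) :
    Y.res h x ∈ B' ⊔ Subring.closure (Y.al V '' s) := by
  have : (B ⊔ Subring.closure (Y.al W '' s)) ≤
      (B' ⊔ Subring.closure (Y.al V '' s)).comap (Y.res h) := by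
    refine sup_le (fun x hx => (le_sup_left : B' ≤ _) (hB x hx)) ?_
    rw [Subring.closure_le]
    rintro _ ⟨a, ha, rfl⟩
    refine (le_sup_right : Subring.closure (Y.al V '' s) ≤ _) ?_
    rw [Y.res_al]
    exact Subring.subset_closure ⟨a, ha, rfl⟩
  exact this hx

/-- blow-up chart -/
def bl (c : Y.Chart) (s : Finset c.B) (g : c.B)
    (hs : ∃ K : ℕ, c.fm ^ K ∈ Ideal.span (s : Set c.B)) : Y.Chart where
  V := Y.D c.V g
  i := c.i
  B := Subring.closure (Y.res (Y.D_le c.V g) '' c.B ∪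
    {x | ∃ y ∈ s, Y.res (Y.D_le c.V g) y = Y.res (Y.D_le c.V g) g * x})
  fg := by
    obtain ⟨t, ht, htc⟩ := c.fg
    refine ⟨Y.res (Y.D_le c.V g) '' t ∪
      {x | ∃ y ∈ s, Y.res (Y.D_le c.V g) y = Y.res (Y.D_le c.V g) g * x}, ?_, ?_⟩
    · refine (ht.image _).union ?_
      obtain ⟨v, hv⟩ := Y.D_unit c.V g
      refine (s.finite_toSet.image (fun y : c.B => (↑v⁻¹ : Y.R _) * Y.res (Y.D_le c.V g) (y : Y.R c.V))).subset ?_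
      rintro x ⟨y, hy, h⟩
      exact ⟨y, hy, by simp only [h, ← hv, Units.inv_mul_cancel_left]⟩
    · rw [Subring.closure_union, Subring.closure_union, closure_image, htc]
      congr 1
      rw [← Subring.coe_map, Subring.closure_eq]
  unit := by rw [← Y.res_al (Y.D_le c.V g)]; exact unit_res _ c.unit
  fmem := Subring.subset_closure (Or.inl ⟨_, c.fmem, Y.res_al _ _⟩)
  good := by
    intro x
    set h := Y.D_le c.V g
    set B' := Subring.closure (Y.res h '' c.B ∪ {x | ∃ y ∈ s, Y.res h y = Y.res h g * x})
    have hB : ∀ x ∈ c.B, Y.res h x ∈ B' := fun x hx =>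
      Subring.subset_closure (Or.inl ⟨_, hx, rfl⟩)
    obtain ⟨n, y, hy⟩ := Y.D_surj c.V g x
    obtain ⟨m, t, ht, hm⟩ := c.good y
    obtain ⟨K, hK⟩ := hs
    obtain ⟨v, hv⟩ := Y.D_unit c.V g
    have key : ∀ z ∈ Ideal.span (s : Set c.B), ∃ b ∈ B', Y.res h z = Y.res h g * b := by
      intro z hz
      induction hz using Submodule.span_induction with
      | mem z hz => 
        refine ⟨↑v⁻¹ * Y.res h z, Subring.subset_closure (Or.inr ⟨z, hz, ?_⟩), ?_⟩ <;>
        simp only [h, ← hv, Units.mul_inv_cancel_left]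
      | zero => exact ⟨0, zero_mem _, by simp⟩
      | add a b _ _ ha hb =>
        obtain ⟨p, hp, hp'⟩ := ha
        obtain ⟨q, hq, hq'⟩ := hb
        exact ⟨p + q, add_mem hp hq, by simp [hp', hq', mul_add]⟩
      | smul a b _ hb =>
        obtain ⟨q, hq, hq'⟩ := hb
        exact ⟨Y.res h a * q, mul_mem (hB _ a.2) hq, by simp [hq']; ring⟩
    obtain ⟨b, hb, hb'⟩ := key _ hK
    refine ⟨m + K * n, t, ht, ?_⟩
    have h1 := good_res h hB t hm
    have h2 : Y.al (Y.D c.V g) (f c.i) ^ (m + K * n) * x =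
        Y.res h (Y.al c.V (f c.i) ^ m * y) * b ^ n := by
      simp only [Subring.coe_pow, fm_val, map_pow, map_mul, Y.res_al] at hb' hy ⊢
      rw [hy, pow_add, pow_mul, hb']; ring
    rw [h2]
    exact mul_mem h1 (pow_mem ((le_sup_left : B' ≤ _) hb) n)
  div := by
    intro l
    obtain ⟨b, hb, h⟩ := c.div l
    refine ⟨_, Subring.subset_closure (Or.inl ⟨b, hb, rfl⟩), ?_⟩
    rw [← Y.res_al (Y.D_le c.V g), h, map_mul, Y.res_al]

section bl
variable {c : Y.Chart} {s : Finset c.B} {g : c.B}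
    {hs : ∃ K : ℕ, c.fm ^ K ∈ Ideal.span (s : Set c.B)}

lemma bl_le : c.bl s g hs ≤ c := ⟨Y.D_le c.V g, fun x hx =>
  Subring.subset_closure (Or.inl ⟨_, hx, rfl⟩)⟩

lemma bl_unit {n : Y.Chart} (h : n ≤ c.bl s g hs) (k : n ≤ c) : IsUnit (rs k g : Y.R n.V) := by
  rw [rs_val, ← Y.res_res h.1 (bl_le (s := s) (hs := hs)).1]
  exact unit_res _ (Y.D_unit c.V g)

lemma bl_dvd_mem {n : Y.Chart} (h : n ≤ c.bl s g hs) (k : n ≤ c) (y : c.B) (hy : y ∈ s) :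
    rs k g ∣ rs k y := by
  obtain ⟨v, hv⟩ := Y.D_unit c.V g
  have hb' : Y.res (Y.D_le c.V g) (y : Y.R c.V) = Y.res (Y.D_le c.V g) (g : Y.R c.V) *
      ((↑v⁻¹ : Y.R (Y.D c.V g)) * Y.res (Y.D_le c.V g) (y : Y.R c.V)) := by
    rw [← hv, Units.mul_inv_cancel_left]
  have hb : ((↑v⁻¹ : Y.R (Y.D c.V g)) * Y.res (Y.D_le c.V g) (y : Y.R c.V)) ∈ (c.bl s g hs).B :=
    Subring.subset_closure (Or.inr ⟨y, hy, hb'⟩)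
  have : rs (bl_le (hs := hs)) y = rs (bl_le (hs := hs)) g * ⟨_, hb⟩ := Subtype.ext hb'
  rw [← rs_rs h bl_le y, ← rs_rs h bl_le g, this, map_mul]
  exact dvd_mul_right _ _

lemma bl_dvd {n : Y.Chart} (h : n ≤ c.bl s g hs) (k : n ≤ c) (y : c.B)
    (hy : y ∈ Ideal.span (s : Set c.B)) : rs k g ∣ rs k y := by
  have : Ideal.span (s : Set c.B) ≤ (Ideal.span {rs k g}).comap (rs k) := by
    rw [Ideal.span_le]
    intro y hy
    simp only [Ideal.coe_comap, Set.mem_preimage, SetLike.mem_coe, Ideal.mem_span_singleton]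
    exact bl_dvd_mem h k y hy
  exact Ideal.mem_span_singleton.1 (this hy)

lemma le_bl {n : Y.Chart} (k : n ≤ c) (hu : IsUnit (rs k g : Y.R n.V))
    (hd : ∀ y ∈ s, rs k g ∣ rs k y) : n ≤ c.bl s g hs := by
  have hV : n.V ≤ Y.D c.V g := Y.le_D k.1 _ hu
  suffices H : Subring.closure (Y.res (Y.D_le c.V g) '' c.B ∪
      {x | ∃ y ∈ s, Y.res (Y.D_le c.V g) y = Y.res (Y.D_le c.V g) g * x}) ≤
      n.B.comap (Y.res hV) from ⟨hV, fun x hx => H hx⟩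
  rw [Subring.closure_le]
  rintro x (⟨y, hy, rfl⟩ | ⟨y, hy, hxy⟩)
  · change Y.res _ _ ∈ n.B
    rw [Y.res_res]; exact k.2 _ hy
  · change Y.res _ _ ∈ n.B
    obtain ⟨b, hb⟩ := hd y hy
    have h1 := congrArg (Y.res hV) hxy
    rw [map_mul, Y.res_res, Y.res_res] at h1
    have h2 := congrArg Subtype.val hb
    simp only [rs_val, Subring.coe_mul] at h2 hu
    rw [h2] at h1
    rw [← hu.mul_left_cancel h1]
    exact b.2

end bl

/-- localization -/
def loc (c : Y.Chart) (g : c.B) : Y.Chart := c.bl {1} g ⟨0, by simp⟩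

lemma loc_le {c : Y.Chart} {g : c.B} : c.loc g ≤ c := bl_le

lemma le_loc {c n : Y.Chart} {g : c.B} (k : n ≤ c) (hu : IsUnit (rs k g)) : n ≤ c.loc g :=
  le_bl k (hu.map n.B.subtype) (fun y _ => hu.dvd)

lemma loc_unit {c n : Y.Chart} {g : c.B} (h : n ≤ c.loc g) (k : n ≤ c) : IsUnit (rs k g) := by
  have := bl_dvd_mem h k 1 (by simp)
  rw [map_one] at this
  exact isUnit_of_dvd_one this

lemma loc_mono {c n : Y.Chart} (k : n ≤ c) (g : c.B) : n.loc (rs k g) ≤ c.loc g :=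
  le_loc (loc_le.trans k) (by rw [← rs_rs loc_le k]; exact loc_unit le_rfl _)

lemma loc_mul_le_left {c : Y.Chart} (g h : c.B) : c.loc (g * h) ≤ c.loc g :=
  le_loc loc_le (by
    have := loc_unit (le_refl (c.loc (g * h))) loc_le
    rw [map_mul] at this
    exact isUnit_of_mul_isUnit_left this)

lemma loc_mul_le_right {c : Y.Chart} (g h : c.B) : c.loc (g * h) ≤ c.loc h :=
  le_loc loc_le (by
    have := loc_unit (le_refl (c.loc (g * h))) loc_le
    rw [map_mul] at this
    exact isUnit_of_mul_isUnit_right this)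

lemma loc_surj {c : Y.Chart} {g : c.B} (x : (c.loc g).B) :
    ∃ (n : ℕ) (y : c.B), rs loc_le y = rs loc_le g ^ n * x := by
  suffices H : ∀ x ∈ Subring.closure (Y.res (Y.D_le c.V g) '' c.B ∪
    {x | ∃ y ∈ ({1} : Finset c.B), Y.res (Y.D_le c.V g) y = Y.res (Y.D_le c.V g) g * x}),
    ∃ (n : ℕ) (y : c.B), Y.res (Y.D_le c.V g) y = Y.res (Y.D_le c.V g) g ^ n * x by
    obtain ⟨n, y, h⟩ := H x.1 x.2
    exact ⟨n, y, Subtype.ext h⟩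
  intro x hx
  induction hx using Subring.closure_induction with
  | mem x h =>
    rcases h with ⟨y, hy, rfl⟩ | ⟨y, hy, hxy⟩
    · exact ⟨0, ⟨y, hy⟩, by rw [pow_zero, one_mul]⟩
    · exact ⟨1, y, by rw [pow_one, hxy]⟩
  | zero => exact ⟨0, 0, by simp⟩
  | one => exact ⟨0, 1, by simp⟩
  | add a b _ _ h1 h2 =>
    obtain ⟨n, y, h1⟩ := h1
    obtain ⟨m, z, h2⟩ := h2
    refine ⟨n + m, g ^ m * y + g ^ n * z, ?_⟩
    push_cast
    rw [map_add, map_mul, map_mul, h1, h2, map_pow, map_pow]; ring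
  | neg a _ h1 =>
    obtain ⟨n, y, h1⟩ := h1
    refine ⟨n, -y, ?_⟩
    push_cast
    rw [map_neg, h1]; ring
  | mul a b _ _ h1 h2 =>
    obtain ⟨n, y, h1⟩ := h1
    obtain ⟨m, z, h2⟩ := h2
    refine ⟨n + m, y * z, ?_⟩
    push_cast
    rw [map_mul, h1, h2]; ring

lemma loc_inj {c n : Y.Chart} {g : c.B} (k : n ≤ c) (h' : n.loc (rs k g) ≤ n) {x y : n.B}
    (h : rs h' x = rs h' y) : ∃ a : ℕ, rs k g ^ a * x = rs k g ^ a * y := by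
  obtain ⟨a, ha⟩ := Y.D_inj n.V (rs k g : n.B) (x - y) (by
    have := congrArg Subtype.val h
    rw [map_sub, sub_eq_zero]; exact this)
  refine ⟨a, Subtype.ext ?_⟩
  rw [mul_sub, sub_eq_zero] at ha
  exact ha

end Chart
end Site

end

section
namespace Site
variable {A : Type u} [CommRing A] {ι : Type} {f : ι → A} {Y : Site A ι f}
namespace Chart

instance (c : Y.Chart) : IsNoetherianRing c.B := by
  obtain ⟨s, hs, h⟩ := c.fg
  have h2 : (Algebra.adjoin ℤ s).FG := ⟨hs.toFinset, by simp⟩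
  have h3 : IsNoetherianRing (Algebra.adjoin ℤ s) := by
    have : Algebra.FiniteType ℤ (Algebra.adjoin ℤ s) := (Subalgebra.fg_iff_finiteType _).1 h2
    exact Algebra.FiniteType.isNoetherianRing ℤ _
  have h4 : (Algebra.adjoin ℤ s).toSubring = c.B := by rw [← h, Algebra.adjoin_int]; rfl
  rw [← h4]
  exact h3

/-- the meet of two charts -/
def inf (c d : Y.Chart) : Y.Chart where
  V := c.V ⊓ d.V
  i := c.i
  B := Subring.closure (Y.res inf_le_left '' c.B ∪ Y.res inf_le_right '' d.B)
  fg := by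
    obtain ⟨s, hs, hs'⟩ := c.fg
    obtain ⟨t, ht, ht'⟩ := d.fg
    refine ⟨Y.res inf_le_left '' s ∪ Y.res inf_le_right '' t, (hs.image _).union (ht.image _), ?_⟩
    rw [Subring.closure_union, Subring.closure_union, closure_image, closure_image, hs', ht',
      ← Subring.coe_map, ← Subring.coe_map, Subring.closure_eq, Subring.closure_eq]
  unit := by rw [← Y.res_al (inf_le_left : c.V ⊓ d.V ≤ _)]; exact unit_res _ c.unit
  fmem := Subring.subset_closure (Or.inl ⟨_, c.fmem, Y.res_al _ _⟩)
  good := by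
    intro x
    set B' := Subring.closure
      (Y.res (inf_le_left : c.V ⊓ d.V ≤ c.V) '' c.B ∪ Y.res inf_le_right '' d.B)
    have hc : ∀ x ∈ c.B, Y.res inf_le_left x ∈ B' := fun x hx =>
      Subring.subset_closure (Or.inl ⟨x, hx, rfl⟩)
    have hd : ∀ x ∈ d.B, Y.res inf_le_right x ∈ B' := fun x hx =>
      Subring.subset_closure (Or.inr ⟨x, hx, rfl⟩)
    have hf : Y.al (c.V ⊓ d.V) (f c.i) ∈ B' := by
      rw [← Y.res_al (inf_le_left : c.V ⊓ d.V ≤ _)]; exact hc _ c.fmem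
    induction Y.inf_surj c.V d.V x using Subring.closure_induction with
    | mem x h =>
      rcases h with ⟨y, rfl⟩ | ⟨y, rfl⟩
      · obtain ⟨n, s, hs, h⟩ := c.good y
        refine ⟨n, s, hs, ?_⟩
        have := good_res inf_le_left hc s h
        rwa [map_mul, map_pow, Y.res_al] at this
      · obtain ⟨n, s, hs, h⟩ := d.good y
        refine ⟨n, s, hs, ?_⟩
        have := good_res inf_le_right hd s h
        rw [map_mul, map_pow, Y.res_al] at this
        obtain ⟨b, hb, hb'⟩ := d.div c.i
        have h2 := congrArg (Y.res (inf_le_right : c.V ⊓ d.V ≤ d.V)) hb'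
        rw [map_mul, Y.res_al, Y.res_al] at h2
        rw [h2, mul_pow, mul_assoc, mul_left_comm]
        exact mul_mem (pow_mem ((le_sup_left : B' ≤ _) (hd _ hb)) _) this
    | zero => exact ⟨0, ∅, Set.finite_empty, by simp⟩
    | one => exact ⟨0, ∅, Set.finite_empty, by simp⟩
    | add x y _ _ h1 h2 =>
      obtain ⟨n, s, hs, h1⟩ := h1
      obtain ⟨m, t, ht, h2⟩ := h2
      refine ⟨n + m, s ∪ t, hs.union ht, ?_⟩
      have h1 := good_set_mono B' (Set.subset_union_left (t := t)) h1
      have h2 := good_set_mono B' (Set.subset_union_right (s := s)) h2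
      have hf' := (le_sup_left : B' ≤ B' ⊔ Subring.closure (Y.al _ '' (s ∪ t))) hf
      convert add_mem (mul_mem (pow_mem hf' m) h1) (mul_mem (pow_mem hf' n) h2) using 1
      ring
    | neg x _ h1 =>
      obtain ⟨n, s, hs, h1⟩ := h1
      exact ⟨n, s, hs, by rw [mul_neg]; exact neg_mem h1⟩
    | mul x y _ _ h1 h2 =>
      obtain ⟨n, s, hs, h1⟩ := h1
      obtain ⟨m, t, ht, h2⟩ := h2
      refine ⟨n + m, s ∪ t, hs.union ht, ?_⟩
      have h1 := good_set_mono B' (Set.subset_union_left (t := t)) h1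
      have h2 := good_set_mono B' (Set.subset_union_right (s := s)) h2
      convert mul_mem h1 h2 using 1
      ring
  div := by
    intro l
    obtain ⟨b, hb, h⟩ := c.div l
    refine ⟨_, Subring.subset_closure (Or.inl ⟨b, hb, rfl⟩), ?_⟩
    rw [← Y.res_al (inf_le_left : c.V ⊓ d.V ≤ _), h, map_mul, Y.res_al]

lemma inf_left {c d : Y.Chart} : c.inf d ≤ c := ⟨(inf_le_left : c.V ⊓ d.V ≤ c.V), fun x hx =>
  Subring.subset_closure (Or.inl ⟨x, hx, rfl⟩)⟩
lemma inf_right {c d : Y.Chart} : c.inf d ≤ d := ⟨(inf_le_right : c.V ⊓ d.V ≤ d.V), fun x hx =>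
  Subring.subset_closure (Or.inr ⟨x, hx, rfl⟩)⟩
lemma le_inf' {n c d : Y.Chart} (h : n ≤ c) (k : n ≤ d) : n ≤ c.inf d := by
  have hV : n.V ≤ c.V ⊓ d.V := le_inf h.1 k.1
  suffices H : Subring.closure
      (Y.res (inf_le_left : c.V ⊓ d.V ≤ c.V) '' c.B ∪ Y.res inf_le_right '' d.B) ≤
      n.B.comap (Y.res hV) from ⟨hV, fun x hx => H hx⟩
  rw [Subring.closure_le]
  rintro _ (⟨y, hy, rfl⟩ | ⟨y, hy, rfl⟩) <;> change Y.res _ _ ∈ n.B <;> rw [Y.res_res]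
  · exact h.2 _ hy
  · exact k.2 _ hy
lemma inf_mono {n c n' c' : Y.Chart} (h : n ≤ n') (k : c ≤ c') : n.inf c ≤ n'.inf c' :=
  le_inf' (inf_left.trans h) (inf_right.trans k)

/-- enlarge by finitely many elements of the base ring -/
def enl (c : Y.Chart) (s : Finset A) : Y.Chart where
  V := c.V
  i := c.i
  B := c.B ⊔ Subring.closure (Y.al c.V '' s)
  fg := by
    obtain ⟨t, ht, ht'⟩ := c.fg
    refine ⟨t ∪ Y.al c.V '' s, ht.union (s.finite_toSet.image _), ?_⟩
    rw [Subring.closure_union, ht']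
  unit := c.unit
  fmem := (le_sup_left : c.B ≤ _) c.fmem
  good x := by
    obtain ⟨n, t, ht, h⟩ := c.good x
    exact ⟨n, t, ht, good_mono le_sup_left t h⟩
  div l := by
    obtain ⟨b, hb, h⟩ := c.div l
    exact ⟨b, (le_sup_left : c.B ≤ _) hb, h⟩

/-- the chart contains the given elements of the base ring -/
def Has (c : Y.Chart) (s : Finset A) : Prop := ∀ a ∈ s, Y.al c.V a ∈ c.B

lemma Has.mono {c d : Y.Chart} {s : Finset A} (h : c.Has s) (k : d ≤ c) : d.Has s := fun a ha => by
  rw [← Y.res_al k.1]; exact k.2 _ (h a ha)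
lemma Has.subset {c : Y.Chart} {s t : Finset A} (h : c.Has t) (k : s ⊆ t) : c.Has s :=
  fun a ha => h a (k ha)
lemma enl_has (c : Y.Chart) (s : Finset A) : (c.enl s).Has s := fun a ha =>
  (le_sup_right : Subring.closure (Y.al c.V '' s) ≤ _) (Subring.subset_closure ⟨a, ha, rfl⟩)
lemma enl_le (c : Y.Chart) (s : Finset A) : c.enl s ≤ c := by
  suffices H : ∀ x ∈ c.B, Y.res (le_refl c.V) x ∈ c.B ⊔ Subring.closure (Y.al c.V '' s) from
    ⟨le_refl c.V, H⟩
  intro x hx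
  rw [Y.res_self]; exact (le_sup_left : c.B ≤ _) hx
lemma le_enl {n c : Y.Chart} {s : Finset A} (h : n ≤ c) (k : n.Has s) : n ≤ c.enl s := by
  suffices H : c.B ⊔ Subring.closure (Y.al c.V '' s) ≤ n.B.comap (Y.res h.1) from
    ⟨h.1, fun x hx => H hx⟩
  refine sup_le (fun x hx => h.2 x hx) ?_
  rw [Subring.closure_le]
  rintro _ ⟨a, ha, rfl⟩
  change Y.res _ _ ∈ n.B
  rw [Y.res_al]; exact k a ha

/-- `n ⊓ c → n` is an open immersion -/
def Tame (n c : Y.Chart) : Prop := ∀ (k : Type u) [Field k] (φ : (n.inf c).B →+* k),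
  ∃ h : n.B, φ (rs inf_left h) ≠ 0 ∧ n.loc h ≤ c

lemma Tame.mono {n m c : Y.Chart} (H : Tame m c) (h : n ≤ m) : Tame n c := by
  intro k _ φ
  obtain ⟨x, hx, hx'⟩ := H k (φ.comp (rs (inf_mono h le_rfl)))
  refine ⟨rs h x, ?_, (loc_mono h x).trans hx'⟩
  simpa using hx

lemma Tame.enl {n c : Y.Chart} (H : Tame n c) {s : Finset A} (h : n.Has s) : Tame n (c.enl s) := by
  intro k _ φ
  obtain ⟨x, hx, hx'⟩ := H k (φ.comp (rs (inf_mono le_rfl (enl_le c s))))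
  refine ⟨x, by simpa using hx, le_enl hx' (h.mono loc_le)⟩

lemma tame_of_le {n c : Y.Chart} (h : n ≤ c) : Tame n c := by
  intro k _ φ
  exact ⟨1, by simp, loc_le.trans h⟩

lemma exists_loc_num {n d : Y.Chart} {h : n.B} (hd : n.loc h ≤ d) (x : d.B) :
    ∃ (a : ℕ) (y : n.B), rs loc_le y = rs loc_le h ^ a * rs hd x := loc_surj _

/-- core transfer : for `e ≤ n`, `e ≤ d`, with `n_h ≤ d`, `x ∈ B_d`, `h^a x` comes from `B_n` -/
lemma exists_num {n d e : Y.Chart} {h : n.B} (hd : n.loc h ≤ d) (en : e ≤ n) (ed : e ≤ d)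
    (x : d.B) : ∃ (a : ℕ) (y : n.B), rs en y = rs en h ^ a * rs ed x := by
  obtain ⟨a, y, hy⟩ := exists_loc_num hd x
  have h1 : e.loc (rs en h) ≤ n.loc h := loc_mono en h
  have := congrArg (rs h1) hy
  obtain ⟨b, hb⟩ := loc_inj en loc_le (x := rs en y) (y := rs en h ^ a * rs ed x) (by
    simpa using this)
  refine ⟨b + a, h ^ b * y, ?_⟩
  rw [map_mul, map_pow, hb]; ring

lemma eq_of_unit_mul {c : Y.Chart} {g x y : c.B} (hg : IsUnit (g : Y.R c.V)) (h : g * x = g * y) :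
    x = y := Subtype.ext (hg.mul_left_cancel (by simpa using congrArg Subtype.val h))

/-- elements `f` with `f^K ∈ span s` -/
abbrev Triv (c : Y.Chart) (s : Finset c.B) : Prop :=
  ∃ K : ℕ, c.fm ^ K ∈ Ideal.span (s : Set c.B)

lemma dvd_of_agree {m m' e : Y.Chart} {s : Finset m.B} {s' : Finset m'.B} {g : m.B}
    {hs : Triv m s} (hJ : (Ideal.span (s' : Set m'.B)).map (rs (inf_right (c := m) (d := m'))) ≤
      (Ideal.span (s : Set m.B)).map (rs inf_left))
    (h : e ≤ m.bl s g hs) (k : e ≤ m) (k' : e ≤ m') (y : m'.B)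
    (hy : y ∈ Ideal.span (s' : Set m'.B)) : rs k g ∣ rs k' y := by
  have h1 : rs inf_right y ∈ (Ideal.span (s : Set m.B)).map (rs (inf_left (c := m) (d := m'))) :=
    hJ (Ideal.mem_map_of_mem _ hy)
  have h2 : (Ideal.span (s : Set m.B)).map (rs (inf_left (c := m) (d := m'))) ≤
      (Ideal.span {rs k g}).comap (rs (le_inf' k k')) := by
    rw [Ideal.map_le_iff_le_comap]
    intro z hz
    simp only [Ideal.mem_comap, rs_rs, Ideal.mem_span_singleton]
    exact bl_dvd h k z hz
  simpa [Ideal.mem_span_singleton] using h2 h1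

lemma BLC {m m' n : Y.Chart} {s : Finset m.B} {s' : Finset m'.B} {g : m.B} {g' : m'.B}
    {hs : Triv m s} {hs' : Triv m' s'} (hg : g ∈ s) (hg' : g' ∈ s')
    (hJ : (Ideal.span (s : Set m.B)).map (rs (inf_left (c := m) (d := m'))) =
      (Ideal.span (s' : Set m'.B)).map (rs inf_right))
    (hJ' : (Ideal.span (s' : Set m'.B)).map (rs (inf_left (c := m') (d := m))) =
      (Ideal.span (s : Set m.B)).map (rs inf_right))
    (hn : n ≤ m.bl s g hs) (hT : Tame n m') : Tame n (m'.bl s' g' hs') := by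
  intro k _ φ
  have nm : n ≤ m := hn.trans bl_le
  set e := n.inf (m'.bl s' g' hs')
  have em' : e ≤ m' := inf_right.trans bl_le
  have en : e ≤ n := inf_left
  have em : e ≤ m := en.trans nm
  obtain ⟨h, h0, hle⟩ := hT k (φ.comp (rs (inf_mono le_rfl bl_le)))
  replace h0 : φ (rs en h) ≠ 0 := by simpa using h0
  have hnm : n.loc h ≤ m := loc_le.trans nm
  obtain ⟨r, hr⟩ := dvd_of_agree (hs := hs) hJ.ge (loc_le.trans hn) hnm hle g'
    (Ideal.subset_span hg')
  obtain ⟨a, r0, hr0⟩ := loc_surj r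
  obtain ⟨r', hr'⟩ := dvd_of_agree (hs := hs') hJ'.ge (inf_right : e ≤ _) em' em g
    (Ideal.subset_span hg)
  have e1 : rs (loc_le.trans nm) (1 : m.B) = (1 : (n.loc h).B) := map_one _
  have h2 : rs (loc_le (g := rs en h)) (rs en h ^ a * rs em' g') =
      rs (loc_le (g := rs en h)) (rs em g * rs en r0) := by
    have h3 : rs loc_le h ^ a * rs hle g' = rs hnm g * rs (loc_le (g := h)) r0 := by
      rw [hr, hr0]; ring
    have := congrArg (rs (loc_mono en h)) h3
    simpa using this
  obtain ⟨b, hb⟩ := loc_inj en loc_le h2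
  have h4 : rs en h ^ (b + a) = rs en h ^ b * (r' * rs en r0) := by
    refine eq_of_unit_mul (bl_unit (inf_right : e ≤ m'.bl s' g' hs') em') ?_
    rw [hr'] at hb
    rw [pow_add, mul_left_comm, mul_comm (rs em' g') (rs en h ^ a), hb]; ring
  have h5 : φ (rs en r0) ≠ 0 := by
    intro h5
    have := congrArg φ h4
    rw [map_mul, map_mul, h5, mul_zero, mul_zero, map_pow] at this
    exact pow_ne_zero _ h0 this
  refine ⟨h * r0, by rw [map_mul, map_mul]; exact mul_ne_zero h0 h5, ?_⟩
  have l1 : n.loc (h * r0) ≤ n.loc h := loc_mul_le_left _ _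
  have l2 : n.loc (h * r0) ≤ m' := l1.trans hle
  have hur0 : IsUnit (rs (loc_le (g := h * r0)) r0) := loc_unit (loc_mul_le_right _ _) _
  have hur : IsUnit (rs l1 r) := by
    have := congrArg (rs l1) hr0
    rw [map_mul, rs_rs] at this
    rw [this] at hur0
    exact isUnit_of_mul_isUnit_right hur0
  have hgr : rs l2 g' = rs (l1.trans hnm) g * rs l1 r := by
    have := congrArg (rs l1) hr
    simpa using this
  refine le_bl l2 ?_ ?_
  · rw [hgr]
    exact (bl_unit (l1.trans (loc_le.trans hn)) _).mul (hur.map (Subring.subtype _))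
  · intro y hy
    rw [hgr]
    obtain ⟨q, hq⟩ := dvd_of_agree (hs := hs) hJ.ge (l1.trans (loc_le.trans hn)) (l1.trans hnm) l2 y
      (Ideal.subset_span hy)
    rw [hq]
    exact mul_dvd_mul_left _ hur.dvd

end Chart
end Site

end

section
namespace Site
variable {A : Type u} [CommRing A] {ι : Type} {f : ι → A} {Y : Site A ι f}
namespace Chart

lemma isLocalization_loc (c : Y.Chart) (g : c.B) :
    @IsLocalization.Away _ _ g (c.loc g).B _ (rs loc_le).toAlgebra := by
  letI : Algebra c.B (c.loc g).B := (rs loc_le).toAlgebra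
  refine ⟨?_, ?_, ?_⟩
  · rintro ⟨_, n, rfl⟩
    change IsUnit (rs loc_le (g ^ n))
    rw [map_pow]
    exact (loc_unit le_rfl _).pow n
  · intro z
    obtain ⟨n, y, h⟩ := loc_surj z
    refine ⟨⟨y, g ^ n, n, rfl⟩, ?_⟩
    change z * rs loc_le (g ^ n) = rs loc_le y
    rw [h, map_pow]; ring
  · intro x y h
    change rs loc_le x = rs loc_le y at h
    have h1 : c.loc (rs le_rfl g) ≤ c := loc_le
    obtain ⟨a, ha⟩ := loc_inj (le_refl c) h1 (x := x) (y := y) (by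
      have e : rs (le_refl c) g = g := rs_self _ _
      have h2 : c.loc (rs le_rfl g) ≤ c.loc g := by rw [e]
      have := congrArg (rs h2) h
      simpa using this)
    exact ⟨⟨g ^ a, a, rfl⟩, by simpa using ha⟩

lemma loc_ideal {c : Y.Chart} {g : c.B} {I : Ideal c.B} {z : c.B}
    (h : rs (loc_le (g := g)) z ∈ I.map (rs (loc_le (g := g)))) : ∃ b : ℕ, g ^ b * z ∈ I := by
  letI : Algebra c.B (c.loc g).B := (rs loc_le).toAlgebra
  haveI : IsLocalization.Away g (c.loc g).B := isLocalization_loc c g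
  obtain ⟨⟨i, ⟨_, n, rfl⟩⟩, h1⟩ := (IsLocalization.mem_map_algebraMap_iff (Submonoid.powers g)
    (c.loc g).B).1 h
  obtain ⟨⟨_, m, rfl⟩, h2⟩ := IsLocalization.exists_of_eq (M := Submonoid.powers g)
    (S := (c.loc g).B) (x := z * g ^ n) (y := i) (by
      rw [map_mul]; exact h1)
  refine ⟨m + n, ?_⟩
  have h3 : g ^ (m + n) * z = g ^ m * i := by
    change g ^ m * (z * g ^ n) = g ^ m * i at h2
    rw [← h2]; ring
  rw [h3]
  exact I.mul_mem_left _ i.2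

lemma local_mem {R : Type u} [CommRing R] (I : Ideal R) (x : R)
    (H : ∀ (k : Type u) [Field k] (φ : R →+* k), ∃ u : R, φ u ≠ 0 ∧ u * x ∈ I) : x ∈ I := by
  by_contra hx
  let Q : Ideal R := I.colon {x}
  have hQ : Q ≠ ⊤ := fun h => hx (by
    have : (1 : R) ∈ Q := h ▸ Submodule.mem_top
    simpa [Q, Submodule.mem_colon_singleton] using this)
  obtain ⟨M, hM, hQM⟩ := Ideal.exists_le_maximal Q hQ
  letI := Ideal.Quotient.field M
  obtain ⟨v, hv, hv'⟩ := H (R ⧸ M) (Ideal.Quotient.mk M)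
  refine hv (Ideal.Quotient.eq_zero_iff_mem.2 (hQM ?_))
  simpa [Q, Submodule.mem_colon_singleton] using hv'

/-- extension of an ideal to other charts -/
def ext (c : Y.Chart) (J : Ideal c.B) (m : Y.Chart) : Ideal m.B :=
  (J.map (rs (inf_right (c := m) (d := c)))).comap (rs inf_left)

abbrev Agree {m m' : Y.Chart} (I : Ideal m.B) (I' : Ideal m'.B) : Prop :=
  I.map (rs (inf_left (c := m) (d := m'))) = I'.map (rs inf_right)

lemma Agree.symm {m m' : Y.Chart} {I : Ideal m.B} {I' : Ideal m'.B} (h : Agree I I') :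
    Agree I' I := by
  have := congrArg (Ideal.map (rs (le_inf' (inf_right (c := m') (d := m)) inf_left))) h
  rw [Ideal.map_map, Ideal.map_map, rs_comp, rs_comp] at this
  exact this.symm

lemma ext_self (c : Y.Chart) (J : Ideal c.B) : c.ext J c = J := by
  refine le_antisymm (fun x hx => ?_) Ideal.le_comap_map
  have := Ideal.mem_map_of_mem (rs (le_inf' (le_refl c) le_rfl)) (Ideal.mem_comap.1 hx)
  rw [Ideal.map_map, rs_comp, rs_rs, rs_self] at this
  have e : (rs ((le_inf' (le_refl c) le_rfl).trans inf_right) : c.B →+* c.B) = RingHom.id _ :=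
    RingHom.ext fun x => rs_self _ _
  rwa [e, Ideal.map_id] at this

lemma ext_triv {c : Y.Chart} {J : Ideal c.B} {K : ℕ} (h : c.fm ^ K ∈ J) (m : Y.Chart) :
    m.fm ^ K ∈ c.ext J m := by
  obtain ⟨b, hb, hb'⟩ := c.div m.i
  have : rs (inf_left (c := m) (d := c)) m.fm = rs inf_right c.fm * rs inf_right ⟨b, hb⟩ := by
    refine Subtype.ext ?_
    have := congrArg (Y.res (inf_right (c := m) (d := c)).1) hb'
    simp only [rs_val, Subring.coe_mul, fm_val]
    rw [Y.res_al, Y.res_al]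
    rwa [map_mul, Y.res_al, Y.res_al] at this
  rw [ext, Ideal.mem_comap, map_pow, this, mul_pow, ← map_pow]
  exact Ideal.mul_mem_right _ _ (Ideal.mem_map_of_mem _ h)

lemma ext_agree_self {c m : Y.Chart} (J : Ideal c.B) (h : Tame m c) : Agree (c.ext J m) J := by
  refine le_antisymm Ideal.map_comap_le ?_
  rw [Ideal.map_le_iff_le_comap]
  intro x hx
  rw [Ideal.mem_comap]
  refine local_mem _ _ fun k _ φ => ?_
  obtain ⟨g, hg, hle⟩ := h k φ
  obtain ⟨a, y, hy⟩ := exists_num hle inf_left inf_right x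
  refine ⟨rs inf_left g ^ a, by rw [map_pow]; exact pow_ne_zero _ hg, ?_⟩
  rw [← hy]
  refine Ideal.mem_map_of_mem _ ?_
  rw [ext, Ideal.mem_comap, hy]
  exact Ideal.mul_mem_left _ _ (Ideal.mem_map_of_mem _ hx)

lemma ext_agree_le {c m m' : Y.Chart} (J : Ideal c.B) (h : Tame m m') :
    (c.ext J m').map (rs (inf_right (c := m) (d := m'))) ≤ (c.ext J m).map (rs inf_left) := by
  rw [Ideal.map_le_iff_le_comap]
  intro x hx
  rw [Ideal.mem_comap]
  refine local_mem _ _ fun k _ φ => ?_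
  obtain ⟨g, hg, hle⟩ := h k φ
  obtain ⟨a, y, hy⟩ := exists_num hle inf_left inf_right x
  set q := m.inf c
  set e := q.loc (rs inf_left g)
  have em : e ≤ m := loc_le.trans inf_left
  have em' : e ≤ m' := (loc_mono inf_left g).trans hle
  have ec : e ≤ c := loc_le.trans inf_right
  have h1 : rs em y = rs em g ^ a * rs em' x := by
    have := congrArg (rs (le_inf' em em')) hy
    simpa using this
  have h2 : rs em' x ∈ (J.map (rs (inf_right (c := m) (d := c)))).map (rs (loc_le : e ≤ q)) := by
    have := Ideal.mem_map_of_mem (rs (le_inf' em' ec)) (Ideal.mem_comap.1 hx)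
    rw [Ideal.map_map, rs_comp, rs_rs] at this
    rwa [Ideal.map_map, rs_comp]
  obtain ⟨b, hb⟩ := loc_ideal (c := q) (g := rs inf_left g) (z := rs inf_left y)
    (I := J.map (rs (inf_right (c := m) (d := c)))) (by
      rw [rs_rs, h1]; exact Ideal.mul_mem_left _ _ h2)
  refine ⟨rs inf_left g ^ (b + a), by rw [map_pow]; exact pow_ne_zero _ hg, ?_⟩
  have : rs (inf_left (c := m) (d := m')) g ^ (b + a) * rs inf_right x =
      rs inf_left (g ^ b * y) := by
    rw [map_mul, hy, map_pow]; ring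
  rw [this]
  refine Ideal.mem_map_of_mem _ ?_
  rw [ext, Ideal.mem_comap, map_mul, map_pow]
  exact hb

lemma ext_agree {c m m' : Y.Chart} (J : Ideal c.B) (h : Tame m m') (h' : Tame m' m) :
    Agree (c.ext J m) (c.ext J m') := by
  refine le_antisymm ?_ (ext_agree_le J h)
  have := Ideal.map_mono (f := rs (le_inf' (inf_right (c := m) (d := m')) inf_left))
    (ext_agree_le (c := c) J h')
  rwa [Ideal.map_map, Ideal.map_map, rs_comp, rs_comp] at this

open Pointwise in
lemma combine {κ : Type*} (c : Y.Chart) (I : Finset κ) (s : κ → Finset c.B) :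
    ∃ t : Finset c.B, Ideal.span (t : Set c.B) = ∏ j ∈ I, Ideal.span (s j : Set c.B) ∧
      ∀ g ∈ t, ∀ j ∈ I, ∃ g' ∈ s j, ∀ (h : Triv c t) (h' : Triv c (s j)),
        c.bl t g h ≤ c.bl (s j) g' h' := by
  classical
  induction I using Finset.induction_on with
  | empty => exact ⟨{1}, by simp, by simp⟩
  | insert j I hj ih =>
    obtain ⟨t, ht, ht'⟩ := ih
    refine ⟨s j * t, ?_, ?_⟩
    · rw [Finset.prod_insert hj, ← ht, Ideal.span_mul_span', Finset.coe_mul]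
    · intro g hg l hl
      obtain ⟨a, ha, b, hb, rfl⟩ := Finset.mem_mul.1 hg
      have key : ∀ (h : Triv c (s j * t)), IsUnit (rs (bl_le (hs := h) (g := a * b)) a).1 ∧
        IsUnit (rs (bl_le (hs := h) (g := a * b)) b).1 := by
        intro h
        have := bl_unit (le_refl (c.bl (s j * t) (a * b) h)) bl_le
        rw [map_mul, Subring.coe_mul] at this
        exact ⟨isUnit_of_mul_isUnit_left this, isUnit_of_mul_isUnit_right this⟩
      rcases Finset.mem_insert.1 hl with rfl | hl
      · refine ⟨a, ha, fun h h' => le_bl bl_le (key h).1 fun y hy => ?_⟩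
        obtain ⟨r, hr⟩ := bl_dvd_mem (le_refl (c.bl (s l * t) (a * b) h)) bl_le (y * b)
          (Finset.mul_mem_mul hy hb)
        refine ⟨r, eq_of_unit_mul (key h).2 ?_⟩
        rw [map_mul, map_mul] at hr
        linear_combination hr
      · obtain ⟨g', hg', H⟩ := ht' b hb l hl
        refine ⟨g', hg', fun h h' => ?_⟩
        have hT : Triv c t := by
          obtain ⟨K, hK⟩ := h
          refine ⟨K, ?_⟩
          have e : Ideal.span ((s j * t : Finset c.B) : Set c.B) ≤ Ideal.span (t : Set c.B) := by
            rw [Finset.coe_mul, ← Ideal.span_mul_span']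
            exact Ideal.mul_le.2 fun _ _ b hb => Ideal.mul_mem_left _ _ hb
          exact e hK
        refine le_trans (le_bl (hs := hT) bl_le (key h).2 fun y hy => ?_) (H hT h')
        obtain ⟨r, hr⟩ := bl_dvd_mem (le_refl (c.bl (s j * t) (a * b) h)) bl_le (a * y)
          (Finset.mul_mem_mul ha hy)
        refine ⟨r, eq_of_unit_mul (key h).1 ?_⟩
        rw [map_mul, map_mul] at hr
        linear_combination hr

lemma triv_of_prod {κ : Type*} {c : Y.Chart} {I : Finset κ} {s : κ → Finset c.B} {t : Finset c.B}
    (ht : Ideal.span (t : Set c.B) = ∏ j ∈ I, Ideal.span (s j : Set c.B))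
    (h : ∀ j ∈ I, Triv c (s j)) : Triv c t := by
  classical
  choose! K hK using h
  refine ⟨∑ j ∈ I, K j, ?_⟩
  rw [ht, ← Finset.prod_pow_eq_pow_sum]
  exact Ideal.prod_mem_prod hK

end Chart
end Site

end

section
namespace Site
variable {A : Type u} [CommRing A] {ι : Type} {f : ι → A} {Y : Site A ι f}
namespace Chart

lemma fm_unit {m n : Y.Chart} (k : n ≤ m) (a : ℕ) : IsUnit (rs k (m.fm ^ a)).1 := by
  rw [rs_val, Subring.coe_pow, map_pow]
  exact (unit_res _ m.unit).pow _

lemma ptame_step1 {m c n : Y.Chart} (r : Finset m.B) (N : ℕ)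
    (hN : rs (inf_left (c := m) (d := c)) (m.fm ^ N) ∈ Ideal.span (rs inf_left '' (r : Set m.B)))
    (k : Type u) [Field k] (φ : (n.inf c).B →+* k) (hn : n ≤ m)
    (g1 : m.B) (hg1 : g1 = m.fm ^ N ∨ g1 ∈ r)
    (hd : ∀ y, y = m.fm ^ N ∨ y ∈ r → rs hn g1 ∣ rs hn y) :
    ∃ a ∈ r, ∃ e : n.B, φ (rs inf_left e) ≠ 0 ∧ ∃ u : (n.loc e).B,
      rs (loc_le.trans hn) (m.fm ^ N) = rs (loc_le.trans hn) a * u := by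
  rcases hg1 with rfl | hg1
  · choose! e he using fun a (ha : a ∈ r) => hd a (Or.inr ha)
    by_contra! H
    have h1 : ∀ a ∈ r, φ (rs inf_left (e a)) = 0 := by
      intro a ha
      by_contra h0
      obtain ⟨u, hu⟩ := loc_unit (le_refl (n.loc (e a))) loc_le
      refine H a ha (e a) h0 ↑u⁻¹ ?_
      have := congrArg (rs (loc_le (g := e a))) (he a ha)
      rw [rs_rs, map_mul, rs_rs, ← hu] at this
      rw [this, mul_assoc, Units.mul_inv, mul_one]
    have h2 : Ideal.span (rs inf_left '' (r : Set m.B)) ≤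
        (Ideal.span {rs (inf_left.trans hn : n.inf c ≤ m) (m.fm ^ N)} * RingHom.ker φ).comap
          (rs (inf_mono hn (le_refl c))) := by
      rw [Ideal.span_le]
      rintro _ ⟨a, ha, rfl⟩
      rw [SetLike.mem_coe, Ideal.mem_comap]
      have := congrArg (rs (inf_left (c := n) (d := c))) (he a ha)
      rw [rs_rs, map_mul, rs_rs] at this
      rw [rs_rs, this]
      exact Ideal.mul_mem_mul (Ideal.mem_span_singleton_self _) (h1 a ha)
    have h3 := h2 hN
    rw [Ideal.mem_comap, rs_rs, Ideal.mem_span_singleton_mul] at h3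
    obtain ⟨z, hz, hz'⟩ := h3
    have : z = 1 := eq_of_unit_mul (fm_unit (inf_left.trans hn : n.inf c ≤ m) N) (by
      rw [hz', mul_one])
    rw [this, RingHom.mem_ker, map_one] at hz
    exact one_ne_zero hz
  · obtain ⟨u, hu⟩ := hd _ (Or.inl rfl)
    refine ⟨g1, hg1, 1, by simp, rs loc_le u, ?_⟩
    have := congrArg (rs (loc_le (g := (1 : n.B)))) hu
    rwa [rs_rs, map_mul, rs_rs] at this

lemma ptame_step2 {m c n : Y.Chart} (N : ℕ)
    (k : Type u) [Field k] (φ : (n.inf c).B →+* k) (hn : n ≤ m) (a : m.B) (e : n.B)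
    (he : φ (rs inf_left e) ≠ 0) (u : (n.loc e).B)
    (hu : rs (loc_le.trans hn) (m.fm ^ N) = rs (loc_le.trans hn) a * u)
    (y : Y.R c.V) (hy : y ∈ c.B) (q l : ℕ) (w : m.B)
    (hw : ∀ (p : Y.L) (hm : p ≤ m.V) (hc : p ≤ c.V), IsUnit (Y.res hm a) →
      Y.res hm w = Y.res hm (a ^ q * m.fm ^ l : m.B) * Y.res hc y)
    (hV : (n.loc e).V ≤ c.V)
    (g : m.B) (hg : g = a ^ q * m.fm ^ l ∨ g = w ∨ g = m.fm ^ (N * q + l))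
    (hgu : IsUnit (rs hn g).1)
    (hd : ∀ y, y = a ^ q * m.fm ^ l ∨ y = w ∨ y = m.fm ^ (N * q + l) → rs hn g ∣ rs hn y) :
    ∃ e' : n.B, φ (rs inf_left e') ≠ 0 ∧ ∀ (p : Y.Chart) (hp : p ≤ n.loc e),
      IsUnit (rs (hp.trans loc_le) e') → Y.res (hp.1.trans hV) y ∈ p.B := by
  let o := n.loc e
  have ho : o ≤ m := loc_le.trans hn
  have hau : IsUnit (rs ho a).1 := by
    have := congrArg Subtype.val hu
    rw [Subring.coe_mul] at this
    exact isUnit_of_mul_isUnit_left (this ▸ fm_unit ho N)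
  have hw' := hw o.V ho.1 hV hau
  -- reduce to `o`
  have red : (Y.res hV y ∈ o.B) → ∃ e' : n.B, φ (rs inf_left e') ≠ 0 ∧ ∀ (p : Y.Chart) (hp : p ≤ o),
      IsUnit (rs (hp.trans loc_le) e') → Y.res (hp.1.trans hV) y ∈ p.B := by
    intro h
    refine ⟨1, by simp, fun p hp _ => ?_⟩
    rw [← Y.res_res hp.1 hV]; exact hp.2 _ h
  have hun : IsUnit (rs ho (a ^ q * m.fm ^ l)).1 := by
    rw [map_mul, Subring.coe_mul, map_pow, Subring.coe_pow]
    exact (hau.pow _).mul (fm_unit ho l)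
  rcases hg with rfl | rfl | rfl
  · apply red
    obtain ⟨b, hb⟩ := hd w (by simp)
    have h1 := congrArg (fun z => (rs (loc_le (g := e)) z).1) hb
    simp only [map_mul, rs_rs, Subring.coe_mul] at h1
    rw [← Subring.coe_mul, ← map_mul] at h1
    have h2 : (rs ho w).1 = (rs ho (a ^ q * m.fm ^ l)).1 * Y.res hV y := hw'
    have h3 : Y.res hV y = (rs (loc_le (g := e)) b).1 :=
      hun.mul_left_cancel (h2.symm.trans h1)
    rw [h3]; exact Subtype.prop _
  · obtain ⟨e', he'⟩ := hd (a ^ q * m.fm ^ l) (by simp)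
    have hgu' : IsUnit (rs ho g).1 := by
      rw [← rs_rs loc_le hn]; exact unit_res _ hgu
    have h1 : (rs ho (a ^ q * m.fm ^ l)).1 = (rs ho g).1 * (rs (loc_le : o ≤ n) e').1 := by
      have := congrArg (rs (loc_le : o ≤ n)) he'
      rw [rs_rs, map_mul (rs (loc_le : o ≤ n)) (rs hn g), rs_rs] at this
      exact congrArg Subtype.val this
    have h2 : (rs ho g).1 = (rs ho (a ^ q * m.fm ^ l)).1 * Y.res hV y := hw'
    have h3 : (rs (loc_le : o ≤ n) e').1 * Y.res hV y = 1 := by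
      apply hgu'.mul_left_cancel
      rw [← mul_assoc, ← h1, ← h2, mul_one]
    refine ⟨e', ?_, ?_⟩
    · -- φ e' ≠ 0
      have h4 : rs (loc_le (g := rs (inf_left (c := n) (d := c)) e)) 
          (rs inf_left e' * rs inf_right ⟨y, hy⟩) = 
          rs (loc_le (g := rs (inf_left (c := n) (d := c)) e)) 1 := by
        have hoo := loc_mono (inf_left (c := n) (d := c)) e
        rw [map_mul, map_one, rs_rs, rs_rs]
        apply Subtype.ext
        have := congrArg (Y.res hoo.1) h3
        rw [map_mul, map_one, Y.res_res] at this
        rw [← rs_rs hoo loc_le]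
        exact this
      obtain ⟨b, hb⟩ := loc_inj inf_left loc_le h4
      intro h0
      have := congrArg φ hb
      rw [map_mul, map_mul, h0, zero_mul, mul_zero, mul_one, map_pow] at this
      exact pow_ne_zero _ he this.symm
    · intro p hp hup
      obtain ⟨v, hv⟩ := hup
      have h5 := congrArg (Y.res hp.1) h3
      rw [map_mul, map_one, Y.res_res] at h5
      have h6 : Y.res hp.1 (rs (loc_le : o ≤ n) e').1 = v.val.1 := by
        rw [hv, ← rs_rs hp loc_le]; rfl
      rw [h6] at h5
      have h7 : Y.res (hp.1.trans hV) y = v.inv.1 := by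
        have : v.val.1 * v.inv.1 = 1 := by rw [← Subring.coe_mul, v.val_inv]; rfl
        have hvu : IsUnit v.val.1 := IsUnit.of_mul_eq_one _ this
        exact hvu.mul_left_cancel (h5.trans this.symm)
      rw [h7]; exact Subtype.prop _
  · apply red
    obtain ⟨b, hb⟩ := hd w (by simp)
    have h1 : (rs ho w) = (rs ho (m.fm ^ (N * q + l))) * (rs (loc_le : o ≤ n) b) := by
      have := congrArg (fun z => (rs (loc_le : o ≤ n) z)) hb
      simpa only [map_mul, rs_rs] using this
    have h2 : (rs ho w).1 = (rs ho (a ^ q * m.fm ^ l)).1 * Y.res hV y := hw'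
    have h3 : rs ho w = rs ho (a ^ q * m.fm ^ l) * (u ^ q * rs (loc_le : o ≤ n) b) := by
      rw [h1, pow_add, pow_mul, map_mul, map_pow (rs ho) (m.fm ^ N) q, hu, map_mul (rs ho) (a ^ q),
        map_pow (rs ho) a q]
      ring
    have h4 : Y.res hV y = (u ^ q * rs (loc_le : o ≤ n) b).1 := by
      apply hun.mul_left_cancel
      rw [← h2, h3]; rfl
    rw [h4]; exact Subtype.prop _

lemma ptame_aux {m c : Y.Chart} (r : Finset m.B) (N : ℕ)
    (hr : ∀ a ∈ r, ∀ (p : Y.L) (hm : p ≤ m.V), IsUnit (Y.res hm a) → p ≤ c.V)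
    (hN : rs (inf_left (c := m) (d := c)) (m.fm ^ N) ∈ Ideal.span (rs inf_left '' (r : Set m.B)))
    (t : Finset (Y.R c.V)) (ht : Subring.closure (t : Set (Y.R c.V)) = c.B)
    (hw : ∀ a ∈ r, ∀ y ∈ t, ∃ (q l : ℕ) (w : m.B), ∀ (p : Y.L) (hm : p ≤ m.V) (hc : p ≤ c.V),
      IsUnit (Y.res hm a) →
      Y.res hm w = Y.res hm (a ^ q * m.fm ^ l : m.B) * Y.res hc y) :
    ∃ s : Finset m.B, Triv m s ∧ ∀ g ∈ s, ∀ hs n, n ≤ m.bl s g hs → Tame n c := by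
  classical
  choose! q l w hw using hw
  let S : Option (m.B × Y.R c.V) → Finset m.B := fun o => o.elim (insert (m.fm ^ N) r)
    fun ay => {ay.1 ^ q ay.1 ay.2 * m.fm ^ l ay.1 ay.2, w ay.1 ay.2,
      m.fm ^ (N * q ay.1 ay.2 + l ay.1 ay.2)}
  let I := Finset.insertNone (r ×ˢ t)
  obtain ⟨s, hs, hs'⟩ := combine m I S
  have hS : ∀ j, Triv m (S j) := by
    rintro (_ | ⟨a, y⟩)
    · exact ⟨N, Ideal.subset_span (by simp [S])⟩
    · exact ⟨N * q a y + l a y, Ideal.subset_span (by simp [S])⟩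
  refine ⟨s, triv_of_prod hs fun j _ => hS j, ?_⟩
  intro g hg hT n hn k _ φ
  have hnm : n ≤ m := hn.trans bl_le
  obtain ⟨g1, hg1, hg1'⟩ := hs' g hg none (by simp [I])
  have hn1 := hn.trans (hg1' hT (hS _))
  obtain ⟨a, ha, e, he, u, hu⟩ := ptame_step1 r N hN k φ hnm g1 (by simpa [S] using hg1)
    (fun y hy => bl_dvd_mem hn1 hnm y (by simpa [S] using hy))
  have hV : (n.loc e).V ≤ c.V := by
    refine hr a ha _ (loc_le.trans hnm).1 ?_
    have := congrArg Subtype.val hu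
    rw [Subring.coe_mul] at this
    exact isUnit_of_mul_isUnit_left (this ▸ fm_unit _ N)
  have key : ∀ y ∈ t, ∃ e' : n.B, φ (rs inf_left e') ≠ 0 ∧ ∀ (p : Y.Chart) (hp : p ≤ n.loc e),
      IsUnit (rs (hp.trans loc_le) e') → Y.res (hp.1.trans hV) y ∈ p.B := by
    intro y hy
    obtain ⟨g2, hg2, hg2'⟩ := hs' g hg (some (a, y)) (by simp [I, ha, hy])
    have hn2 := hn.trans (hg2' hT (hS _))
    exact ptame_step2 N k φ hnm a e he u hu y (ht ▸ Subring.subset_closure hy) (q a y) (l a y)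
      (w a y) (hw a ha y hy) hV g2 (by simpa [S] using hg2) (bl_unit hn2 hnm)
      (fun z hz => bl_dvd_mem hn2 hnm z (by simpa [S] using hz))
  choose! e' he' h' using key
  refine ⟨e * ∏ y ∈ t, e' y, ?_, ?_⟩
  · rw [map_mul, map_mul, map_prod, map_prod]
    exact mul_ne_zero he (Finset.prod_ne_zero_iff.2 he')
  · have l1 : n.loc (e * ∏ y ∈ t, e' y) ≤ n.loc e := loc_mul_le_left _ _
    have hB : c.B ≤ (n.loc (e * ∏ y ∈ t, e' y)).B.comap (Y.res (l1.1.trans hV)) := by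
      rw [← ht, Subring.closure_le]
      intro y hy
      refine h' y hy _ l1 ?_
      have : IsUnit (rs (loc_le (g := e * ∏ y ∈ t, e' y)) (∏ y ∈ t, e' y)) :=
        loc_unit (loc_mul_le_right _ _) _
      exact isUnit_of_dvd_unit (map_dvd _ (Finset.dvd_prod_of_mem e' hy)) this
    exact ⟨l1.1.trans hV, fun x hx => hB hx⟩

lemma good_fin (c : Y.Chart) (T : Finset (Y.R c.V)) : ∃ (n : ℕ) (s : Finset A),
    ∀ s' : Finset A, s ⊆ s' → ∀ x ∈ T, Y.al c.V (f c.i) ^ n * x ∈ (c.enl s').B := by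
  classical
  choose n s hs h using c.good
  refine ⟨∑ x ∈ T, n x, T.biUnion fun x => (hs x).toFinset, fun s' hs' x hx => ?_⟩
  have h1 : Y.al c.V (f c.i) ^ n x * x ∈ (c.enl s').B := by
    refine good_set_mono c.B ?_ (h x)
    refine subset_trans ?_ (Finset.coe_subset.2 hs')
    intro a ha
    simp only [Finset.coe_biUnion, Set.mem_iUnion]
    exact ⟨x, hx, by simpa using ha⟩
  rw [← Finset.add_sum_erase _ _ hx, pow_add, mul_comm (_ ^ n x), mul_assoc]
  exact mul_mem (pow_mem (c.enl s').fmem _) h1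

lemma ptame (m c : Y.Chart) : ∃ l0 : Finset A, ∀ l : Finset A, l0 ⊆ l →
    ∃ s : Finset (m.enl l).B, Triv (m.enl l) s ∧
      ∀ g ∈ s, ∀ hs n, n ≤ (m.enl l).bl s g hs → Tame n c := by
  classical
  obtain ⟨r, hr, hr1⟩ := Y.cov m.V c.V
  obtain ⟨t, ht, htc⟩ := c.fg
  lift t to Finset (Y.R c.V) using ht
  -- numerators
  have h0 : ∀ a ∈ r, ∀ y ∈ t, ∃ (q : ℕ) (z : Y.R m.V),
      ∀ (p : Y.L) (hm : p ≤ m.V) (hc : p ≤ c.V),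
      IsUnit (Y.res hm a) → Y.res hm z = Y.res hm a ^ q * Y.res hc y := by
    intro a ha y hy
    obtain ⟨q, z, hz⟩ := Y.D_surj m.V a (Y.res (hr a ha) y)
    refine ⟨q, z, fun p hm hc hu => ?_⟩
    have := congrArg (Y.res (Y.le_D hm a hu)) hz
    rwa [map_mul, map_pow, Y.res_res, Y.res_res, Y.res_res] at this
  choose! q z hz using h0
  obtain ⟨n1, l1, h1⟩ := good_fin m r
  obtain ⟨n2, l2, h2⟩ := good_fin m ((r ×ˢ t).image fun ay => z ay.1 ay.2)
  have h3 : (1 : Y.R (m.V ⊓ c.V)) ∈ Ideal.span (Y.res (inf_le_left : m.V ⊓ c.V ≤ m.V) '' r) := by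
    rw [hr1]; exact Submodule.mem_top
  obtain ⟨b, hb⟩ := (Submodule.mem_span_image_finset_iff_exists_fun' _).1 h3
  obtain ⟨n3, l3, h3'⟩ := good_fin (m.inf c) (r.image b)
  refine ⟨l1 ∪ l2 ∪ l3, fun l hl => ?_⟩
  have hl1 : l1 ⊆ l := (Finset.subset_union_left.trans Finset.subset_union_left).trans hl
  have hl2 : l2 ⊆ l := (Finset.subset_union_right.trans Finset.subset_union_left).trans hl
  have hl3 : l3 ⊆ l := Finset.subset_union_right.trans hl
  set m' := m.enl l with hm'
  let F : Y.R m.V := Y.al m.V (f m.i)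
  have hF : ∀ {p : Y.L} (hp : p ≤ m.V), IsUnit (Y.res hp F) := fun hp => unit_res _ m.unit
  let a' : {a // a ∈ r} → m'.B := fun a => ⟨F ^ n1 * a.1, h1 l hl1 a.1 a.2⟩
  have ha' : ∀ a {p : Y.L} (hp : p ≤ m.V), Y.res hp (a' a).1 = Y.res hp F ^ n1 * Y.res hp a.1 := by
    intro a p hp
    have : (a' a).1 = F ^ n1 * a.1 := rfl
    refine Eq.trans (congrArg (Y.res hp) this) ?_
    rw [map_mul, map_pow]
  have hu' : ∀ a {p : Y.L} (hp : p ≤ m.V), IsUnit (Y.res hp (a' a).1) → IsUnit (Y.res hp a.1) := by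
    intro a p hp h
    rw [ha'] at h
    exact isUnit_of_mul_isUnit_right h
  refine ptame_aux (m := m') (c := c) (r.attach.image a') (n3 + n1) ?_ ?_ t htc ?_
  · intro a ha p hp hu
    obtain ⟨a, -, rfl⟩ := Finset.mem_image.1 ha
    exact (Y.le_D hp a.1 (hu' a hp hu)).trans (hr a.1 a.2)
  · have hB : ∀ a ∈ r, Y.al (m.V ⊓ c.V) (f m.i) ^ n3 * b a ∈ (m'.inf c).B := by
      intro a ha
      have k1 : m'.inf c ≤ (m.inf c).enl l :=
        le_enl (inf_mono (enl_le _ _) le_rfl) ((enl_has m l).mono inf_left)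
      have := k1.2 _ (h3' l hl3 (b a) (Finset.mem_image_of_mem _ ha))
      have e : ∀ x : Y.R (m.V ⊓ c.V), Y.res (le_refl (m.V ⊓ c.V)) x = x := fun x => Y.res_self _ _
      exact (e (Y.al (m.V ⊓ c.V) (f m.i) ^ n3 * b a)) ▸ this
    have e1 : rs (inf_left (c := m') (d := c)) (m'.fm ^ (n3 + n1)) =
        ∑ a ∈ r.attach, (⟨_, hB a.1 a.2⟩ : (m'.inf c).B) * rs inf_left (a' a) := by
      apply Subtype.ext
      have e2 : Y.res (inf_le_left : m.V ⊓ c.V ≤ m.V) (F ^ (n3 + n1)) =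
        ∑ a ∈ r.attach, (Y.al (m.V ⊓ c.V) (f m.i) ^ n3 * b a) * Y.res inf_le_left (F ^ n1 * a.1) := by
        simp only [smul_eq_mul] at hb ⊢
        rw [← Finset.sum_attach] at hb
        rw [map_pow, ← mul_one (_ ^ _), ← hb, Finset.mul_sum]
        refine Finset.sum_congr rfl fun a _ => ?_
        simp only [F, Y.res_al, map_mul, map_pow]
        ring
      refine Eq.trans e2 ?_
      rw [AddSubmonoidClass.coe_finsetSum]
      rfl
    rw [e1]
    refine Ideal.sum_mem _ fun a _ => Ideal.mul_mem_left _ _ (Ideal.subset_span ⟨a' a, ?_, rfl⟩)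
    exact Finset.mem_coe.2 (Finset.mem_image_of_mem _ (Finset.mem_attach _ _))
  · intro a ha y hy
    obtain ⟨a, -, rfl⟩ := Finset.mem_image.1 ha
    have hw : F ^ (n1 * q a.1 y) * (F ^ n2 * z a.1 y) ∈ m'.B :=
      mul_mem (pow_mem m'.fmem _) (h2 l hl2 _ (Finset.mem_image.2
        ⟨(a.1, y), Finset.mk_mem_product a.2 hy, rfl⟩))
    refine ⟨q a.1 y, n2, ⟨_, hw⟩, fun p hp hc hu => ?_⟩
    have e3 : Y.res (show p ≤ m.V from hp) (F ^ (n1 * q a.1 y) * (F ^ n2 * z a.1 y)) =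
      Y.res (show p ≤ m.V from hp) ((F ^ n1 * a.1) ^ q a.1 y * F ^ n2) * Y.res hc y := by
      rw [map_mul, map_mul, hz a.1 a.2 y hy p hp hc (hu' a hp hu)]
      simp only [map_pow, map_mul]
      ring
    exact e3

end Chart
end Site

end

section
namespace Site
variable {A : Type u} [CommRing A] {ι : Type} {f : ι → A}

/-- a point with a valuation ring in its residue field -/
structure Pl (Y : Site A ι f) where
  mem : Y.L → Prop
  K : Type u
  [fld : Field K]
  ev : ∀ V, mem V → Y.R V →+* K
  ev_res : ∀ {V W : Y.L} (h : V ≤ W) (hV : mem V) (hW : mem W) (x : Y.R W),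
    ev V hV (Y.res h x) = ev W hW x
  mem_D : ∀ (V : Y.L) (g : Y.R V) (h : mem V), ev V h g ≠ 0 → mem (Y.D V g)
  O : ValuationSubring K

attribute [instance] Pl.fld

variable {Y : Site A ι f}

namespace Pl
def On (P : Y.Pl) (c : Y.Chart) : Prop := ∃ h : P.mem c.V, ∀ x ∈ c.B, P.ev _ h x ∈ P.O
def Has (P : Y.Pl) (l : Finset A) : Prop := ∀ V (h : P.mem V), ∀ a ∈ l, P.ev V h (Y.al V a) ∈ P.O

lemma Has.subset {P : Y.Pl} {s t : Finset A} (h : P.Has t) (k : s ⊆ t) : P.Has s :=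
  fun V hV a ha => h V hV a (k ha)

lemma On.enl {P : Y.Pl} {c : Y.Chart} (h : P.On c) {l : Finset A} (hl : P.Has l) :
    P.On (c.enl l) := by
  obtain ⟨h, hB⟩ := h
  have : c.B ⊔ Subring.closure (Y.al c.V '' l) ≤ P.O.toSubring.comap (P.ev _ h) := by
    refine sup_le hB ?_
    rw [Subring.closure_le]
    rintro _ ⟨a, ha, rfl⟩
    exact hl _ h a ha
  exact ⟨h, fun x hx => this hx⟩

lemma On.bl {P : Y.Pl} {c : Y.Chart} (h : P.On c) (s : Finset c.B) (hs : Chart.Triv c s) :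
    ∃ g ∈ s, P.On (c.bl s g hs) := by
  obtain ⟨h, hB⟩ := h
  have hne : ∃ y ∈ s, P.ev _ h y.1 ≠ 0 := by
    by_contra! H
    obtain ⟨K, hK⟩ := hs
    have : Ideal.span (s : Set c.B) ≤ RingHom.ker ((P.ev _ h).comp c.B.subtype) := by
      rw [Ideal.span_le]; exact fun y hy => H y hy
    have h1 := this hK
    rw [RingHom.mem_ker, map_pow] at h1
    exact pow_ne_zero _ ((c.unit.map (P.ev _ h)).ne_zero) h1
  obtain ⟨y0, hy0, hy0'⟩ := hne
  obtain ⟨g, hg, hmax⟩ := s.exists_max_image (fun y => P.O.valuation (P.ev _ h y.1)) ⟨y0, hy0⟩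
  have hg0 : P.ev _ h g.1 ≠ 0 := by
    intro h0
    have := hmax y0 hy0
    rw [h0, map_zero, le_zero_iff, map_eq_zero] at this
    exact hy0' this
  refine ⟨g, hg, P.mem_D _ _ h hg0, ?_⟩
  suffices H : Subring.closure (Y.res (Y.D_le c.V g) '' c.B ∪
    {x | ∃ y ∈ s, Y.res (Y.D_le c.V g) y = Y.res (Y.D_le c.V g) g * x}) ≤
    P.O.toSubring.comap (P.ev _ (P.mem_D _ _ h hg0)) from fun x hx => H hx
  rw [Subring.closure_le]
  rintro x (⟨y, hy, rfl⟩ | ⟨y, hy, hxy⟩)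
  · change P.ev _ _ _ ∈ P.O
    rw [P.ev_res _ _ h]; exact hB y hy
  · change P.ev _ _ _ ∈ P.O
    have h1 := congrArg (P.ev _ (P.mem_D _ _ h hg0)) hxy
    rw [map_mul, P.ev_res _ _ h, P.ev_res _ _ h] at h1
    have h2 := hmax y hy
    rw [h1, map_mul] at h2
    rw [← ValuationSubring.valuation_le_one_iff]
    have h3 : 0 < P.O.valuation (P.ev _ h g.1) := by
      rw [zero_lt_iff]; simpa using hg0
    exact (mul_le_iff_le_one_right h3).1 h2

end Pl

namespace Chart
def Atlas (M : Set Y.Chart) : Prop := ∀ n ∈ M, ∀ c ∈ M, Tame n c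

lemma Atlas.enl {M : Set Y.Chart} (h : Atlas M) (l : Finset A) : Atlas ((fun c => enl c l) '' M) := by
  rintro _ ⟨n, hn, rfl⟩ _ ⟨c, hc, rfl⟩
  exact ((h n hn c hc).mono (enl_le _ _)).enl (enl_has _ _)

lemma blow_atlas (M : Set Y.Chart) (hM : M.Finite) (t : ∀ m : Y.Chart, Finset m.B)
    (ht : ∀ m ∈ M, Triv m (t m))
    (hA : ∀ m ∈ M, ∀ m' ∈ M, Agree (Ideal.span (t m : Set m.B)) (Ideal.span (t m' : Set m'.B)))
    (hT : ∀ m ∈ M, ∀ g ∈ t m, ∀ hs, ∀ m' ∈ M, Tame (m.bl (t m) g hs) m') :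
    ∃ M' : Set Y.Chart, (∀ n ∈ M', ∃ m ∈ M, ∃ g ∈ t m, ∃ hs, n = m.bl (t m) g hs) ∧
      M'.Finite ∧ Atlas M' ∧
      ∀ P : Y.Pl, (∃ m ∈ M, P.On m) → ∃ n ∈ M', P.On n := by
  refine ⟨{n | ∃ m ∈ M, ∃ g ∈ t m, ∃ hs, n = m.bl (t m) g hs}, fun _ h => h, ?_, ?_, ?_⟩
  · have : {n | ∃ m ∈ M, ∃ g ∈ t m, ∃ hs, n = m.bl (t m) g hs} ⊆ 
        ⋃ m ∈ M, (⋃ g ∈ (t m : Set m.B), {n | ∃ hs, n = m.bl (t m) g hs}) := by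
      rintro n ⟨m, hm, g, hg, hs, rfl⟩
      simp only [Set.mem_iUnion]
      exact ⟨m, hm, g, hg, hs, rfl⟩
    refine Set.Finite.subset (hM.biUnion fun m hm => (t m).finite_toSet.biUnion fun g hg => ?_) this
    refine Set.Subsingleton.finite ?_
    rintro _ ⟨_, rfl⟩ _ ⟨_, rfl⟩
    rfl
  · rintro _ ⟨m, hm, g, hg, hs, rfl⟩ _ ⟨m', hm', g', hg', hs', rfl⟩
    exact BLC hg hg' (hA m hm m' hm') (hA m' hm' m hm) le_rfl (hT m hm g hg hs m' hm')
  · rintro P ⟨m, hm, hP⟩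
    obtain ⟨g, hg, h⟩ := hP.bl (t m) (ht m hm)
    exact ⟨_, ⟨m, hm, g, hg, _, rfl⟩, h⟩

lemma exists_gens {m : Y.Chart} (J : Ideal m.B) : ∃ t : Finset m.B, Ideal.span (t : Set m.B) = J :=
  (isNoetherianRing_iff_ideal_fg m.B).1 inferInstance J

lemma Agree.prod {κ : Type*} {m m' : Y.Chart} {I : Finset κ} {J : κ → Ideal m.B}
    {J' : κ → Ideal m'.B} (h : ∀ j ∈ I, Agree (J j) (J' j)) :
    Agree (∏ j ∈ I, J j) (∏ j ∈ I, J' j) := by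
  change Ideal.map _ _ = Ideal.map _ _
  rw [← Ideal.mapHom_apply, ← Ideal.mapHom_apply, map_prod, map_prod]
  exact Finset.prod_congr rfl h

lemma step1 (M : Set Y.Chart) (hM : M.Finite) (hA : Atlas M) (c : Y.Chart) :
    ∃ (l : Finset A) (M' : Set Y.Chart), M'.Finite ∧ Atlas M' ∧ (∀ n ∈ M', Tame n c) ∧
      ∀ P : Y.Pl, P.Has l → (∃ m ∈ M, P.On m) → ∃ n ∈ M', P.On n := by
  classical
  choose l0 hl0 using fun m : Y.Chart => ptame m c
  let l := hM.toFinset.biUnion l0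
  have hl : ∀ m ∈ M, l0 m ⊆ l := fun m hm =>
    Finset.subset_biUnion_of_mem l0 (hM.mem_toFinset.2 hm)
  let M1 := (fun c => enl c l) '' M
  have hM1 : M1.Finite := hM.image _
  have hA1 : Atlas M1 := hA.enl l
  have key : ∀ m : Y.Chart, ∃ s : Finset m.B, m ∈ M1 → (Triv m s ∧
      ∀ g ∈ s, ∀ hs n, n ≤ m.bl s g hs → Tame n c) := by
    intro m
    by_cases hm : m ∈ M1
    · obtain ⟨m, hm', rfl⟩ := hm
      obtain ⟨s, hs, hs'⟩ := hl0 m l (hl m hm')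
      exact ⟨s, fun _ => ⟨hs, hs'⟩⟩
    · exact ⟨∅, fun h => absurd h hm⟩
  choose s hs using key
  have key2 : ∀ m k : Y.Chart, ∃ t : Finset m.B,
      Ideal.span (t : Set m.B) = ext k (Ideal.span (s k : Set k.B)) m ∧ (m = k → t = s m) := by
    intro m k
    by_cases h : m = k
    · subst h
      exact ⟨s m, (ext_self _ _).symm, fun _ => rfl⟩
    · obtain ⟨t, ht⟩ := exists_gens (ext k (Ideal.span (s k : Set k.B)) m)
      exact ⟨t, ht, fun h' => absurd h' h⟩
  choose S hS hS' using key2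
  choose t ht ht' using fun m : Y.Chart => combine m hM1.toFinset (S m)
  have hSt : ∀ m, ∀ k ∈ M1, Triv m (S m k) := by
    intro m k hk
    obtain ⟨K, hK⟩ := (hs k hk).1
    exact ⟨K, by rw [hS]; exact ext_triv hK m⟩
  obtain ⟨M', h1, h2, h3, h4⟩ := blow_atlas M1 hM1 t
    (fun m hm => triv_of_prod (ht m) fun j hj => hSt m j (hM1.mem_toFinset.1 hj))
    (fun m hm m' hm' => by
      rw [ht, ht]
      refine Agree.prod fun k hk => ?_
      rw [hS, hS]
      exact ext_agree _ (hA1 m hm m' hm') (hA1 m' hm' m hm))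
    (fun m hm g hg hs m' hm' => (hA1 m hm m' hm').mono bl_le)
  refine ⟨l, M', h2, h3, ?_, ?_⟩
  · intro n hn
    obtain ⟨m, hm, g, hg, hT, rfl⟩ := h1 n hn
    obtain ⟨g', hg', hle⟩ := ht' m g hg m (hM1.mem_toFinset.2 hm)
    have gen : ∀ u : Finset m.B, u = s m → g' ∈ u → ∀ h5, m.bl (t m) g hT ≤ m.bl u g' h5 →
        Tame (m.bl (t m) g hT) c := by
      rintro _ rfl hg' h5 hle
      exact (hs m hm).2 g' hg' h5 _ hle
    exact gen _ (hS' m m rfl) hg' _ (hle hT (hSt m m hm))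
  · rintro P hP ⟨m, hm, hPm⟩
    exact h4 P ⟨_, ⟨m, hm, rfl⟩, hPm.enl hP⟩

lemma step2 (M : Set Y.Chart) (hM : M.Finite) (hA : Atlas M) (c : Y.Chart)
    (hc : ∀ n ∈ M, Tame n c) :
    ∃ (l : Finset A) (M' : Set Y.Chart), M'.Finite ∧ Atlas M' ∧
      ∀ P : Y.Pl, P.Has l → (P.On c ∨ ∃ m ∈ M, P.On m) → ∃ n ∈ M', P.On n := by
  classical
  choose l0 hl0 using fun m : Y.Chart => ptame c m
  let l := hM.toFinset.biUnion l0
  have hl : ∀ m ∈ M, l0 m ⊆ l := fun m hm =>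
    Finset.subset_biUnion_of_mem l0 (hM.mem_toFinset.2 hm)
  let M1 := (fun c => enl c l) '' M
  have hM1 : M1.Finite := hM.image _
  have hA1 : Atlas M1 := hA.enl l
  let c1 := c.enl l
  have hc1 : ∀ n ∈ M1, Tame n c1 := by
    rintro _ ⟨n, hn, rfl⟩
    exact ((hc n hn).mono (enl_le _ _)).enl (enl_has _ _)
  choose! S hS hS' using fun m (hm : m ∈ M) => hl0 m l (hl m hm)
  obtain ⟨s, hs, hs'⟩ := combine c1 hM.toFinset S
  have hsT : Triv c1 s := triv_of_prod hs fun j hj => hS j (hM.mem_toFinset.1 hj)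
  have hsT' : ∀ g ∈ s, ∀ h, ∀ m ∈ M1, Tame (c1.bl s g h) m := by
    rintro g hg h _ ⟨m, hm, rfl⟩
    obtain ⟨g', hg', hle⟩ := hs' g hg m (hM.mem_toFinset.2 hm)
    exact (hS' m hm g' hg' (hS m hm) _ (hle h (hS m hm))).enl ((enl_has c l).mono bl_le)
  have key : ∀ m : Y.Chart, ∃ t : Finset m.B,
      Ideal.span (t : Set m.B) = ext c1 (Ideal.span (s : Set c1.B)) m ∧
      (m = c1 → ∀ g ∈ t, ∀ h, ∀ m' ∈ M1, Tame (m.bl t g h) m') := by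
    intro m
    by_cases h : m = c1
    · subst h
      exact ⟨s, (ext_self _ _).symm, fun _ => hsT'⟩
    · obtain ⟨t, ht⟩ := exists_gens (ext c1 (Ideal.span (s : Set c1.B)) m)
      exact ⟨t, ht, fun h' => absurd h' h⟩
  choose t ht ht' using key
  obtain ⟨M', h1, h2, h3, h4⟩ := blow_atlas (insert c1 M1) (hM1.insert _) t
    (fun m hm => by
      obtain ⟨K, hK⟩ := hsT
      exact ⟨K, by rw [ht]; exact ext_triv hK m⟩)
    (by
      intro m hm m' hm'
      rw [ht, ht]
      rcases hm with rfl | hm <;> rcases hm' with rfl | hm'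
      · rfl
      · refine Agree.symm ?_
        rw [ext_self]
        exact ext_agree_self _ (hc1 m' hm')
      · rw [ext_self]
        exact ext_agree_self _ (hc1 m hm)
      · exact ext_agree _ (hA1 m hm m' hm') (hA1 m' hm' m hm))
    (by
      intro m hm g hg hs m' hm'
      rcases hm with rfl | hm <;> rcases hm' with rfl | hm'
      · exact tame_of_le bl_le
      · exact ht' _ rfl g hg hs m' hm'
      · exact (hc1 m hm).mono bl_le
      · exact (hA1 m hm m' hm').mono bl_le)
  refine ⟨l, M', h2, h3, ?_⟩
  rintro P hP (hPc | ⟨m, hm, hPm⟩)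
  · exact h4 P ⟨c1, Or.inl rfl, hPc.enl hP⟩
  · exact h4 P ⟨_, Or.inr ⟨m, hm, rfl⟩, hPm.enl hP⟩

theorem exists_atlas (C : Set Y.Chart) (hC : C.Finite) :
    ∃ (l : Finset A) (M : Set Y.Chart), M.Finite ∧ Atlas M ∧
      ∀ P : Y.Pl, P.Has l → (∃ m ∈ C, P.On m) → ∃ n ∈ M, P.On n := by
  classical
  induction C, hC using Set.Finite.induction_on with
  | empty => exact ⟨∅, ∅, Set.finite_empty, fun _ h => h.elim, fun P _ ⟨m, h, _⟩ => h.elim⟩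
  | insert _ _ ih =>
    rename_i c C _ _
    obtain ⟨l, M, h1, h2, h3⟩ := ih
    obtain ⟨l', M', h1', h2', h2'', h3'⟩ := step1 M h1 h2 c
    obtain ⟨l2, M2, h12, h22, h32⟩ := step2 M' h1' h2' c h2''
    refine ⟨l ∪ l' ∪ l2, M2, h12, h22, ?_⟩
    rintro P hP ⟨m, rfl | hm, hPm⟩
    · exact h32 P (hP.subset Finset.subset_union_right) (Or.inl hPm)
    · exact h32 P (hP.subset Finset.subset_union_right) (Or.inr (h3' P
        (hP.subset (Finset.subset_union_right.trans Finset.subset_union_left)) (h3 P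
          (hP.subset (Finset.subset_union_left.trans Finset.subset_union_left)) ⟨m, hm, hPm⟩)))

end Chart
end Site

end

section
open AlgebraicGeometry CategoryTheory CategoryTheory.Limits

namespace SchSite
variable {A : Type u} [CommRing A] {Y : Scheme.{u}} (p : Y ⟶ Spec (CommRingCat.of A))

/-- structure map -/
noncomputable def alc (V : Y.Opens) : CommRingCat.of A ⟶ Γ(Y, V) :=
  (Scheme.ΓSpecIso (CommRingCat.of A)).inv ≫ p.appLE ⊤ V le_top

lemma alc_res {V W : Y.Opens} (h : V ≤ W) :
    alc p W ≫ Y.presheaf.map (homOfLE h).op = alc p V := by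
  rw [alc, alc, Category.assoc]
  exact congrArg (fun t => _ ≫ t) (Scheme.Hom.appLE_map p _ (homOfLE h).op)

lemma fromSpec_p {V : Y.Opens} (hV : IsAffineOpen V) :
    hV.fromSpec ≫ p = Spec.map (alc p V) := by
  rw [← IsAffineOpen.SpecMap_appLE_fromSpec p (isAffineOpen_top _) hV le_top,
    IsAffineOpen.fromSpec_top, alc, Spec.map_comp]
  congr 1
  rw [Scheme.isoSpec_Spec_inv]

lemma inf_aff [IsSeparated p] {V W : Y.Opens} (hV : IsAffineOpen V) (hW : IsAffineOpen W) :
    IsAffineOpen (V ⊓ W) := by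
  have : IsAffineHom (pullback.diagonal p) := inferInstance
  exact isAffineHom_diagonal_iff.mp this ⊤ (isAffineOpen_top _) V le_top W le_top hV hW

lemma inf_surj [IsSeparated p] {V W : Y.Opens} (hV : IsAffineOpen V) (hW : IsAffineOpen W)
    (C : Subring Γ(Y, V ⊓ W))
    (h1 : ∀ x, (Y.presheaf.map (homOfLE (inf_le_left : V ⊓ W ≤ V)).op).hom x ∈ C)
    (h2 : ∀ x, (Y.presheaf.map (homOfLE (inf_le_right : V ⊓ W ≤ W)).op).hom x ∈ C) (x) :
    x ∈ C := by
  have hD := inf_aff p hV hW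
  let r1 := Y.presheaf.map (homOfLE (inf_le_left : V ⊓ W ≤ V)).op
  let r2 := Y.presheaf.map (homOfLE (inf_le_right : V ⊓ W ≤ W)).op
  let i : CommRingCat.of C ⟶ Γ(Y, V ⊓ W) := CommRingCat.ofHom C.subtype
  let a : Γ(Y, V) ⟶ CommRingCat.of C := CommRingCat.ofHom (r1.hom.codRestrict C h1)
  let b : Γ(Y, W) ⟶ CommRingCat.of C := CommRingCat.ofHom (r2.hom.codRestrict C h2)
  have ha : a ≫ i = r1 := rfl
  have hb : b ≫ i = r2 := rfl
  have hab : alc p V ≫ a = alc p W ≫ b := by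
    have : Mono i := ConcreteCategory.mono_of_injective _ Subtype.val_injective
    rw [← cancel_mono i, Category.assoc, Category.assoc, ha, hb, alc_res, alc_res]
  let q : Spec (CommRingCat.of C) ⟶ pullback (hV.fromSpec ≫ p) (hW.fromSpec ≫ p) :=
    pullback.lift (Spec.map a) (Spec.map b) (by
      rw [fromSpec_p, fromSpec_p, ← Spec.map_comp, ← Spec.map_comp, hab])
  have e1 : Spec.map r1 ≫ hV.fromSpec = hD.fromSpec := IsAffineOpen.map_fromSpec _ hD _
  have e2 : Spec.map r2 ≫ hW.fromSpec = hD.fromSpec := IsAffineOpen.map_fromSpec _ hD _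
  have hoi : IsOpenImmersion (Spec.map r1) := by
    have : IsOpenImmersion (Spec.map r1 ≫ hV.fromSpec) := by rw [e1]; infer_instance
    exact IsOpenImmersion.of_comp _ hV.fromSpec
  have hpb : IsPullback (Spec.map r2) (Spec.map r1) hW.fromSpec hV.fromSpec := by
    refine IsOpenImmersion.isPullback _ _ _ _ (e1.trans e2.symm) ?_
    have h3 : (Spec.map r1 ≫ hV.fromSpec).opensRange = V ⊓ W := by
      refine Eq.trans ?_ hD.opensRange_fromSpec; congr 1
    rw [Scheme.Hom.opensRange_comp] at h3
    have h4 := congrArg (fun U => hV.fromSpec ⁻¹ᵁ U) h3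
    simp only [Scheme.Hom.preimage_image_eq] at h4
    rw [h4, hW.opensRange_fromSpec, Scheme.Hom.preimage_inf, hV.fromSpec_preimage_self, top_inf_eq]
  have hq : Spec.map i ≫ q = hpb.flip.isoPullback.hom ≫
      pullback.mapDesc hV.fromSpec hW.fromSpec p := by
    apply pullback.hom_ext
    · have h7 : pullback.mapDesc hV.fromSpec hW.fromSpec p ≫ pullback.fst _ _ = pullback.fst _ _ := by
        rw [pullback.mapDesc, pullback.map, pullback.lift_fst, Category.comp_id]
      rw [Category.assoc, Category.assoc, h7, IsPullback.isoPullback_hom_fst, pullback.lift_fst,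
        ← Spec.map_comp, ha]
    · have h7 : pullback.mapDesc hV.fromSpec hW.fromSpec p ≫ pullback.snd _ _ = pullback.snd _ _ := by
        rw [pullback.mapDesc, pullback.map, pullback.lift_snd, Category.comp_id]
      rw [Category.assoc, Category.assoc, h7, IsPullback.isoPullback_hom_snd, pullback.lift_snd,
        ← Spec.map_comp, hb]
  have : IsClosedImmersion (Spec.map i ≫ q) := by rw [hq]; infer_instance
  have hci : IsClosedImmersion (Spec.map i) := .of_comp _ q
  have hs := (IsClosedImmersion.isAffine_surjective_of_isAffine (Spec.map i)).2
  have hs2 : Function.Surjective i.hom := by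
    have := Scheme.ΓSpecIso_inv_naturality i
    have h5 : i = (Scheme.ΓSpecIso _).inv ≫ (Spec.map i).appTop ≫ (Scheme.ΓSpecIso _).hom := by
      rw [← reassoc_of% this]; simp
    rw [h5]
    simp only [CommRingCat.hom_comp, RingHom.coe_comp]
    exact ((ConcreteCategory.bijective_of_isIso (Scheme.ΓSpecIso _).hom).2.comp hs).comp
      (ConcreteCategory.bijective_of_isIso (Scheme.ΓSpecIso _).inv).2
  obtain ⟨y, rfl⟩ := hs2 x
  exact y.2

lemma cov [IsSeparated p] {V W : Y.Opens} (hV : IsAffineOpen V) (hW : IsAffineOpen W) :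
    ∃ s : Finset Γ(Y, V), (∀ a ∈ s, Y.basicOpen a ≤ W) ∧
    Ideal.span ((Y.presheaf.map (homOfLE (inf_le_left : V ⊓ W ≤ V)).op).hom '' s) = ⊤ := by
  have hD := inf_aff p hV hW
  have H : ∀ x : (V ⊓ W : Y.Opens), ∃ f : Γ(Y, V), Y.basicOpen f ≤ V ⊓ W ∧ ↑x ∈ Y.basicOpen f :=
    fun x => hV.exists_basicOpen_le x x.2.1
  choose F h1 h2 using H
  obtain ⟨t, ht⟩ := hD.isCompact.elim_finite_subcover (fun x => (Y.basicOpen (F x) : Set Y))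
    (fun x => (Y.basicOpen (F x)).2) (fun x hx => Set.mem_iUnion.2 ⟨⟨x, hx⟩, h2 ⟨x, hx⟩⟩)
  classical
  refine ⟨t.image F, ?_, ?_⟩
  · intro a ha
    obtain ⟨x, -, rfl⟩ := Finset.mem_image.1 ha
    exact (h1 x).trans inf_le_right
  · rw [← hD.self_le_iSup_basicOpen_iff]
    intro x hx
    obtain ⟨y, hy, hxy⟩ := Set.mem_iUnion₂.1 (ht hx)
    refine TopologicalSpace.Opens.mem_iSup.2 ⟨⟨_, ⟨F y, Finset.mem_coe.2 (Finset.mem_image_of_mem F hy), rfl⟩⟩, ?_⟩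
    rw [Scheme.basicOpen_res]
    exact ⟨hx, hxy⟩

end SchSite

open SchSite

/-- the site of affine opens -/
noncomputable def schSite {A : Type u} [CommRing A] {ι : Type} (f : ι → A) {Y : Scheme.{u}}
    (p : Y ⟶ Spec (CommRingCat.of A)) [IsSeparated p] : Site A ι f where
  L := Y.affineOpens
  lat := { (inferInstance : PartialOrder Y.affineOpens) with
    inf := fun V W => ⟨V.1 ⊓ W.1, inf_aff p V.2 W.2⟩
    inf_le_left := fun V W => (inf_le_left : V.1 ⊓ W.1 ≤ V.1)
    inf_le_right := fun V W => (inf_le_right : V.1 ⊓ W.1 ≤ W.1)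
    le_inf := fun U V W h k => (le_inf h k : U.1 ≤ V.1 ⊓ W.1) }
  R V := Γ(Y, V.1)
  ring V := inferInstance
  al V := (alc p V.1).hom
  res {V W} h := (Y.presheaf.map (homOfLE (show V.1 ≤ W.1 from h)).op).hom
  res_self {V} h x := by
    have : (homOfLE (show V.1 ≤ V.1 from h)).op = 𝟙 _ := rfl
    rw [this, Y.presheaf.map_id]; rfl
  res_res {U V W} h k x := by
    rw [← CommRingCat.comp_apply, ← Functor.map_comp]; rfl
  res_al {V W} h a := by
    rw [← alc_res p (show V.1 ≤ W.1 from h)]; rfl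
  D V g := ⟨Y.basicOpen g, V.2.basicOpen g⟩
  D_le V g := Y.basicOpen_le g
  D_unit V g := RingedSpace.isUnit_res_basicOpen _ g
  le_D {V W} h g hg := by
    change W.1 ≤ Y.basicOpen g
    have h1 := Y.basicOpen_of_isUnit hg
    rw [Scheme.basicOpen_res] at h1
    exact h1 ▸ inf_le_right
  D_surj V g x := by
    have := V.2.isLocalization_basicOpen g
    obtain ⟨n, y, h⟩ := IsLocalization.Away.surj g x
    exact ⟨n, y, by rw [mul_comm]; exact h.symm⟩
  D_inj V g y hy := by
    have := V.2.isLocalization_basicOpen g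
    obtain ⟨n, h⟩ := IsLocalization.Away.exists_of_eq g (S := Γ(Y, Y.basicOpen g)) (a := y) (b := 0)
      (by rw [map_zero]; exact hy)
    exact ⟨n, by simpa using h⟩
  inf_surj V W x := SchSite.inf_surj p V.2 W.2 _
    (fun x => Subring.subset_closure (Or.inl ⟨x, rfl⟩))
    (fun x => Subring.subset_closure (Or.inr ⟨x, rfl⟩)) x
  cov V W := SchSite.cov p V.2 W.2

end

section

lemma ultra {I : Type u} (F : Ultrafilter I) (K : I → Type u) [∀ j, Field (K j)]
    (O : ∀ j, ValuationSubring (K j)) :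
    ∃ (K' : Type u) (_ : Field K') (π : (∀ j, K j) →+* K') (O' : ValuationSubring K'),
      Function.Surjective π ∧ (∀ x, π x = 0 ↔ ∀ᶠ j in (F : Filter I), x j = 0) ∧
      ∀ x, π x ∈ O' ↔ ∀ᶠ j in (F : Filter I), x j ∈ O j := by
  let m : Ideal (∀ j, K j) :=
    { carrier := {x | ∀ᶠ j in (F : Filter I), x j = 0}
      zero_mem' := by simp
      add_mem' := fun {a b} ha hb => by
        filter_upwards [ha, hb] with j h1 h2
        simp [h1, h2]
      smul_mem' := fun c x hx => by
        filter_upwards [hx] with j h1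
        simp [h1] }
  have hm : ∀ x, x ∈ m ↔ ∀ᶠ j in (F : Filter I), x j = 0 := fun x => Iff.rfl
  have hmax : m.IsMaximal := by
    classical
    rw [Ideal.isMaximal_iff]
    refine ⟨fun h => ?_, fun J x hJ hx hxJ => ?_⟩
    · rw [hm] at h
      obtain ⟨j, hj⟩ := h.exists
      simp at hj
    · rw [hm, ← Ultrafilter.eventually_not] at hx
      have h1 : (1 - (fun j => (x j)⁻¹) * x) ∈ m := by
        rw [hm]
        filter_upwards [hx] with j hj
        simp [hj]
      have := J.add_mem (hJ h1) (J.mul_mem_left (fun j => (x j)⁻¹) hxJ)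
      simpa using this
  let fld : Field ((∀ j, K j) ⧸ m) := Ideal.Quotient.field m
  let π := Ideal.Quotient.mk m
  have hπ : ∀ x, π x = 0 ↔ ∀ᶠ j in (F : Filter I), x j = 0 := fun x => by
    rw [← hm]; exact Ideal.Quotient.eq_zero_iff_mem
  let S : Subring (∀ j, K j) :=
    { carrier := {x | ∀ᶠ j in (F : Filter I), x j ∈ O j}
      mul_mem' := fun {a b} ha hb => by
        filter_upwards [ha, hb] with j h1 h2 using mul_mem h1 h2
      one_mem' := Filter.Eventually.of_forall fun j => one_mem _
      add_mem' := fun {a b} ha hb => by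
        filter_upwards [ha, hb] with j h1 h2 using add_mem h1 h2
      zero_mem' := Filter.Eventually.of_forall fun j => zero_mem _
      neg_mem' := fun {a} ha => by
        filter_upwards [ha] with j h1 using neg_mem h1 }
  have hS : ∀ x, π x ∈ S.map π ↔ ∀ᶠ j in (F : Filter I), x j ∈ O j := by
    intro x
    constructor
    · rintro ⟨y, hy, hyx⟩
      have h2 : π (y - x) = 0 := by rw [map_sub, hyx, sub_self]
      rw [hπ] at h2
      filter_upwards [h2, hy] with j h3 h4
      rw [Pi.sub_apply, sub_eq_zero] at h3
      rwa [← h3]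
    · intro h
      exact ⟨x, h, rfl⟩
  refine ⟨_, fld, π, ⟨S.map π, fun z => ?_⟩, Ideal.Quotient.mk_surjective, hπ, hS⟩
  obtain ⟨x, rfl⟩ := Ideal.Quotient.mk_surjective z
  by_cases hx : π x = 0
  · left
    have hx' : (Ideal.Quotient.mk m) x = 0 := hx
    rw [hx']; exact (S.map π).zero_mem
  have hinv : (π x)⁻¹ = π (fun j => (x j)⁻¹) := by
    refine inv_eq_of_mul_eq_one_right ?_
    rw [← map_mul, ← sub_eq_zero, ← map_one π, ← map_sub, hπ]
    rw [hπ, ← Ultrafilter.eventually_not] at hx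
    filter_upwards [hx] with j hj
    simp [hj]
  have h3 : (∀ᶠ j in (F : Filter I), x j ∈ O j) ∨ ∀ᶠ j in (F : Filter I), (x j)⁻¹ ∈ O j := by
    rw [← Ultrafilter.eventually_or]
    exact Filter.Eventually.of_forall fun j => (O j).mem_or_inv_mem _
  rcases h3 with h3 | h3
  · left; exact (hS x).2 h3
  · right
    change (π x)⁻¹ ∈ S.map π
    rw [hinv]; exact (hS _).2 h3

lemma val_away {K : Type u} [Field K] (O : ValuationSubring K) (t : K) (ht : t ∈ O) (h0 : t ≠ 0) :
    ∃ O' : ValuationSubring K, O ≤ O' ∧ t⁻¹ ∈ O' ∧ ∀ x ∈ O', ∃ n : ℕ, t ^ n * x ∈ O := by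
  have up : ∀ {x : K} {n m : ℕ}, n ≤ m → t ^ n * x ∈ O → t ^ m * x ∈ O := by
    intro x n m h hx
    obtain ⟨d, rfl⟩ := Nat.exists_eq_add_of_le h
    rw [pow_add, mul_comm (t ^ n), mul_assoc]
    exact mul_mem (pow_mem ht d) hx
  let S : Subring K :=
    { carrier := {x | ∃ n : ℕ, t ^ n * x ∈ O}
      mul_mem' := by
        rintro a b ⟨n, hn⟩ ⟨m, hm⟩
        refine ⟨n + m, ?_⟩
        have := mul_mem hn hm
        rwa [show t ^ n * a * (t ^ m * b) = t ^ (n + m) * (a * b) by ring] at this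
      one_mem' := ⟨0, by simp⟩
      add_mem' := by
        rintro a b ⟨n, hn⟩ ⟨m, hm⟩
        refine ⟨max n m, ?_⟩
        rw [mul_add]
        exact add_mem (up (le_max_left _ _) hn) (up (le_max_right _ _) hm)
      zero_mem' := ⟨0, by simp⟩
      neg_mem' := by
        rintro a ⟨n, hn⟩
        refine ⟨n, ?_⟩
        rw [mul_neg]; exact neg_mem hn }
  have hle : O.toSubring ≤ S := fun x hx => ⟨0, by simpa using hx⟩
  refine ⟨O.ofLE S hle, hle, ?_, fun x hx => hx⟩
  exact ⟨1, by simp [h0]⟩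

namespace Site
variable {A : Type u} [CommRing A] {ι : Type} {f : ι → A} {Y : Site A ι f}

/-- well-behaved places -/
structure Pl.Geo {κ : Type} (U : κ → Y.L) (idx : κ → ι) (P : Y.Pl) : Prop where
  mono : ∀ {V W : Y.L}, V ≤ W → P.mem V → P.mem W
  ex : ∃ V h i, P.ev V h (Y.al V (f i)) ≠ 0
  cov : ∀ i V (h : P.mem V), P.ev V h (Y.al V (f i)) ≠ 0 → ∃ k, idx k = i ∧ P.mem (U k)
  inf : ∀ V W, P.mem V → P.mem W → P.mem (V ⊓ W)

lemma good_ini (V : Y.L) (i : ι) (s : Finset (Y.R V))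
    (hs : ∀ x, x ∈ Subring.closure (Set.range (Y.al V) ∪ s)) (B : Subring (Y.R V))
    (hf : Y.al V (f i) ∈ B) (N : ℕ) (hB : ∀ x ∈ s, Y.al V (f i) ^ N * x ∈ B) (x : Y.R V) :
    ∃ (n : ℕ) (s : Set A), s.Finite ∧
      Y.al V (f i) ^ n * x ∈ B ⊔ Subring.closure (Y.al V '' s) := by
  have up : ∀ {s t : Set A} (h : s ⊆ t), B ⊔ Subring.closure (Y.al V '' s) ≤
    B ⊔ Subring.closure (Y.al V '' t) := fun h => sup_le_sup_left
      (Subring.closure_mono (Set.image_mono h)) _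
  have hfs : ∀ s, Y.al V (f i) ∈ B ⊔ Subring.closure (Y.al V '' s) := fun s =>
    (le_sup_left : B ≤ B ⊔ _) hf
  induction hs x using Subring.closure_induction with
  | mem x hx =>
    rcases hx with ⟨a, rfl⟩ | hx
    · refine ⟨0, {a}, Set.finite_singleton _, ?_⟩
      rw [pow_zero, one_mul]
      exact (le_sup_right : _ ≤ B ⊔ _) (Subring.subset_closure ⟨a, rfl, rfl⟩)
    · exact ⟨N, ∅, Set.finite_empty, (le_sup_left : B ≤ B ⊔ _) (hB x hx)⟩
  | zero => exact ⟨0, ∅, Set.finite_empty, by simp⟩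
  | one => exact ⟨0, ∅, Set.finite_empty, by simp⟩
  | add x y _ _ h1 h2 =>
    obtain ⟨n, s, hs, h1⟩ := h1
    obtain ⟨m, t, ht, h2⟩ := h2
    refine ⟨n + m, s ∪ t, hs.union ht, ?_⟩
    have h3 := mul_mem (pow_mem (hfs (s ∪ t)) m) (up Set.subset_union_left h1)
    have h4 := mul_mem (pow_mem (hfs (s ∪ t)) n) (up Set.subset_union_right h2)
    convert add_mem h3 h4 using 1
    ring
  | neg x _ h1 =>
    obtain ⟨n, s, hs, h1⟩ := h1
    exact ⟨n, s, hs, by rw [mul_neg]; exact neg_mem h1⟩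
  | mul x y _ _ h1 h2 =>
    obtain ⟨n, s, hs, h1⟩ := h1
    obtain ⟨m, t, ht, h2⟩ := h2
    refine ⟨n + m, s ∪ t, hs.union ht, ?_⟩
    convert mul_mem (up Set.subset_union_left h1) (up Set.subset_union_right h2) using 1
    ring

/-- initial charts -/
noncomputable def ini [Finite ι] (V : Y.L) (i : ι) (hu : IsUnit (Y.al V (f i))) (s : Finset (Y.R V))
    (hs : ∀ x, x ∈ Subring.closure (Set.range (Y.al V) ∪ s)) (N : ℕ) : Y.Chart where
  V := V
  i := i
  B := Subring.closure ({Y.al V (f i)} ∪ Set.range (fun l => (↑hu.unit⁻¹ : Y.R V) * Y.al V (f l)) ∪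
    (fun x => Y.al V (f i) ^ N * x) '' s)
  fg := ⟨_, ((Set.finite_singleton _).union (Set.finite_range _)).union (s.finite_toSet.image _), rfl⟩
  unit := hu
  fmem := Subring.subset_closure (Or.inl (Or.inl rfl))
  good := good_ini V i s hs _ (Subring.subset_closure (Or.inl (Or.inl rfl))) N
    (fun x hx => Subring.subset_closure (Or.inr ⟨x, hx, rfl⟩))
  div l := ⟨_, Subring.subset_closure (Or.inl (Or.inr ⟨l, rfl⟩)), by
    rw [← mul_assoc, IsUnit.mul_val_inv, one_mul]⟩

lemma Pl.on_ini [Finite ι] (P : Y.Pl) (V : Y.L) (i : ι) (hu : IsUnit (Y.al V (f i)))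
    (s : Finset (Y.R V))
    (hs : ∀ x, x ∈ Subring.closure (Set.range (Y.al V) ∪ s)) (N : ℕ) (h : P.mem V)
    (h1 : P.ev V h (Y.al V (f i)) ∈ P.O)
    (h2 : ∀ l, P.ev V h (Y.al V (f l)) / P.ev V h (Y.al V (f i)) ∈ P.O)
    (h3 : ∀ x ∈ s, P.ev V h (Y.al V (f i)) ^ N * P.ev V h x ∈ P.O) : P.On (ini V i hu s hs N) := by
  refine ⟨h, ?_⟩
  suffices H : Subring.closure ({Y.al V (f i)} ∪ Set.range (fun l => (↑hu.unit⁻¹ : Y.R V) * Y.al V (f l)) ∪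
    (fun x => Y.al V (f i) ^ N * x) '' s) ≤ P.O.toSubring.comap (P.ev V h) from fun x hx => H hx
  rw [Subring.closure_le]
  rintro _ ((rfl | ⟨l, rfl⟩) | ⟨x, hx, rfl⟩)
  · exact h1
  · change P.ev V h _ ∈ P.O
    convert h2 l using 1
    have := (hu.map (P.ev V h)).ne_zero
    rw [eq_div_iff this, ← map_mul, mul_right_comm, IsUnit.val_inv_mul, one_mul]
  · change P.ev V h _ ∈ P.O
    rw [map_mul, map_pow]
    exact h3 x hx

end Site

end

section
namespace Site
variable {A : Type u} [CommRing A] {ι : Type} {f : ι → A} {Y : Site A ι f}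

lemma Pl.Geo.ev_al {κ : Type} {U : κ → Y.L} {idx : κ → ι} {P : Y.Pl} (hP : P.Geo U idx)
    {V W : Y.L} (hV : P.mem V) (hW : P.mem W) (a : A) :
    P.ev V hV (Y.al V a) = P.ev W hW (Y.al W a) := by
  have h := hP.inf _ _ hV hW
  rw [← P.ev_res inf_le_left h hV, ← P.ev_res inf_le_right h hW, Y.res_al, Y.res_al]

lemma Pl.Geo.exists_max {κ : Type} {U : κ → Y.L} {idx : κ → ι} {P : Y.Pl} [Finite ι]
    (hP : P.Geo U idx) : ∃ k, ∃ h : P.mem (U k), P.ev _ h (Y.al _ (f (idx k))) ≠ 0 ∧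
      ∀ l, P.ev _ h (Y.al _ (f l)) / P.ev _ h (Y.al _ (f (idx k))) ∈ P.O := by
  obtain ⟨V, h, i, hi⟩ := hP.ex
  have : Nonempty ι := ⟨i⟩
  obtain ⟨i0, hi0⟩ := Finite.exists_max (fun l => P.O.valuation (P.ev V h (Y.al V (f l))))
  have h0 : P.ev V h (Y.al V (f i0)) ≠ 0 := by
    intro h0
    have := hi0 i
    rw [h0, map_zero, le_zero_iff, map_eq_zero] at this
    exact hi this
  obtain ⟨k, rfl, hk⟩ := hP.cov i0 V h h0
  refine ⟨k, hk, ?_, fun l => ?_⟩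
  · rwa [hP.ev_al hk h]
  · rw [hP.ev_al hk h, hP.ev_al hk h, ← ValuationSubring.valuation_le_one_iff, map_div₀]
    exact div_le_one_of_le₀ (hi0 l) zero_le

theorem cov_charts [Finite ι] {κ : Type} [Finite κ] (U : κ → Y.L) (idx : κ → ι)
    (hu : ∀ k, IsUnit (Y.al (U k) (f (idx k)))) (s : ∀ k, Finset (Y.R (U k)))
    (hs : ∀ k x, x ∈ Subring.closure (Set.range (Y.al (U k)) ∪ s k))
    (val : ∀ (k : κ) (K : Type u) [Field K] (O : ValuationSubring K) (ev : Y.R (U k) →+* K),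
      (∀ a, ev (Y.al _ a) ∈ O) → (ev (Y.al _ (f (idx k))))⁻¹ ∈ O → ∃ k1, idx k1 = idx k ∧
        ∃ h : Y.R (U k ⊓ U k1) →+* K, (∀ x, h (Y.res inf_le_left x) = ev x) ∧
          ∀ x, h (Y.res inf_le_right x) ∈ O) :
    ∃ (l : Finset A) (N : ℕ), ∀ P : Y.Pl, P.Geo U idx → P.Has l →
      ∃ k, P.On (ini (U k) (idx k) (hu k) (s k) (hs k) N) := by
  classical
  by_contra! H
  have H1 : ∀ j : Finset A × ℕ, ∃ P : Y.Pl, ∃ k, P.Geo U idx ∧ P.Has j.1 ∧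
      (∃ h : P.mem (U k), P.ev _ h (Y.al _ (f (idx k))) ≠ 0 ∧
      ∀ l, P.ev _ h (Y.al _ (f l)) / P.ev _ h (Y.al _ (f (idx k))) ∈ P.O) ∧
      ∀ k, ¬ P.On (ini (U k) (idx k) (hu k) (s k) (hs k) j.2) := by
    intro j
    obtain ⟨P, h1, h2, h3⟩ := H j.1 j.2
    obtain ⟨k, hk⟩ := h1.exists_max
    exact ⟨P, k, h1, h2, hk, h3⟩
  choose P kk hP using H1
  have H2 : ∃ k0, ∀ j, ∃ j', j ≤ j' ∧ kk j' = k0 := by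
    by_contra! H3
    choose b hb using H3
    obtain ⟨M, hM⟩ := Finite.exists_le b
    exact hb (kk M) M (hM _) rfl
  obtain ⟨k0, hk0⟩ := H2
  have H4 : ∀ j : Finset A × ℕ, ∃ P : Y.Pl, P.Geo U idx ∧ P.Has j.1 ∧
      (∃ h : P.mem (U k0), P.ev _ h (Y.al _ (f (idx k0))) ≠ 0 ∧
      ∀ l, P.ev _ h (Y.al _ (f l)) / P.ev _ h (Y.al _ (f (idx k0))) ∈ P.O) ∧
      ∃ N, j.2 ≤ N ∧ ∀ k, ¬ P.On (ini (U k) (idx k) (hu k) (s k) (hs k) N) := by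
    intro j
    obtain ⟨j', h1, rfl⟩ := hk0 j
    obtain ⟨h2, h3, h4, h5⟩ := hP j'
    exact ⟨P j', h2, h3.subset h1.1, h4, j'.2, h1.2, h5⟩
  choose Q hG hH hX N hN hOn using H4
  choose hm hm0 hmd using hX
  let F : Ultrafilter (Finset A × ℕ) := Ultrafilter.of Filter.atTop
  have hF : (F : Filter (Finset A × ℕ)) ≤ Filter.atTop := Ultrafilter.of_le _
  obtain ⟨K, fld, π, O, hsur, hπ, hO⟩ := ultra F (fun j => (Q j).K) (fun j => (Q j).O)
  let ev : Y.R (U k0) →+* K := π.comp (RingHom.pi fun j => (Q j).ev _ (hm j))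
  have hev : ∀ x, ev x = π (fun j => (Q j).ev _ (hm j) x) := fun x => rfl
  have hal : ∀ a, ev (Y.al _ a) ∈ O := by
    intro a
    rw [hev, hO]
    filter_upwards [hF (Filter.eventually_ge_atTop ({a}, 0))] with j hj
    exact hH j _ _ a (hj.1 (by simp))
  set t := ev (Y.al _ (f (idx k0))) with ht
  have ht0 : t ≠ 0 := ((hu k0).map ev).ne_zero
  obtain ⟨O2, hle, htinv, hO2⟩ := val_away O t (hal _) ht0
  obtain ⟨k1, hk1, h, hl, hr⟩ := val k0 K O2 ev (fun a => hle (hal a)) htinv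
  choose e he using fun x => hO2 _ (hr x)
  let N0 := (s k1).sup e
  obtain ⟨s', hs', hspan⟩ := Y.cov (U k0) (U k1)
  obtain ⟨a, has, ha0⟩ : ∃ a ∈ s', ev a ≠ 0 := by
    by_contra! h0
    have h1 : Ideal.span (Y.res (inf_le_left : U k0 ⊓ U k1 ≤ U k0) '' s') ≤ RingHom.ker h := by
      rw [Ideal.span_le]
      rintro _ ⟨x, hx, rfl⟩
      change h _ = 0
      rw [hl]; exact h0 x hx
    rw [hspan] at h1
    have h2 : h 1 = 0 := h1 (Submodule.mem_top)
    rw [map_one] at h2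
    exact one_ne_zero h2
  have hDU := hs' a has
  have key : ∀ x : Y.R (U k1), ∃ (m : ℕ) (b : Y.R (U k0)),
      Y.res (Y.D_le _ a) b = Y.res (Y.D_le _ a) a ^ m * Y.res hDU x ∧
      ev b = ev a ^ m * h (Y.res inf_le_right x) := by
    intro x
    obtain ⟨m, b, hb⟩ := Y.D_surj (U k0) a (Y.res hDU x)
    refine ⟨m, b, hb, ?_⟩
    let W := U k0 ⊓ U k1
    let a' : Y.R W := Y.res inf_le_left a
    have hle : Y.D W a' ≤ Y.D (U k0) a := Y.le_D ((Y.D_le _ _).trans inf_le_left) a (by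
      rw [← Y.res_res (Y.D_le W a') inf_le_left]; exact Y.D_unit W a')
    have h1 := congrArg (Y.res hle) hb
    rw [map_mul, map_pow, Y.res_res, Y.res_res, Y.res_res] at h1
    obtain ⟨n, hn⟩ := Y.D_inj W a' (Y.res inf_le_left b - a' ^ m * Y.res inf_le_right x) (by
      rw [map_sub, map_mul, map_pow, Y.res_res, Y.res_res, Y.res_res, sub_eq_zero]
      exact h1)
    have h2 := congrArg h hn
    rw [map_mul, map_pow, map_sub, map_mul, map_pow, hl, hl, map_zero] at h2
    have h3 := (mul_eq_zero.1 h2).resolve_left (pow_ne_zero _ ha0)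
    exact sub_eq_zero.1 h3
  have hmD : ∀ᶠ j in (F : Filter (Finset A × ℕ)), (Q j).ev _ (hm j) a ≠ 0 := by
    rw [Ultrafilter.eventually_not]
    intro h0
    exact ha0 ((hπ _).2 h0)
  have hx : ∀ x ∈ s k1, ∀ᶠ j in (F : Filter (Finset A × ℕ)), ∀ hj : (Q j).mem (U k1),
      (Q j).ev _ (hm j) (Y.al _ (f (idx k0))) ^ e x * (Q j).ev _ hj x ∈ (Q j).O := by
    intro x _
    obtain ⟨m, b, h1, h2⟩ := key x
    obtain ⟨z, hz⟩ := hsur (h (Y.res inf_le_right x))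
    rw [← hz, hev, hev, ← map_pow, ← map_mul, ← sub_eq_zero, ← map_sub, hπ] at h2
    have h3 := he x
    rw [← hz, ht, hev, ← map_pow, ← map_mul, hO] at h3
    filter_upwards [hmD, h2, h3] with j h4 h5 h6 hj
    have hD := (Q j).mem_D _ _ (hm j) h4
    have h7 := congrArg ((Q j).ev _ hD) h1
    rw [map_mul, map_pow, (Q j).ev_res _ _ (hm j), (Q j).ev_res _ _ (hm j),
      (Q j).ev_res _ _ hj] at h7
    have h8 : (Q j).ev _ (hm j) b = (Q j).ev _ (hm j) a ^ m * z j := sub_eq_zero.1 h5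
    rw [h7] at h8
    have h9 := mul_left_cancel₀ (pow_ne_zero _ h4) h8
    rw [h9]; exact h6
  have hfin := (Filter.eventually_all_finset (s k1)).2 hx
  obtain ⟨j, h1, h2, h3⟩ := (hmD.and (hfin.and
    (hF (Filter.eventually_ge_atTop (({f (idx k0)} : Finset A), N0))))).exists
  have hj1 : (Q j).mem (U k1) := (hG j).mono hDU ((Q j).mem_D _ _ (hm j) h1)
  have hfO : (Q j).ev _ hj1 (Y.al _ (f (idx k0))) ∈ (Q j).O := hH j _ _ _ (h3.1 (by simp))
  refine hOn j k1 (Pl.on_ini _ _ _ _ _ _ _ hj1 ?_ ?_ ?_)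
  · rw [hk1]; exact hfO
  · intro l
    rw [hk1, (hG j).ev_al hj1 (hm j), (hG j).ev_al hj1 (hm j)]
    exact hmd j l
  · intro x hx
    have h4 : e x ≤ N j := (Finset.le_sup hx).trans (h3.2.trans (hN j))
    obtain ⟨d, hd⟩ := Nat.exists_eq_add_of_le h4
    have h5 := h2 x hx hj1
    rw [(hG j).ev_al (hm j) hj1] at h5
    rw [hk1, hd, pow_add, mul_right_comm]
    exact mul_mem h5 (pow_mem hfO d)

end Site

end

section
open AlgebraicGeometry CategoryTheory CategoryTheory.Limits

namespace SchSite
variable {A : Type u} [CommRing A] {Y : Scheme.{u}} (p : Y ⟶ Spec (CommRingCat.of A))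

/-- evaluation of sections along a ring-valued point -/
noncomputable def evAt {K : Type u} [CommRing K] (φ : Spec (CommRingCat.of K) ⟶ Y) (V : Y.Opens)
    (h : ⊤ ≤ φ ⁻¹ᵁ V) : Γ(Y, V) ⟶ CommRingCat.of K :=
  φ.appLE V ⊤ h ≫ (Scheme.ΓSpecIso (CommRingCat.of K)).hom

lemma res_evAt {K : Type u} [CommRing K] (φ : Spec (CommRingCat.of K) ⟶ Y) {V W : Y.Opens}
    (h : V ≤ W) (hV : ⊤ ≤ φ ⁻¹ᵁ V) (hW : ⊤ ≤ φ ⁻¹ᵁ W) :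
    Y.presheaf.map (homOfLE h).op ≫ evAt φ V hV = evAt φ W hW := by
  rw [evAt, evAt, ← Category.assoc]
  exact congrArg (fun t => t ≫ _) (Scheme.Hom.map_appLE φ _ (homOfLE h).op)

lemma evAt_comp {K K' : Type u} [CommRing K] [CommRing K'] (φ : Spec (CommRingCat.of K) ⟶ Y)
    (ψ : CommRingCat.of K ⟶ CommRingCat.of K') (V : Y.Opens) (h : ⊤ ≤ φ ⁻¹ᵁ V)
    (h' : ⊤ ≤ (Spec.map ψ ≫ φ) ⁻¹ᵁ V) :
    evAt (Spec.map ψ ≫ φ) V h' = evAt φ V h ≫ ψ := by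
  have h1 := Scheme.Hom.appLE_comp_appLE (Spec.map ψ) φ V ⊤ ⊤ h le_top
  rw [evAt, evAt, ← h1, Category.assoc, Category.assoc]
  congr 1
  have h2 : (Spec.map ψ).appLE ⊤ ⊤ le_top = (Spec.map ψ).appTop := by
    exact Scheme.Hom.appLE_eq_app _
  rw [h2]
  exact Scheme.ΓSpecIso_naturality ψ

lemma evAt_fromSpec {K : Type u} [CommRing K] {V : Y.Opens} (hV : IsAffineOpen V)
    (ψ : Γ(Y, V) ⟶ CommRingCat.of K)
    (h : ⊤ ≤ (Spec.map ψ ≫ hV.fromSpec) ⁻¹ᵁ V) : evAt (Spec.map ψ ≫ hV.fromSpec) V h = ψ := by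
  have h1 := Scheme.Hom.appLE_comp_appLE (Spec.map ψ) hV.fromSpec V ⊤ ⊤
    hV.fromSpec_preimage_self.ge le_top
  rw [evAt, ← h1]
  have h2 : (Spec.map ψ).appLE ⊤ ⊤ le_top = (Spec.map ψ).appTop := by
    exact Scheme.Hom.appLE_eq_app _
  have h3 : hV.fromSpec.appLE V ⊤ hV.fromSpec_preimage_self.ge = (Scheme.ΓSpecIso Γ(Y, V)).inv := by
    rw [Scheme.Hom.appLE, hV.fromSpec_app_self, Category.assoc, ← Functor.map_comp]
    exact (congrArg (fun t => _ ≫ t) (CategoryTheory.Functor.map_id _ _)).trans (Category.comp_id _)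
  rw [h2, h3, Category.assoc, Scheme.ΓSpecIso_naturality, Iso.inv_hom_id_assoc]

lemma evAt_al {K : Type u} [CommRing K] (φ : Spec (CommRingCat.of K) ⟶ Y) (V : Y.Opens)
    (h : ⊤ ≤ φ ⁻¹ᵁ V) : Spec.map (alc p V ≫ evAt φ V h) = φ ≫ p := by
  have h1 := Scheme.Hom.appLE_comp_appLE φ p ⊤ V ⊤ le_top h
  have h2 : alc p V ≫ evAt φ V h = (Scheme.ΓSpecIso (CommRingCat.of A)).inv ≫
      (φ ≫ p).appTop ≫ (Scheme.ΓSpecIso (CommRingCat.of K)).hom := by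
    rw [alc, evAt, Category.assoc, reassoc_of% h1]
    congr 2
  rw [h2]
  obtain ⟨χ, hχ⟩ := Spec.map_surjective (φ ≫ p)
  rw [← hχ, Scheme.ΓSpecIso_naturality, Iso.inv_hom_id_assoc]

lemma basicOpen_al (V : Y.Opens) (a : A) :
    Y.basicOpen ((alc p V).hom a) = V ⊓ p ⁻¹ᵁ (PrimeSpectrum.basicOpen a) := by
  refine (Scheme.basicOpen_appLE p V ⊤ le_top ((Scheme.ΓSpecIso (CommRingCat.of A)).inv.hom a)).trans ?_
  congr 2
  exact (basicOpen_eq_of_affine (R := CommRingCat.of A) a)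

lemma mem_D {K : Type u} [Field K] (φ : Spec (CommRingCat.of K) ⟶ Y) (V : Y.Opens)
    (h : ⊤ ≤ φ ⁻¹ᵁ V) (g : Γ(Y, V)) (hg : (evAt φ V h).hom g ≠ 0) : ⊤ ≤ φ ⁻¹ᵁ (Y.basicOpen g) := by
  have h1 : IsUnit (φ.appLE V ⊤ h g) := by
    have h2 : IsUnit ((evAt φ V h).hom g) := hg.isUnit
    rw [evAt, CommRingCat.comp_apply] at h2
    have h4 := h2.map (Scheme.ΓSpecIso (CommRingCat.of K)).inv.hom
    rwa [← CommRingCat.comp_apply, Iso.hom_inv_id] at h4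
  have h3 := Scheme.basicOpen_of_isUnit _ h1
  rw [Scheme.basicOpen_appLE] at h3
  rw [← h3]
  exact inf_le_right

lemma top_le {K : Type u} [CommRing K] [IsLocalRing K] (φ : Spec (CommRingCat.of K) ⟶ Y) (V : Y.Opens)
    (h : φ (IsLocalRing.closedPoint K) ∈ V) : ⊤ ≤ φ ⁻¹ᵁ V :=
  ((IsLocalRing.closedPoint_mem_iff (R := K) (φ ⁻¹ᵁ V)).1 h).ge

variable {ι : Type} (f : ι → A) [IsSeparated p]

/-- place from a field-valued point -/
noncomputable def geoPl {K : Type u} [Field K] (φ : Spec (CommRingCat.of K) ⟶ Y)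
    (O : ValuationSubring K) : (schSite f p).Pl where
  mem V := ⊤ ≤ φ ⁻¹ᵁ V.1
  K := K
  ev V h := (evAt φ V.1 h).hom
  ev_res {V W} h hV hW x := by
    rw [← res_evAt φ (show V.1 ≤ W.1 from h) hV hW]; rfl
  mem_D V g h hg := mem_D φ V.1 h g hg
  O := O

lemma geoPl_geo {K : Type u} [Field K] (φ : Spec (CommRingCat.of K) ⟶ Y)
    (O : ValuationSubring K) {κ : Type} (U : κ → Y.affineOpens) (idx : κ → ι)
    (hf : ∀ y : Y, ∃ i, p y ∈ PrimeSpectrum.basicOpen (f i))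
    (hU : ∀ y i, p y ∈ PrimeSpectrum.basicOpen (f i) → ∃ k, idx k = i ∧ y ∈ (U k).1) :
    (geoPl p f φ O).Geo (Y := schSite f p) U idx where
  mono {V W} h k := k.trans (φ.preimage_mono h)
  ex := by
    obtain ⟨i, hi⟩ := hf (φ (IsLocalRing.closedPoint K))
    obtain ⟨k, -, hk⟩ := hU _ i hi
    have h1 := top_le φ (U k).1 hk
    refine ⟨U k, h1, i, fun h0 => ?_⟩
    have h2 : ⊤ ≤ φ ⁻¹ᵁ Y.basicOpen ((alc p (U k).1).hom (f i)) := by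
      rw [basicOpen_al]; exact top_le φ _ ⟨hk, hi⟩
    have h3 := res_evAt φ (Y.basicOpen_le ((alc p (U k).1).hom (f i))) h2 h1
    have h4 : (evAt φ _ h1).hom ((alc p (U k).1).hom (f i)) = 0 := h0
    rw [← h3, CommRingCat.comp_apply] at h4
    have h5 := (RingedSpace.isUnit_res_basicOpen _ ((alc p (U k).1).hom (f i))).map
      (evAt φ _ h2).hom
    exact h5.ne_zero h4
  cov i V h h0 := by
    have h1 := mem_D φ V.1 h _ h0
    have h2 := h1 (show IsLocalRing.closedPoint K ∈ (⊤ : (Spec (CommRingCat.of K)).Opens) from trivial)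
    have h3 : φ (IsLocalRing.closedPoint K) ∈ Y.basicOpen ((alc p V.1).hom (f i)) := h2
    rw [basicOpen_al] at h3
    obtain ⟨k, h4, h5⟩ := hU _ i h3.2
    exact ⟨k, h4, top_le φ _ h5⟩
  inf V W h k := le_inf h k

end SchSite

end

section
open AlgebraicGeometry CategoryTheory CategoryTheory.Limits

namespace SchSite
variable {A : Type u} [CommRing A]

lemma exists_f (T : (Spec (CommRingCat.of A)).Opens) (hT : IsCompact T.carrier) :
    ∃ (n : ℕ) (f : Fin n → A), ∀ x : Spec (CommRingCat.of A),
      x ∈ T ↔ ∃ i, x ∈ PrimeSpectrum.basicOpen (f i) := by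
  obtain ⟨t, ht⟩ := PrimeSpectrum.isCompact_isOpen_iff.1
    (⟨hT, T.2⟩ : IsCompact (T.carrier : Set (PrimeSpectrum A)) ∧ IsOpen _)
  refine ⟨_, fun i => (t.equivFin.symm i : A), fun x => ?_⟩
  change PrimeSpectrum A at x
  have h1 : x ∈ T.carrier ↔ x ∈ (PrimeSpectrum.zeroLocus (t : Set A))ᶜ :=
    (Set.ext_iff.1 ht x).symm
  refine h1.trans ((show _ ↔ ∃ a ∈ (t : Set A), a ∉ x.asIdeal from Set.not_subset).trans ?_)
  constructor
  · rintro ⟨a, ha, h⟩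
    exact ⟨t.equivFin ⟨a, ha⟩, by
      have := t.equivFin.symm_apply_apply ⟨a, ha⟩
      change ¬ ((t.equivFin.symm (t.equivFin ⟨a, ha⟩) : A) ∈ x.asIdeal)
      rw [this]; exact h⟩
  · rintro ⟨i, hi⟩
    exact ⟨_, (t.equivFin.symm i).2, hi⟩

variable {Y : Scheme.{u}} (p : Y ⟶ Spec (CommRingCat.of A))

lemma exists_cover {ι : Type} [Finite ι] (f : ι → A) [QuasiCompact p] :
    ∃ (n : ℕ) (U : Fin n → Y.affineOpens) (idx : Fin n → ι),
      (∀ k y, y ∈ (U k).1 → p y ∈ PrimeSpectrum.basicOpen (f (idx k))) ∧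
      ∀ y i, p y ∈ PrimeSpectrum.basicOpen (f i) → ∃ k, idx k = i ∧ y ∈ (U k).1 := by
  have H : ∀ i, ∃ s : Set Y.affineOpens, s.Finite ∧
      p ⁻¹ᵁ (PrimeSpectrum.basicOpen (f i)) = ⨆ i ∈ s, (i : Y.Opens) := by
    intro i
    refine isCompact_iff_finite_and_eq_biUnion_affineOpens.1 ?_
    exact QuasiCompact.isCompact_preimage (f := p)
      ((PrimeSpectrum.basicOpen (f i) : TopologicalSpace.Opens (PrimeSpectrum A)) :
        Set (PrimeSpectrum A)) (PrimeSpectrum.basicOpen (f i)).2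
      (PrimeSpectrum.isCompact_basicOpen (f i))
  choose s hs hU using H
  have : ∀ i, Finite (s i) := fun i => hs i
  let e := Finite.equivFin (Σ i, s i)
  refine ⟨_, fun k => (e.symm k).2.1, fun k => (e.symm k).1, ?_, ?_⟩
  · intro k y hy
    have h1 : y ∈ p ⁻¹ᵁ (PrimeSpectrum.basicOpen (f (e.symm k).1)) := by
      rw [hU]
      exact TopologicalSpace.Opens.mem_iSup.2 ⟨_, TopologicalSpace.Opens.mem_iSup.2
        ⟨(e.symm k).2.2, hy⟩⟩
    exact h1
  · intro y i hi
    have h1 : y ∈ p ⁻¹ᵁ (PrimeSpectrum.basicOpen (f i)) := hi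
    rw [hU] at h1
    obtain ⟨V, hV⟩ := TopologicalSpace.Opens.mem_iSup.1 h1
    obtain ⟨hV, hy⟩ := TopologicalSpace.Opens.mem_iSup.1 hV
    exact ⟨e ⟨i, V, hV⟩, by beta_reduce; rw [e.symm_apply_apply], by
      beta_reduce; rw [e.symm_apply_apply]; exact hy⟩

lemma unit_al {V : Y.Opens} {a : A} (h : ∀ y ∈ V, p y ∈ PrimeSpectrum.basicOpen a) :
    IsUnit ((alc p V).hom a) := by
  have h1 : Y.basicOpen ((alc p V).hom a) = V := by
    rw [basicOpen_al]
    exact inf_eq_left.2 h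
  exact (RingedSpace.isUnit_of_isUnit_germ _ _ _ fun x hx =>
    (RingedSpace.mem_basicOpen _ _ _ hx).1 (h1.ge hx))

lemma gens [LocallyOfFiniteType p] {V : Y.Opens} (hV : IsAffineOpen V) :
    ∃ s : Finset Γ(Y, V), ∀ x, x ∈ Subring.closure (Set.range (alc p V).hom ∪ s) := by
  have h1 := p.finiteType_appLE (isAffineOpen_top _) hV le_top
  have h2 : (alc p V).hom.FiniteType := by
    rw [alc, CommRingCat.hom_comp]
    refine RingHom.FiniteType.comp h1 (RingHom.FiniteType.of_surjective _ ?_)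
    exact (ConcreteCategory.bijective_of_isIso (Scheme.ΓSpecIso _).inv).2
  let _ := (alc p V).hom.toAlgebra
  obtain ⟨s, hs⟩ := h2.out
  refine ⟨s, fun x => ?_⟩
  have h3 := Algebra.adjoin_eq_ring_closure (R := CommRingCat.of A) (A := Γ(Y, V)) (s : Set Γ(Y, V))
  have h4 : x ∈ (Algebra.adjoin (CommRingCat.of A) (s : Set Γ(Y, V))).toSubring := by
    rw [hs]; trivial
  rw [h3] at h4
  exact h4

lemma val {ι : Type} (f : ι → A) (T : (Spec (CommRingCat.of A)).Opens)
    (hT : ∀ x : Spec (CommRingCat.of A), x ∈ T ↔ ∃ i, x ∈ PrimeSpectrum.basicOpen (f i))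
    (g : Y ⟶ T.toScheme) [IsProper g] (hp : g ≫ T.ι = p) [IsSeparated p]
    {κ : Type} (U : κ → Y.affineOpens) (idx : κ → ι)
    (hU : ∀ y i, p y ∈ PrimeSpectrum.basicOpen (f i) → ∃ k, idx k = i ∧ y ∈ (U k).1)
    (k : κ) (K : Type u) [Field K] (O : ValuationSubring K) (ev : Γ(Y, (U k).1) →+* K)
    (h1 : ∀ a, ev ((alc p _).hom a) ∈ O) (h2 : (ev ((alc p _).hom (f (idx k))))⁻¹ ∈ O)
    (h3 : ev ((alc p _).hom (f (idx k))) ≠ 0) : ∃ k1, idx k1 = idx k ∧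
        ∃ h : Γ(Y, (U k).1 ⊓ (U k1).1) →+* K,
          (∀ x, h ((Y.presheaf.map (homOfLE inf_le_left).op).hom x) = ev x) ∧
          ∀ x, h ((Y.presheaf.map (homOfLE inf_le_right).op).hom x) ∈ O := by
  let α : A →+* O := (ev.comp (alc p (U k).1).hom).codRestrict O.toSubring h1
  have hUk : IsAffineOpen (U k).1 := (U k).2
  let i₁ : Spec (CommRingCat.of K) ⟶ Y := Spec.map (CommRingCat.ofHom ev) ≫ hUk.fromSpec
  have hunit : IsUnit (α (f (idx k))) := by
    refine IsUnit.of_mul_eq_one ⟨_, h2⟩ (Subtype.ext ?_)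
    exact mul_inv_cancel₀ h3
  have hrange : Set.range (Spec.map (CommRingCat.ofHom α)) ⊆ Set.range T.ι := by
    rintro _ ⟨x, rfl⟩
    rw [Scheme.Opens.range_ι]
    refine (hT _).2 ⟨idx k, ?_⟩
    intro hmem
    exact x.2.ne_top (Ideal.eq_top_of_isUnit_mem _ hmem hunit)
  let i₂ : Spec (CommRingCat.of O) ⟶ T.toScheme := IsOpenImmersion.lift T.ι _ hrange
  have hi₂ : i₂ ≫ T.ι = Spec.map (CommRingCat.ofHom α) := IsOpenImmersion.lift_fac _ _ _
  have hsq : i₁ ≫ g = Spec.map (CommRingCat.ofHom (algebraMap O K)) ≫ i₂ := by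
    rw [← cancel_mono T.ι, Category.assoc, hp, Category.assoc, Category.assoc, hi₂,
      fromSpec_p, ← Spec.map_comp, ← Spec.map_comp]
    rfl
  have hex : ValuativeCriterion.Existence g := by
    have : IsProper g := inferInstance
    rw [IsProper.eq_valuativeCriterion] at this
    exact this.1.1.1.existence
  let S : ValuativeCommSq g := { R := O, K := K, i₁ := i₁, i₂ := i₂, commSq := ⟨hsq⟩ }
  obtain ⟨⟨l, hl1, hl2⟩⟩ := (hex S).exists_lift
  change Spec (CommRingCat.of O) ⟶ Y at l
  change Spec.map (CommRingCat.ofHom (algebraMap O K)) ≫ l = i₁ at hl1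
  change l ≫ g = i₂ at hl2
  have hlp : l ≫ p = Spec.map (CommRingCat.ofHom α) := by
    rw [← hp, ← Category.assoc, hl2, hi₂]
  have hpt : p (l (IsLocalRing.closedPoint O)) ∈ PrimeSpectrum.basicOpen (f (idx k)) := by
    have e1 : p (l (IsLocalRing.closedPoint O)) =
      Spec.map (CommRingCat.ofHom α) (IsLocalRing.closedPoint O) := by rw [← hlp]; rfl
    rw [e1]
    intro hmem
    exact (IsLocalRing.closedPoint O).2.ne_top (Ideal.eq_top_of_isUnit_mem _ hmem hunit)
  obtain ⟨k1, hk1, hy⟩ := hU _ _ hpt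
  have hle := top_le l (U k1).1 hy
  have m1 : ⊤ ≤ i₁ ⁻¹ᵁ (U k1).1 := by
    rw [← hl1]
    intro x _
    exact hle (show Spec.map (CommRingCat.ofHom (algebraMap O K)) x ∈ _ from trivial)
  have m0 : ⊤ ≤ i₁ ⁻¹ᵁ (U k).1 := by
    intro x _
    exact hUk.fromSpec_preimage_self.ge (show Spec.map (CommRingCat.ofHom ev) x ∈ _ from trivial)
  refine ⟨k1, hk1, (evAt i₁ ((U k).1 ⊓ (U k1).1) (le_inf m0 m1)).hom, fun x => ?_, fun x => ?_⟩
  · have e1 := res_evAt i₁ (inf_le_left : (U k).1 ⊓ (U k1).1 ≤ _) (le_inf m0 m1) m0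
    rw [← CommRingCat.comp_apply, e1]
    have e2 : evAt i₁ (U k).1 m0 = CommRingCat.ofHom ev := evAt_fromSpec hUk _ _
    rw [e2]; rfl
  · have e1 := res_evAt i₁ (inf_le_right : (U k).1 ⊓ (U k1).1 ≤ _) (le_inf m0 m1) m1
    rw [← CommRingCat.comp_apply, e1]
    have m2 : ⊤ ≤ (Spec.map (CommRingCat.ofHom (algebraMap O K)) ≫ l) ⁻¹ᵁ (U k1).1 := hl1 ▸ m1
    have e2 : evAt i₁ (U k1).1 m1 = evAt l (U k1).1 hle ≫ CommRingCat.ofHom (algebraMap O K) := by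
      rw [← evAt_comp l _ _ hle m2]
      congr 1
      exact hl1.symm
    rw [e2, CommRingCat.comp_apply]
    exact ((evAt l (U k1).1 hle).hom x).2

/-- main output of the combinatorial part -/
theorem exists_atlas {ι : Type} [Finite ι] (f : ι → A) (T : (Spec (CommRingCat.of A)).Opens)
    (hT : ∀ x : Spec (CommRingCat.of A), x ∈ T ↔ ∃ i, x ∈ PrimeSpectrum.basicOpen (f i))
    (g : Y ⟶ T.toScheme) [IsProper g] (hp : g ≫ T.ι = p) [IsSeparated p] [QuasiCompact p]
    [LocallyOfFiniteType p] :
    ∃ (l : Finset A) (M : Set (schSite f p).Chart), M.Finite ∧ Site.Chart.Atlas M ∧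
      ∀ (K : Type u) [Field K] (φ : Spec (CommRingCat.of K) ⟶ Y) (O : ValuationSubring K),
        (geoPl p f φ O).Has l → ∃ n ∈ M, (geoPl p f φ O).On n := by
  classical
  obtain ⟨n, U, idx, hUa, hUb⟩ := exists_cover p f
  choose s hs using fun k => gens p (U k).2
  obtain ⟨l, N, hN⟩ := Site.cov_charts (Y := schSite f p) U idx
    (fun k => unit_al p (hUa k)) s hs (by
      intro k K _ O ev h1 h2
      change Γ(Y, (U k).1) →+* K at ev
      exact val p f T hT g hp U idx hUb k K O ev h1 h2
        (((unit_al p (hUa k)).map ev).ne_zero))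
  obtain ⟨l', M, hM1, hM2, hM3⟩ := Site.Chart.exists_atlas (Y := schSite f p)
    (Set.range fun k => Site.ini (Y := schSite f p) (U k) (idx k) (unit_al p (hUa k)) (s k) (hs k) N)
    (Set.finite_range _)
  refine ⟨l ∪ l', M, hM1, hM2, fun K _ φ O hO => hM3 _ (hO.subset Finset.subset_union_right) ?_⟩
  obtain ⟨k, hk⟩ := hN (geoPl p f φ O) (geoPl_geo p f φ O U idx (fun y => by
    have h1 : p y ∈ T := by
      rw [← hp, Scheme.Hom.comp_apply]
      exact (g y).2
    exact (hT _).1 h1) hUb) (hO.subset Finset.subset_union_left)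
  exact ⟨_, ⟨k, rfl⟩, hk⟩

end SchSite

end

section

lemma alg_place {G : Type u} [CommRing G] (B : Subring G) {K : Type u} [Field K] (φ : B →+* K)
    (R : ValuationSubring K) :
    ∃ (L : Type u) (_ : Field L) (e : G →+* L) (O : ValuationSubring L) (k : Type u) (_ : Field k)
      (r : O →+* k) (R2 : ValuationSubring k) (O' : ValuationSubring L)
      (hB : ∀ b : B, e b ∈ O),
      (∀ x, x ∈ O' ↔ ∃ hx : x ∈ O, r ⟨x, hx⟩ ∈ R2) ∧
      (∀ b : B, r ⟨e b, hB b⟩ = 0 ↔ φ b = 0) ∧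
      (∀ b s : B, φ s ≠ 0 → (r ⟨e b, hB b⟩ / r ⟨e s, hB s⟩ ∈ R2 ↔ φ b / φ s ∈ R)) := by
  let q : Ideal B := RingHom.ker φ
  have hq : q.IsPrime := RingHom.ker_isPrime φ
  obtain ⟨η, hη, hηq⟩ := Ideal.exists_minimalPrimes_le (bot_le : ⊥ ≤ q)
  obtain ⟨P, hP, hPη⟩ := Ideal.exists_comap_eq_of_mem_minimalPrimes_of_injective
    (f := B.subtype) Subtype.val_injective η hη
  let L := FractionRing (G ⧸ P)
  let e : G →+* L := (algebraMap (G ⧸ P) L).comp (Ideal.Quotient.mk P)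
  have he : ∀ b : B, e b = 0 ↔ b ∈ η := by
    intro b
    rw [← hPη, Ideal.mem_comap]
    simp only [e, RingHom.comp_apply]
    rw [map_eq_zero_iff _ (IsFractionRing.injective (G ⧸ P) L), Ideal.Quotient.eq_zero_iff_mem]
    rfl
  let E : Localization.AtPrime q →+* L := IsLocalization.lift (M := q.primeCompl)
    (g := e.comp B.subtype) (fun y => by
      refine IsUnit.mk0 _ fun h => y.2 (hηq ((he y.1).1 h)))
  have hE : ∀ b : B, E (algebraMap _ _ b) = e b := fun b => IsLocalization.lift_eq _ b
  obtain ⟨O, hO, hloc⟩ := IsLocalRing.exists_factor_valuationRing E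
  have hB : ∀ b : B, e b ∈ O := fun b => hE b ▸ hO _
  let k := IsLocalRing.ResidueField O
  let r : O →+* k := IsLocalRing.residue O
  have hr : ∀ b : B, r ⟨e b, hB b⟩ = 0 ↔ φ b = 0 := by
    intro b
    have h1 : (⟨e b, hB b⟩ : O) = (E.codRestrict O.toSubring hO) (algebraMap _ _ b) :=
      Subtype.ext (hE b).symm
    rw [IsLocalRing.residue_eq_zero_iff, h1, IsLocalRing.mem_maximalIdeal, mem_nonunits_iff,
      ← mem_nonunits_iff, map_mem_nonunits_iff, mem_nonunits_iff,
      IsLocalization.AtPrime.isUnit_to_map_iff (Localization.AtPrime q) q]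
    simp [q]
  let rr : B →+* k := r.comp ((e.comp B.subtype).codRestrict O.toSubring hB)
  have hrr : ∀ b, rr b = r ⟨e b, hB b⟩ := fun _ => rfl
  let F := q.ResidueField
  let i : F →+* K := Ideal.ResidueField.lift q φ le_rfl (fun x hx => IsUnit.mk0 _ hx)
  let j : F →+* k := Ideal.ResidueField.lift q rr (fun x hx => (hr x).2 hx)
    (fun x hx => IsUnit.mk0 _ fun h => hx ((hr x).1 h))
  have hi : ∀ b, i (algebraMap B F b) = φ b := fun b => Ideal.ResidueField.lift_algebraMap ..
  have hj : ∀ b, j (algebraMap B F b) = rr b := fun b => Ideal.ResidueField.lift_algebraMap ..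
  let R1 : ValuationSubring F := R.comap i
  have : IsLocalRing R1.toSubring := inferInstanceAs (IsLocalRing R1)
  obtain ⟨R2, hR2, hl2⟩ := IsLocalRing.exists_factor_valuationRing (j.comp R1.toSubring.subtype)
  have hjR : ∀ x, j x ∈ R2 ↔ i x ∈ R := by
    intro x
    refine ⟨fun h => ?_, fun h => hR2 ⟨x, h⟩⟩
    rcases R1.mem_or_inv_mem x with hx | hx
    · exact hx
    · by_cases h0 : x = 0
      · rw [h0, map_zero]; exact R.zero_mem
      have hu : IsUnit ((j.comp R1.toSubring.subtype).codRestrict R2.toSubring hR2 ⟨x⁻¹, hx⟩) := by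
        refine IsUnit.of_mul_eq_one ⟨j x, h⟩ (Subtype.ext ?_)
        change j x⁻¹ * j x = 1
        rw [← map_mul, inv_mul_cancel₀ h0, map_one]
      obtain ⟨⟨y, hy⟩, hy2⟩ := ((isUnit_map_iff _ _).1 hu).exists_right_inv
      have h3 : x⁻¹ * y = 1 := congrArg Subtype.val hy2
      have h4 : y = x := ((inv_mul_eq_one₀ h0).1 h3).symm
      exact h4 ▸ hy
  let O' : ValuationSubring L :=
    { toSubring := (R2.toSubring.comap r).map O.toSubring.subtype
      mem_or_inv_mem' := by
        intro x
        have key : ∀ (x : L) (hx : x ∈ O), r ⟨x, hx⟩ ∈ R2 →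
            x ∈ (R2.toSubring.comap r).map O.toSubring.subtype :=
          fun x h1 h2 => ⟨⟨x, h1⟩, h2, rfl⟩
        have key2 : ∀ x : L, x ∈ O → x ∈ (R2.toSubring.comap r).map O.toSubring.subtype ∨
            x⁻¹ ∈ (R2.toSubring.comap r).map O.toSubring.subtype := by
          intro x hx
          by_cases hu : IsUnit (⟨x, hx⟩ : O)
          · obtain ⟨⟨y, hy⟩, hy2⟩ := hu.exists_right_inv
            have hxy : x * y = 1 := congrArg Subtype.val hy2
            have hyx : x⁻¹ = y := inv_eq_of_mul_eq_one_right hxy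
            have hr2 : r ⟨x, hx⟩ * r ⟨y, hy⟩ = 1 := by rw [← map_mul, hy2, map_one]
            rcases R2.mem_or_inv_mem (r ⟨x, hx⟩) with h | h
            · exact Or.inl (key x hx h)
            · rw [inv_eq_of_mul_eq_one_right hr2] at h
              right; rw [hyx]; exact key y hy h
          · left
            refine key x hx ?_
            have : r ⟨x, hx⟩ = 0 := (IsLocalRing.residue_eq_zero_iff _).2 hu
            rw [this]; exact R2.zero_mem
        rcases O.mem_or_inv_mem x with hx | hx
        · exact key2 x hx
        · have := key2 _ hx
          rw [inv_inv] at this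
          exact this.symm }
  refine ⟨L, inferInstance, e, O, k, inferInstance, r, R2, O', hB, ?_, hr, ?_⟩
  · intro x
    constructor
    · rintro ⟨⟨x, hx⟩, h2, rfl⟩; exact ⟨hx, h2⟩
    · rintro ⟨hx, h2⟩; exact ⟨⟨x, hx⟩, h2, rfl⟩
  · intro b s _
    rw [← hrr, ← hrr, ← hj, ← hj, ← map_div₀, hjR, map_div₀, hi, hi]

end

section
open AlgebraicGeometry CategoryTheory CategoryTheory.Limits

lemma openImm_of_local {X Y : Scheme.{u}} (f : X ⟶ Y) (hinj : Function.Injective f)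
    (h : ∀ x : X, ∃ (W : Scheme.{u}) (w : W ⟶ X) (y : W), IsOpenImmersion w ∧ w y = x ∧
      IsOpenImmersion (w ≫ f)) : IsOpenImmersion f := by
  rw [IsOpenImmersion.iff_isIso_stalkMap]
  constructor
  · refine .of_continuous_injective_isOpenMap f.continuous hinj ?_
    rw [isOpenMap_iff_nhds_le]
    intro x
    obtain ⟨W, w, y, h1, rfl, h2⟩ := h x
    rw [← w.isOpenEmbedding.map_nhds_eq, Filter.map_map]
    exact ((w ≫ f).isOpenEmbedding.map_nhds_eq y).ge
  · intro x
    obtain ⟨W, w, y, h1, rfl, h2⟩ := h x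
    have h3 := Scheme.Hom.stalkMap_comp w f y
    have h4 : IsIso (f.stalkMap (w y) ≫ w.stalkMap y) := by
      rw [← h3]; exact (IsOpenImmersion.iff_isIso_stalkMap.1 h2).2 y
    exact IsIso.of_isIso_comp_right _ (w.stalkMap y)

namespace Site.Chart
variable {A : Type u} [CommRing A] {ι : Type} {f : ι → A} {Y : Site A ι f}

noncomputable abbrev Sp (c : Y.Chart) : Scheme.{u} := Spec (CommRingCat.of c.B)
noncomputable def Sm {c d : Y.Chart} (h : c ≤ d) : c.Sp ⟶ d.Sp :=
  Spec.map (CommRingCat.ofHom (rs h))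

lemma Sm_comp {c d e : Y.Chart} (h : c ≤ d) (k : d ≤ e) : Sm h ≫ Sm k = Sm (h.trans k) := by
  rw [Sm, Sm, Sm, ← Spec.map_comp, ← CommRingCat.ofHom_comp, rs_comp]

lemma Sm_self {c : Y.Chart} (h : c ≤ c) : Sm h = 𝟙 _ := by
  have : rs h = RingHom.id _ := RingHom.ext fun x => rs_self h x
  rw [Sm, this, CommRingCat.ofHom_id, Spec.map_id]

lemma mem_Sm {c d : Y.Chart} (h : c ≤ d) (x : c.Sp) (b : d.B) :
    b ∈ (Sm h x).asIdeal ↔ rs h b ∈ x.asIdeal := Iff.rfl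

lemma Sm_apply {c d e : Y.Chart} (h : c ≤ d) (k : d ≤ e) (x : c.Sp) :
    Sm k (Sm h x) = Sm (h.trans k) x := by
  rw [← Sm_comp h k]; rfl

lemma isIso_Sm {c d : Y.Chart} (h : c ≤ d) (k : d ≤ c) : IsIso (Sm h) :=
  ⟨Sm k, by rw [Sm_comp, Sm_self], by rw [Sm_comp, Sm_self]⟩

lemma openImm_loc (c : Y.Chart) (g : c.B) : IsOpenImmersion (Sm (loc_le (c := c) (g := g))) := by
  let _ : Algebra c.B (c.loc g).B := (rs loc_le).toAlgebra
  have : IsLocalization.Away g (c.loc g).B := isLocalization_loc c g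
  exact IsOpenImmersion.of_isLocalization (R := c.B) (S := (c.loc g).B) g

lemma exists_loc (c : Y.Chart) (g : c.B) (x : c.Sp) (hx : g ∉ x.asIdeal) :
    ∃ y : (c.loc g).Sp, Sm loc_le y = x := by
  let _ : Algebra c.B (c.loc g).B := (rs loc_le).toAlgebra
  have : IsLocalization.Away g (c.loc g).B := isLocalization_loc c g
  have h1 := PrimeSpectrum.localization_away_comap_range (c.loc g).B g
  have h2 : x ∈ Set.range (PrimeSpectrum.comap (algebraMap c.B (c.loc g).B)) := by
    rw [h1]; exact hx
  obtain ⟨y, hy⟩ := h2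
  exact ⟨y, hy⟩

lemma openImm_of_loc_le {c d : Y.Chart} (k : c ≤ d) {g : d.B} (h : d.loc g ≤ c) :
    IsOpenImmersion (Sm h) := by
  have h1 : d.loc g ≤ c.loc (rs k g) := le_loc h (by
    rw [rs_rs]; exact loc_unit le_rfl _)
  have h2 := isIso_Sm h1 (loc_mono k g)
  have h3 := openImm_loc c (rs k g)
  rw [← Sm_comp h1 loc_le]
  infer_instance

lemma Tame.pt {c d : Y.Chart} (H : Tame d c) (k : c ≤ d) (x : c.Sp) :
    ∃ g : d.B, rs k g ∉ x.asIdeal ∧ d.loc g ≤ c := by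
  have : x.asIdeal.IsPrime := x.2
  obtain ⟨g, h1, h2⟩ := H (x.asIdeal.ResidueField)
    ((algebraMap c.B x.asIdeal.ResidueField).comp (rs (le_inf' k le_rfl)))
  refine ⟨g, fun h => h1 ?_, h2⟩
  rw [RingHom.comp_apply, rs_rs]
  exact Ideal.algebraMap_residueField_eq_zero.2 h

lemma Tame.pt' {c d : Y.Chart} (H : Tame d c) (k : c ≤ d) (x : c.Sp) :
    ∃ (g : d.B) (h : d.loc g ≤ c) (y : (d.loc g).Sp), Sm h y = x ∧ rs k g ∉ x.asIdeal := by
  obtain ⟨g, h1, h2⟩ := H.pt k x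
  have h3 : d.loc g ≤ c.loc (rs k g) := le_loc h2 (by
    rw [rs_rs]; exact loc_unit le_rfl _)
  have h4 := isIso_Sm h3 (loc_mono k g)
  obtain ⟨y, hy⟩ := exists_loc c (rs k g) x h1
  refine ⟨g, h2, Sm (loc_mono k g) y, ?_, h1⟩
  rw [Sm_apply]
  exact hy

lemma Tame.openImm {c d : Y.Chart} (H : Tame d c) (k : c ≤ d) : IsOpenImmersion (Sm k) := by
  refine openImm_of_local _ ?_ ?_
  · intro x x' hxx
    obtain ⟨g, h, y, rfl, hg⟩ := H.pt' k x
    have hg' : rs k g ∉ x'.asIdeal := by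
      rw [← mem_Sm] at hg ⊢
      rwa [← hxx]
    obtain ⟨y', hy'⟩ := exists_loc c (rs k g) x' hg'
    have h5 : Sm h (Sm (loc_mono k g) y') = x' := by rw [Sm_apply]; exact hy'
    have h6 := openImm_loc d g
    rw [← h5] at hxx ⊢
    rw [Sm_apply h k, Sm_apply h k] at hxx
    rw [(Sm (loc_le (c := d) (g := g))).isOpenEmbedding.injective hxx]
  · intro x
    obtain ⟨g, h, y, rfl, hg⟩ := H.pt' k x
    refine ⟨_, Sm h, y, openImm_of_loc_le k h, rfl, ?_⟩
    rw [Sm_comp]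
    exact openImm_loc d g

lemma Tame.inf {m c d : Y.Chart} (h1 : Tame m c) (h2 : Tame m d) : Tame m (c.inf d) := by
  intro k _ φ
  obtain ⟨g1, a1, b1⟩ := h1 k (φ.comp (rs (inf_mono le_rfl inf_left)))
  obtain ⟨g2, a2, b2⟩ := h2 k (φ.comp (rs (inf_mono le_rfl inf_right)))
  rw [RingHom.comp_apply, rs_rs] at a1 a2
  refine ⟨g1 * g2, ?_, le_inf' ((loc_mul_le_left _ _).trans b1) ((loc_mul_le_right _ _).trans b2)⟩
  rw [map_mul, map_mul]
  exact mul_ne_zero a1 a2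

/-- the charts to be glued -/
structure GM (M : Set Y.Chart) where
  c : Y.Chart
  le : ∃ m ∈ M, c ≤ m
  tame : ∀ m ∈ M, Tame m c

namespace GM
variable {M : Set Y.Chart}
instance : Preorder (GM M) := Preorder.lift GM.c

lemma tame_le (c d : GM M) : Tame d.c c.c := by
  obtain ⟨m, hm, h⟩ := d.le
  exact (c.tame m hm).mono h

def of (hM : Atlas M) {m : Y.Chart} (hm : m ∈ M) : GM M := ⟨m, ⟨m, hm, le_rfl⟩, fun n hn => hM n hn m hm⟩

def inf (c d : GM M) : GM M := ⟨c.c.inf d.c, by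
  obtain ⟨m, hm, h⟩ := c.le
  exact ⟨m, hm, inf_left.trans h⟩, fun m hm => (c.tame m hm).inf (d.tame m hm)⟩

noncomputable def F (M : Set Y.Chart) : GM M ⥤ Scheme.{u} where
  obj c := c.c.Sp
  map h := Sm h.le
  map_id _ := Sm_self _
  map_comp _ _ := (Sm_comp _ _).symm

instance {c d : GM M} (h : c ⟶ d) : IsOpenImmersion ((F M).map h) := (tame_le c d).openImm h.le

lemma dir {c d k : GM M} (h1 : c.c ≤ k.c) (h2 : d.c ≤ k.c) (x : c.c.Sp) (y : d.c.Sp)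
    (hxy : Sm h1 x = Sm h2 y) : ∃ z : (c.c.inf d.c).Sp, Sm inf_left z = x ∧ Sm inf_right z = y := by
  obtain ⟨g1, a1, y1, b1, c1⟩ := (tame_le c k).pt' h1 x
  obtain ⟨g2, a2, y2, b2, c2⟩ := (tame_le d k).pt' h2 y
  rw [← mem_Sm] at c1 c2
  rw [← hxy] at c2
  obtain ⟨w, hw⟩ := exists_loc k.c (g1 * g2) (Sm h1 x) (fun h => by
    rcases (Sm h1 x).2.mem_or_mem h with h | h
    exacts [c1 h, c2 h])
  have l1 : k.c.loc (g1 * g2) ≤ c.c := (loc_mul_le_left _ _).trans a1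
  have l2 : k.c.loc (g1 * g2) ≤ d.c := (loc_mul_le_right _ _).trans a2
  have o1 := (tame_le c k).openImm h1
  have o2 := (tame_le d k).openImm h2
  refine ⟨Sm (le_inf' l1 l2) w, ?_, ?_⟩
  · apply (Sm h1).isOpenEmbedding.injective
    rw [Sm_apply, Sm_apply]; exact hw
  · apply (Sm h2).isOpenEmbedding.injective
    rw [Sm_apply, Sm_apply]; exact hw.trans hxy

instance : (F M ⋙ Scheme.forget).IsLocallyDirected := ⟨by
  intro c d k h1 h2 x y hxy
  obtain ⟨z, hz1, hz2⟩ := dir h1.le h2.le x y hxy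
  exact ⟨c.inf d, homOfLE (inf_left : c.c.inf d.c ≤ _), homOfLE (inf_right : c.c.inf d.c ≤ _),
    z, hz1, hz2⟩⟩

noncomputable def X (M : Set Y.Chart) : Scheme.{u} := colimit (F M)
noncomputable def j (c : GM M) : c.c.Sp ⟶ X M := colimit.ι (F M) c
instance (c : GM M) : IsOpenImmersion c.j :=
  inferInstanceAs (IsOpenImmersion (colimit.ι (F M) c))
lemma Sm_j {c d : GM M} (h : c.c ≤ d.c) : Sm h ≫ d.j = c.j :=
  colimit.w (F M) (homOfLE (show c ≤ d from h))
lemma Sm_j_apply {c d : GM M} (h : c.c ≤ d.c) (x : c.c.Sp) : d.j (Sm h x) = c.j x := by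
  rw [← Sm_j h]; rfl
lemma exists_j (x : X M) : ∃ (c : GM M) (y : c.c.Sp), c.j y = x :=
  Scheme.IsLocallyDirected.ι_jointly_surjective (F M) x
lemma exists_jM (hM : Atlas M) (x : X M) : ∃ (m : Y.Chart) (hm : m ∈ M) (y : m.Sp), (of hM hm).j y = x := by
  obtain ⟨c, y, rfl⟩ := exists_j x
  obtain ⟨m, hm, h⟩ := c.le
  exact ⟨m, hm, Sm h y, Sm_j_apply (d := of hM hm) h y⟩
lemma j_eq {c d : GM M} {x : c.c.Sp} {y : d.c.Sp} (h : c.j x = d.j y) :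
    ∃ z : (c.c.inf d.c).Sp, Sm inf_left z = x ∧ Sm inf_right z = y := by
  obtain ⟨k, k1, k2, z, hz1, hz2⟩ := (Scheme.IsLocallyDirected.ι_eq_ι_iff (F M)).1 h
  exact ⟨Sm (le_inf' k1.le k2.le) z, (Sm_apply _ _ _).trans hz1, (Sm_apply _ _ _).trans hz2⟩
noncomputable def desc {Z : Scheme.{u}} (φ : ∀ c : GM M, c.c.Sp ⟶ Z)
    (h : ∀ (c d : GM M) (k : c.c ≤ d.c), Sm k ≫ φ d = φ c) : X M ⟶ Z :=
  colimit.desc (F M) (Cocone.mk Z (NatTrans.mk φ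
    fun c d k => Eq.trans (h c d k.le) (Category.comp_id _).symm))
lemma j_desc {Z : Scheme.{u}} (φ : ∀ c : GM M, c.c.Sp ⟶ Z)
    (h : ∀ (c d : GM M) (k : c.c ≤ d.c), Sm k ≫ φ d = φ c) (c) : c.j ≫ desc φ h = φ c :=
  colimit.ι_desc _ _
end GM
end Site.Chart

end

section
open AlgebraicGeometry CategoryTheory CategoryTheory.Limits

namespace Site.Chart
variable {A : Type u} [CommRing A] {ι : Type} {f : ι → A} {Y : Site A ι f}

/-- the covering property of a set of charts -/
def Cov (M : Set Y.Chart) (l : Finset A) : Prop :=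
  ∀ c ∈ M, ∀ (L : Type u) [Field L] (e : Y.R c.V →+* L) (O : ValuationSubring L),
    (∀ a ∈ l, e (Y.al c.V a) ∈ O) → ∃ d ∈ M, ∃ e' : Y.R (c.V ⊓ d.V) →+* L,
      (∀ x, e' (Y.res inf_le_left x) = e x) ∧ ∀ x ∈ d.B, e' (Y.res inf_le_right x) ∈ O

lemma exist_alg {M : Set Y.Chart} {l : Finset A} (hA : Atlas M) (hC : Cov M l) {c : Y.Chart}
    (hc : c ∈ M) (hl : c.Has l) {K : Type u} [Field K] (φ : c.B →+* K) (R : ValuationSubring K)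
    (hφ : ∀ a (ha : a ∈ l), φ ⟨Y.al c.V a, hl a ha⟩ ∈ R) :
    ∃ d ∈ M, ∃ (h : c.B) (hd : c.loc h ≤ d) (ψ : (c.loc h).B →+* K),
      ψ.comp (rs loc_le) = φ ∧ ∀ x : d.B, ψ (rs hd x) ∈ R := by
  obtain ⟨L, _, e, O, k, _, r, R2, O', hB, hO', h0, hdiv⟩ := alg_place c.B φ R
  have hOO : ∀ x ∈ O', x ∈ O := fun x hx => ((hO' x).1 hx).1
  obtain ⟨d, hd, e', he1, he2⟩ := hC c hc L e O' (fun a ha => by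
    rw [hO']
    refine ⟨hB ⟨_, hl a ha⟩, ?_⟩
    have := (hdiv ⟨_, hl a ha⟩ 1 (by simp)).2 (by simpa using hφ a ha)
    have h1 : r ⟨e ((1 : c.B) : Y.R c.V), hB 1⟩ = 1 := by
      rw [← map_one r]; congr 1; ext; simp
    rwa [h1, div_one] at this)
  have hin : ∀ x ∈ (c.inf d).B, e' x ∈ O := by
    intro x hx
    refine (Subring.closure_le (t := O.toSubring.comap e')).2 ?_ hx
    rintro _ (⟨y, hy, rfl⟩ | ⟨y, hy, rfl⟩)
    · change e' _ ∈ O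
      rw [he1]; exact hB ⟨y, hy⟩
    · exact hOO _ (he2 y hy)
  let θ : (c.inf d).B →+* O.toSubring := (e'.comp (c.inf d).B.subtype).codRestrict O.toSubring
    fun x => hin x x.2
  obtain ⟨h, hh, hle⟩ := hA c hc d hd k ((r : O.toSubring →+* k).comp θ)
  have hθ : ∀ b : c.B, θ (rs inf_left b) = ⟨e b, hB b⟩ := fun b => Subtype.ext (he1 b)
  have hφh : φ h ≠ 0 := by
    intro hz
    apply hh
    rw [RingHom.comp_apply, hθ]
    exact (h0 h).2 hz
  let _ : Algebra c.B (c.loc h).B := (rs loc_le).toAlgebra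
  have := isLocalization_loc c h
  have hu : IsUnit (φ h) := hφh.isUnit
  let ψ : (c.loc h).B →+* K := IsLocalization.Away.lift h hu
  have hψ : ∀ b, ψ (rs loc_le b) = φ b := fun b => IsLocalization.Away.lift_eq h hu b
  refine ⟨d, hd, h, hle, ψ, RingHom.ext hψ, fun x => ?_⟩
  obtain ⟨a, y, hy⟩ := exists_num hle (inf_left (c := c) (d := d)) inf_right x
  have e1 := congrArg (fun t => ψ (rs (le_inf' loc_le hle) t)) hy
  simp only [map_mul, map_pow, rs_rs, hψ] at e1
  have e2 := congrArg (fun t => r (θ t)) hy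
  rw [← map_pow] at e2
  simp only [map_mul (rs _), map_mul θ, map_mul r, hθ] at e2
  have hφa : φ (h ^ a) ≠ 0 := by rw [map_pow]; exact pow_ne_zero _ hφh
  have e3 : ψ (rs hle x) = φ y / φ (h ^ a) := by
    rw [eq_div_iff hφa, e1, map_pow, mul_comm]
  rw [e3, ← hdiv _ _ hφa]
  have hne : r ⟨e (h ^ a : c.B), hB _⟩ ≠ 0 := fun hz => hφa ((h0 _).1 hz)
  have e4 : r ⟨e y, hB y⟩ / r ⟨e (h ^ a : c.B), hB _⟩ = r (θ (rs inf_right x)) := by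
    rw [div_eq_iff hne, mul_comm]
    exact e2
  rw [e4]
  exact ((hO' _).1 (he2 x x.2)).2

namespace GM
variable {M : Set Y.Chart}

lemma factor (c : GM M) {R : Type u} [CommRing R] [IsLocalRing R] (φ : Spec (CommRingCat.of R) ⟶ X M)
    (h : φ (IsLocalRing.closedPoint R) ∈ Set.range c.j) :
    ∃ ψ : c.c.B →+* R, φ = Spec.map (CommRingCat.ofHom ψ) ≫ c.j := by
  have h1 : ⊤ ≤ φ ⁻¹ᵁ c.j.opensRange := SchSite.top_le φ _ h
  have h2 : Set.range φ ⊆ Set.range c.j := by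
    rintro _ ⟨x, rfl⟩
    exact h1 (show x ∈ ⊤ from trivial)
  refine ⟨(Spec.preimage (IsOpenImmersion.lift c.j φ h2)).hom, ?_⟩
  rw [CommRingCat.ofHom_hom, Spec.map_preimage, IsOpenImmersion.lift_fac]
end GM
end Site.Chart

end

section
open AlgebraicGeometry CategoryTheory CategoryTheory.Limits

lemma lift_range {B R K : Type u} [CommRing B] [CommRing R] [CommRing K] (χ : B →+* K) (i : R →+* K)
    (hi : Function.Injective i) (h : ∀ x, ∃ r, i r = χ x) : ∃ ψ : B →+* R, i.comp ψ = χ := by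
  choose g hg using h
  exact ⟨{ toFun := g
           map_one' := hi (by simp [hg])
           map_zero' := hi (by simp [hg])
           map_mul' := fun x y => hi (by simp [hg])
           map_add' := fun x y => hi (by simp [hg]) }, RingHom.ext hg⟩

namespace Site.Chart
variable {A : Type u} [CommRing A] {ι : Type} {f : ι → A} {Y : Site A ι f}
namespace GM
variable {M : Set Y.Chart}

lemma exists_factor (hM : Atlas M) {R : Type u} [CommRing R] [IsLocalRing R]
    (φ : Spec (CommRingCat.of R) ⟶ X M) :
    ∃ (c : GM M) (ψ : c.c.B →+* R), φ = Spec.map (CommRingCat.ofHom ψ) ≫ c.j := by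
  obtain ⟨m, hm, x, hx⟩ := exists_jM hM (φ (IsLocalRing.closedPoint R))
  exact ⟨_, (of hM hm).factor φ ⟨x, hx⟩⟩

lemma map_j_iff {c d : GM M} (h : d.c ≤ c.c) {R : Type u} [CommRing R] (ψ : c.c.B →+* R)
    (χ : d.c.B →+* R) : Spec.map (CommRingCat.ofHom ψ) ≫ c.j = Spec.map (CommRingCat.ofHom χ) ≫ d.j ↔
      χ.comp (rs h) = ψ := by
  rw [← Sm_j h, Sm, ← Category.assoc, cancel_mono, ← Spec.map_comp]
  constructor
  · intro h1
    exact congrArg CommRingCat.Hom.hom (Spec.map_injective h1).symm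
  · rintro rfl; rfl
lemma infl (c d : GM M) : (c.inf d).c ≤ c.c := inf_left
lemma infr (c d : GM M) : (c.inf d).c ≤ d.c := inf_right

lemma factor_unique {R K : Type u} [CommRing R] [IsLocalRing R] [Field K] (i : R →+* K)
    (hi : Function.Injective i) (hM : Atlas M) (a b : Spec (CommRingCat.of R) ⟶ X M)
    (h : Spec.map (CommRingCat.ofHom i) ≫ a = Spec.map (CommRingCat.ofHom i) ≫ b) : a = b := by
  obtain ⟨c, ψ1, rfl⟩ := exists_factor hM a
  obtain ⟨d, ψ2, rfl⟩ := exists_factor hM b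
  have h' := congrArg (fun t : Spec (CommRingCat.of K) ⟶ X M => t (IsLocalRing.closedPoint K)) h
  obtain ⟨z, hz1, hz2⟩ := j_eq (c := c) (d := d)
    (x := Spec.map (CommRingCat.ofHom ψ1) (Spec.map (CommRingCat.ofHom i) (IsLocalRing.closedPoint K)))
    (y := Spec.map (CommRingCat.ofHom ψ2) (Spec.map (CommRingCat.ofHom i) (IsLocalRing.closedPoint K)))
    h'
  obtain ⟨χ, hχ⟩ := (c.inf d).factor
    (Spec.map (CommRingCat.ofHom i) ≫ Spec.map (CommRingCat.ofHom ψ1) ≫ c.j) ⟨z, by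
      refine (Sm_j_apply (c := c.inf d) (d := c) inf_left z).symm.trans ?_
      exact congrArg c.j hz1⟩
  have k1 : χ.comp (rs (infl c d)) = i.comp ψ1 := by
    rw [← map_j_iff, CommRingCat.ofHom_comp, Spec.map_comp, Category.assoc, hχ]
  have k2 : χ.comp (rs (infr c d)) = i.comp ψ2 := by
    rw [← map_j_iff, CommRingCat.ofHom_comp, Spec.map_comp, Category.assoc, ← h, hχ]
  have hr : ∀ x, ∃ r, i r = χ x := by
    suffices H : ∀ (t : Y.R (c.inf d).c.V) (ht : t ∈ (c.inf d).c.B), χ ⟨t, ht⟩ ∈ i.range from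
      fun x => H x.1 x.2
    intro t ht
    refine Subring.closure_induction (p := fun t ht => χ ⟨t, ht⟩ ∈ i.range) ?_ ?_ ?_ ?_ ?_ ?_ ht
    · rintro _ (⟨y, hy, rfl⟩ | ⟨y, hy, rfl⟩)
      · exact ⟨ψ1 ⟨y, hy⟩, (RingHom.congr_fun k1 ⟨y, hy⟩).symm⟩
      · exact ⟨ψ2 ⟨y, hy⟩, (RingHom.congr_fun k2 ⟨y, hy⟩).symm⟩
    · exact ⟨0, by rw [map_zero]; exact (map_zero χ).symm⟩
    · exact ⟨1, by rw [map_one]; exact (map_one χ).symm⟩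
    · intro x y hx hy h1 h2
      have := add_mem h1 h2
      rwa [← map_add] at this
    · intro x hx h1
      have := neg_mem h1
      rwa [← map_neg] at this
    · intro x y hx hy h1 h2
      have := mul_mem h1 h2
      rwa [← map_mul] at this
  obtain ⟨ψ, hψ⟩ := lift_range χ i hi hr
  have e1 : ψ.comp (rs (infl c d)) = ψ1 := RingHom.ext fun x => hi (by
    rw [← RingHom.comp_apply, ← RingHom.comp_assoc, hψ, k1]; rfl)
  have e2 : ψ.comp (rs (infr c d)) = ψ2 := RingHom.ext fun x => hi (by
    rw [← RingHom.comp_apply, ← RingHom.comp_assoc, hψ, k2]; rfl)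
  rw [(map_j_iff (infl c d) ψ1 ψ).2 e1, (map_j_iff (infr c d) ψ2 ψ).2 e2]

/-- structure map of a chart -/
def be {l : Finset A} (c : Y.Chart) (hl : c.Has l) : Subring.closure (l : Set A) →+* c.B :=
  ((Y.al c.V).comp (Subring.subtype _)).codRestrict c.B (by
    rintro ⟨x, hx⟩
    refine (Subring.closure_le (t := c.B.comap (Y.al c.V))).2 (fun a ha => hl a ha) hx)

lemma rs_be {l : Finset A} {c d : Y.Chart} (hl : c.Has l) (hl' : d.Has l) (k : d ≤ c) :
    (rs k).comp (be c hl) = be d hl' := RingHom.ext fun _ => Subtype.ext (Y.res_al _ _)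

lemma has {l : Finset A} (hl : ∀ m ∈ M, m.Has l) (c : GM M) : c.c.Has l := by
  obtain ⟨m, hm, h⟩ := c.le
  exact (hl m hm).mono h

noncomputable def pi {l : Finset A} (hl : ∀ m ∈ M, m.Has l) :
    X M ⟶ Spec (CommRingCat.of (Subring.closure (l : Set A))) :=
  desc (fun c => Spec.map (CommRingCat.ofHom (be c.c (has hl c)))) (fun c d k => by
    rw [Sm, ← Spec.map_comp, ← CommRingCat.ofHom_comp, rs_be _ (has hl c)])

lemma j_pi {l : Finset A} (hl : ∀ m ∈ M, m.Has l) (c : GM M) :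
    c.j ≫ pi hl = Spec.map (CommRingCat.ofHom (be c.c (has hl c))) := j_desc _ _ _

instance noeth (l : Finset A) : IsNoetherianRing (Subring.closure (l : Set A)) := by
  have h2 : (Algebra.adjoin ℤ (l : Set A)).FG := ⟨l, by simp⟩
  have h3 : IsNoetherianRing (Algebra.adjoin ℤ (l : Set A)) := by
    have : Algebra.FiniteType ℤ (Algebra.adjoin ℤ (l : Set A)) := (Subalgebra.fg_iff_finiteType _).1 h2
    exact Algebra.FiniteType.isNoetherianRing ℤ _
  have h4 : (Algebra.adjoin ℤ (l : Set A)).toSubring = Subring.closure l := by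
    rw [Algebra.adjoin_int]; rfl
  rw [← h4]
  exact h3

lemma be_fp {l : Finset A} (c : Y.Chart) (hl : c.Has l) : (be c hl).FinitePresentation := by
  have h1 : (be c hl).FiniteType := by
    obtain ⟨s, hs, h⟩ := c.fg
    have h2 : (Int.castRingHom c.B).FiniteType := by
      have h2 : (Algebra.adjoin ℤ s).FG := ⟨hs.toFinset, by simp⟩
      have h3 : Algebra.FiniteType ℤ (Algebra.adjoin ℤ s) := (Subalgebra.fg_iff_finiteType _).1 h2
      have h4 : (Algebra.adjoin ℤ s).toSubring = c.B := by rw [← h, Algebra.adjoin_int]; rfl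
      have h5 : (Int.castRingHom (Algebra.adjoin ℤ s).toSubring).FiniteType := by
        have e : Int.castRingHom (Algebra.adjoin ℤ s).toSubring =
          algebraMap ℤ (Algebra.adjoin ℤ s) := RingHom.ext_int _ _
        rw [e]
        exact RingHom.finiteType_algebraMap.2 h3
      rwa [h4] at h5
    have h3 : (be c hl).comp (Int.castRingHom _) = Int.castRingHom _ := RingHom.ext_int _ _
    rw [← h3] at h2
    exact RingHom.FiniteType.of_comp_finiteType h2
  exact RingHom.FinitePresentation.of_finiteType.1 h1

instance pi_fp {l : Finset A} (hl : ∀ m ∈ M, m.Has l) : LocallyOfFinitePresentation (pi hl) := by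
  have : IsZariskiLocalAtSource (@LocallyOfFinitePresentation.{u}) := HasRingHomProperty.instIsZariskiLocalAtSource (Q := RingHom.FinitePresentation)
  refine (IsZariskiLocalAtSource.iff_of_openCover (P := @LocallyOfFinitePresentation.{u})
    (f := pi hl) (Scheme.IsLocallyDirected.openCover (F M))).2 fun c => ?_
  change LocallyOfFinitePresentation (GM.j c ≫ pi hl)
  rw [j_pi hl c]
  exact (LocallyOfFinitePresentation.SpecMap_iff _).2 (be_fp _ (has hl c))

lemma compact (hA : Atlas M) (hf : M.Finite) : CompactSpace (X M) := by
  have := hf.to_subtype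
  refine ⟨?_⟩
  have : (Set.univ : Set (X M)) = ⋃ m : M, Set.range (of hA m.2).j := by
    ext x
    obtain ⟨m, hm, y, hy⟩ := exists_jM hA x
    simp only [Set.mem_univ, Set.mem_iUnion, true_iff]
    exact ⟨⟨m, hm⟩, y, hy⟩
  rw [this]
  exact isCompact_iUnion fun m => isCompact_range (of hA m.2).j.continuous

lemma locNoeth : IsLocallyNoetherian (X M) := by
  refine (isLocallyNoetherian_iff_openCover (Scheme.IsLocallyDirected.openCover (F M))).2 fun c => ?_
  change IsLocallyNoetherian (Spec (CommRingCat.of (GM.c c).B))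
  infer_instance
end GM
end Site.Chart

end

section
open AlgebraicGeometry CategoryTheory CategoryTheory.Limits
namespace Site.Chart
variable {A : Type u} [CommRing A] {ι : Type} {f : ι → A} {Y : Site A ι f}
namespace GM
variable {M : Set Y.Chart}

/-- a valuation ring inside its field -/
def vs (R K : Type u) [CommRing R] [IsDomain R] [ValuationRing R] [Field K] [Algebra R K]
    [IsFractionRing R K] : ValuationSubring K where
  __ := (algebraMap R K).range
  mem_or_inv_mem' x := by
    rcases ValuationRing.isInteger_or_isInteger R x with ⟨r, hr⟩ | ⟨r, hr⟩
    · exact Or.inl ⟨r, hr⟩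
    · exact Or.inr ⟨r, hr⟩

lemma mem_vs {R K : Type u} [CommRing R] [IsDomain R] [ValuationRing R] [Field K] [Algebra R K]
    [IsFractionRing R K] (x : K) : x ∈ vs R K ↔ ∃ r, algebraMap R K r = x := Iff.rfl

lemma exists_lift {l : Finset A} (hl : ∀ m ∈ M, m.Has l) (hA : Atlas M) (hC : Cov M l)
    {R K : Type u} [CommRing R] [IsDomain R] [ValuationRing R] [Field K] [Algebra R K]
    [IsFractionRing R K] (i₁ : Spec (CommRingCat.of K) ⟶ X M)
    (i₂ : Spec (CommRingCat.of R) ⟶ Spec (CommRingCat.of (Subring.closure (l : Set A))))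
    (w : i₁ ≫ pi hl = Spec.map (CommRingCat.ofHom (algebraMap R K)) ≫ i₂) :
    ∃ t : Spec (CommRingCat.of R) ⟶ X M,
      Spec.map (CommRingCat.ofHom (algebraMap R K)) ≫ t = i₁ ∧ t ≫ pi hl = i₂ := by
  have hinj : Function.Injective (algebraMap R K) := IsFractionRing.injective R K
  obtain ⟨m, hm, x, hx⟩ := exists_jM hA (i₁ (IsLocalRing.closedPoint K))
  obtain ⟨φ, hφ⟩ := (of hA hm).factor i₁ ⟨x, hx⟩
  obtain ⟨α, rfl⟩ := Spec.map_surjective i₂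
  have hw : φ.comp (be m (hl m hm)) = (algebraMap R K).comp α.hom := by
    rw [hφ, Category.assoc, j_pi, ← Spec.map_comp, ← Spec.map_comp] at w
    exact congrArg CommRingCat.Hom.hom (Spec.map_injective w)
  obtain ⟨d, hd, h, hle, ψ, hψ, hR⟩ := exist_alg hA hC hm (hl m hm) φ (vs R K) (fun a ha =>
    ⟨α.hom ⟨a, Subring.subset_closure ha⟩, (RingHom.congr_fun hw ⟨a, Subring.subset_closure ha⟩).symm⟩)
  obtain ⟨τ, hτ⟩ := lift_range (ψ.comp (rs hle)) (algebraMap R K) hinj (fun x => hR x)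
  let C : GM M := of hA hm
  let D : GM M := of hA hd
  let ψ' : (C.inf D).c.B →+* K := ψ.comp (rs (le_inf' loc_le hle))
  have h1 : ψ'.comp (rs (infl C D)) = φ := by
    rw [← hψ]; exact RingHom.ext fun x => congrArg ψ (rs_rs _ _ x)
  have h2 : ψ'.comp (rs (infr C D)) = (algebraMap R K).comp τ := by
    rw [hτ]; exact RingHom.ext fun x => congrArg ψ (rs_rs _ _ x)
  let τ' : D.c.B →+* R := τ
  refine ⟨Spec.map (CommRingCat.ofHom τ') ≫ D.j, ?_, ?_⟩
  · rw [← Category.assoc, ← Spec.map_comp, ← CommRingCat.ofHom_comp]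
    exact ((map_j_iff (infr C D) _ ψ').2 h2).trans
      (((map_j_iff (infl C D) _ ψ').2 h1).symm.trans hφ.symm)
  · rw [Category.assoc, j_pi, ← Spec.map_comp]
    congr 1
    ext x
    apply hinj
    have h3 := RingHom.congr_fun hτ (be d (hl d hd) x)
    have h4 := RingHom.congr_fun hψ (be m (hl m hm) x)
    have h5 := RingHom.congr_fun hw x
    refine h3.trans (Eq.trans ?_ (h4.trans h5))
    refine congrArg ψ ?_
    have hL : (m.loc h).Has l := (hl m hm).mono loc_le
    exact (RingHom.congr_fun (rs_be (hl d hd) hL hle) x).trans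
      (RingHom.congr_fun (rs_be (hl m hm) hL loc_le) x).symm

theorem proper {l : Finset A} (hl : ∀ m ∈ M, m.Has l) (hA : Atlas M) (hf : M.Finite)
    (hC : Cov M l) : IsProper (pi hl) := by
  have := compact hA hf
  have : IsLocallyNoetherian (X M) := locNoeth
  have : QuasiCompact (pi hl) := inferInstance
  have : QuasiSeparatedSpace (X M) := inferInstance
  have : QuasiSeparated (pi hl) := inferInstance
  refine IsProper.of_valuativeCriterion _ (ValuativeCriterion.iff.2 ⟨?_, ?_⟩)
  · intro S
    obtain ⟨t, h1, h2⟩ := exists_lift hl hA hC S.i₁ S.i₂ S.commSq.w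
    exact ⟨⟨⟨t, h1, h2⟩⟩⟩
  · intro S
    refine ⟨fun a b => ?_⟩
    ext1
    refine factor_unique (algebraMap S.R S.K) (IsFractionRing.injective S.R S.K) hA _ _ ?_
    exact a.fac_left.trans b.fac_left.symm
end GM
end Site.Chart

end

section

set_option maxHeartbeats 1600000 in
lemma loc_ring {A G : Type u} [CommRing A] [CommRing G] (al : A →+* G) (hfp : al.FinitePresentation)
    (s : Set G) (hs : s.Finite) (a : A) (hu : IsUnit (al a)) (ha : al a ∈ Subring.closure s)
    (good : ∀ x, ∃ (n : ℕ) (t : Set A), t.Finite ∧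
      al a ^ n * x ∈ Subring.closure s ⊔ Subring.closure (al '' t)) :
    ∃ l : Finset A, ∀ l' : Finset A, l ⊆ l' → ∀ (B : Subring G)
      (_ : B = Subring.closure s ⊔ Subring.closure (al '' (l' : Set A)))
      (C : Type u) [CommRing C] (iA : A →+* C) (iB : B →+* C)
      (_ : ∀ x ∈ Subring.closure (l' : Set A), ∀ h : al x ∈ B, iA x = iB ⟨al x, h⟩)
      (_ : ∀ c, c ∈ Subring.closure (Set.range iA ∪ Set.range iB))
      (μ : C →+* G) (_ : μ.comp iA = al) (_ : μ.comp iB = B.subtype),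
      (∀ c, μ c = 0 → ∃ n : ℕ, iA a ^ n * c = 0) ∧ ∀ x, ∃ (n : ℕ) (c : C), μ c = al a ^ n * x := by
  algebraize [al]
  have := hs.to_subtype
  obtain ⟨u, hu⟩ := hu
  obtain ⟨ev, evC, evN, evS⟩ : ∃ ev : MvPolynomial (Option s) A →ₐ[A] G,
      (∀ x, ev (MvPolynomial.C x) = al x) ∧ ev (MvPolynomial.X none) = ↑u⁻¹ ∧
      ∀ x : s, ev (MvPolynomial.X (some x)) = x.1 :=
    ⟨MvPolynomial.aeval (fun o => o.elim (↑u⁻¹) (fun x => x.1)), fun x => MvPolynomial.aeval_C _ _,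
      MvPolynomial.aeval_X _ _, fun x => MvPolynomial.aeval_X _ _⟩
  have hsev : ∀ (t : Set A), Subring.closure s ⊔ Subring.closure (al '' t) ≤ ev.toRingHom.range := by
    intro t
    refine sup_le ((Subring.closure_le).2 ?_) ((Subring.closure_le).2 ?_)
    · intro x hx
      exact ⟨MvPolynomial.X (some ⟨x, hx⟩), evS _⟩
    · rintro _ ⟨x, -, rfl⟩
      exact ⟨MvPolynomial.C x, evC x⟩
  have hev : Function.Surjective ev := by
    intro x
    obtain ⟨n, t, -, h⟩ := good x
    obtain ⟨y, hy⟩ := hsev t h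
    refine ⟨MvPolynomial.X none ^ n * y, ?_⟩
    change ev y = _ at hy
    rw [map_mul, map_pow, hy, ← hu, evN, ← mul_assoc, ← mul_pow, Units.inv_mul, one_pow, one_mul]
  obtain ⟨r, hr⟩ := Algebra.FinitePresentation.ker_fG_of_surjective ev hev
  classical
  refine ⟨insert a (r.biUnion (fun q => q.support.image q.coeff)),
    fun l' hl' B hB C _ iA iB hcomp hgen μ hA hBμ => ⟨?_, ?_⟩⟩
  swap
  · intro x
    obtain ⟨n, t, -, h⟩ := good x
    have h1 : Subring.closure s ⊔ Subring.closure (al '' t) ≤ μ.range := by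
      refine sup_le ?_ ((Subring.closure_le).2 ?_)
      · intro y hy
        have hyB : y ∈ B := by rw [hB]; exact (le_sup_left : Subring.closure s ≤ _) hy
        exact ⟨iB ⟨y, hyB⟩, RingHom.congr_fun hBμ ⟨y, hyB⟩⟩
      · rintro _ ⟨y, -, rfl⟩
        exact ⟨iA y, RingHom.congr_fun hA y⟩
    obtain ⟨c, hc⟩ := h1 h
    exact ⟨n, c, hc⟩
  have hal : ∀ x ∈ Subring.closure (l' : Set A), al x ∈ B := by
    intro x hx
    rw [hB, ← RingHom.map_closure]
    exact (le_sup_right : Subring.map al (Subring.closure (l' : Set A)) ≤ _) ⟨x, hx, rfl⟩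
  have hsB : Subring.closure s ≤ B := by rw [hB]; exact le_sup_left
  have haB : al a ∈ B := hsB ha
  have hss : ∀ x : s, x.1 ∈ B := fun x => hsB (Subring.subset_closure x.2)
  have hab : iA a = iB ⟨al a, haB⟩ := hcomp a (Subring.subset_closure (hl' (Finset.mem_insert_self _ _))) haB
  let Cf := Localization.Away (iA a)
  let z : B := ⟨al a, haB⟩
  let Bf := Localization.Away z
  have huu : IsUnit (al a) := ⟨u, hu⟩
  have hz1 : IsUnit (B.subtype z) := huu
  have hz2 : IsUnit (((algebraMap C Cf).comp iB) z) := by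
    change IsUnit (algebraMap C Cf (iB z))
    rw [← hab]
    exact IsLocalization.Away.algebraMap_isUnit _
  have hz3 : IsUnit (μ (iA a)) := by
    rw [← RingHom.comp_apply, hA]; exact huu
  obtain ⟨γ, hγ⟩ : ∃ γ : Bf →+* G, ∀ b, γ (algebraMap B Bf b) = b :=
    ⟨IsLocalization.Away.lift z hz1, fun b => IsLocalization.Away.lift_eq z hz1 b⟩
  obtain ⟨g, hg⟩ : ∃ g : Bf →+* Cf, ∀ b, g (algebraMap B Bf b) = algebraMap C Cf (iB b) :=
    ⟨IsLocalization.Away.lift z hz2, fun b => IsLocalization.Away.lift_eq z hz2 b⟩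
  obtain ⟨μf, hμf⟩ : ∃ μf : Cf →+* G, ∀ c, μf (algebraMap C Cf c) = μ c :=
    ⟨IsLocalization.Away.lift (iA a) hz3, fun b => IsLocalization.Away.lift_eq (iA a) hz3 b⟩
  have hγi : Function.Injective γ := by
    rw [injective_iff_map_eq_zero]
    intro x hx
    obtain ⟨⟨b, ⟨_, n, rfl⟩⟩, hb⟩ := IsLocalization.surj (Submonoid.powers z) x
    have h1 := congrArg γ hb
    rw [map_mul, hx, zero_mul, hγ] at h1
    have h2 : b = 0 := Subtype.ext h1.symm
    change x * algebraMap B Bf (z ^ n) = algebraMap B Bf b at hb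
    rw [h2, map_zero] at hb
    have h3 : IsUnit (algebraMap B Bf (z ^ n)) := by
      rw [map_pow]; exact (IsLocalization.Away.algebraMap_isUnit z).pow n
    exact (h3.mul_left_eq_zero).1 hb
  obtain ⟨iz, hiz⟩ : ∃ iz : Bf, algebraMap B Bf z * iz = 1 := ⟨_, IsLocalization.Away.mul_invSelf z⟩
  obtain ⟨ic, hic⟩ : ∃ ic : Cf, algebraMap C Cf (iA a) * ic = 1 :=
    ⟨_, IsLocalization.Away.mul_invSelf (iA a)⟩
  have hgi : g iz = ic := by
    have h1 := congrArg g hiz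
    rw [map_mul, hg, map_one, ← hab] at h1
    have h2 : ic * (algebraMap C Cf (iA a) * g iz) = ic := by rw [h1, mul_one]
    rw [← mul_assoc, mul_comm ic, hic, one_mul] at h2
    exact h2
  have hγi' : γ iz = ↑u⁻¹ := by
    have h1 := congrArg γ hiz
    rw [map_mul, hγ, map_one] at h1
    change al a * γ iz = 1 at h1
    rw [← hu] at h1
    rw [← Units.inv_mul_cancel_left u (γ iz), h1, mul_one]
  have hμi : μf ic = ↑u⁻¹ := by
    have h1 := congrArg μf hic
    rw [map_mul, hμf, map_one, ← RingHom.comp_apply, hA, ← hu] at h1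
    rw [← Units.inv_mul_cancel_left u (μf ic), h1, mul_one]
  obtain ⟨ψ, ψC, ψN, ψS⟩ : ∃ ψ : MvPolynomial (Option s) A →+* Cf,
      (∀ x, ψ (MvPolynomial.C x) = algebraMap C Cf (iA x)) ∧ ψ (MvPolynomial.X none) = ic ∧
      ∀ x : s, ψ (MvPolynomial.X (some x)) = algebraMap C Cf (iB ⟨x.1, hss x⟩) :=
    ⟨MvPolynomial.eval₂Hom ((algebraMap C Cf).comp iA)
      (fun o => o.elim ic (fun x => algebraMap C Cf (iB ⟨x.1, hss x⟩))),
      fun x => MvPolynomial.eval₂Hom_C _ _ _, MvPolynomial.eval₂Hom_X' _ _ _,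
      fun x => MvPolynomial.eval₂Hom_X' _ _ _⟩
  let A0 := Subring.closure (l' : Set A)
  let β : A0 →+* B := (al.comp A0.subtype).codRestrict B (fun x => hal x.1 x.2)
  obtain ⟨ψB, ψBC, ψBN, ψBS⟩ : ∃ ψB : MvPolynomial (Option s) A0 →+* Bf,
      (∀ x, ψB (MvPolynomial.C x) = algebraMap B Bf (β x)) ∧ ψB (MvPolynomial.X none) = iz ∧
      ∀ x : s, ψB (MvPolynomial.X (some x)) = algebraMap B Bf ⟨x.1, hss x⟩ :=
    ⟨MvPolynomial.eval₂Hom ((algebraMap B Bf).comp β)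
      (fun o => o.elim iz (fun x => algebraMap B Bf ⟨x.1, hss x⟩)),
      fun x => MvPolynomial.eval₂Hom_C _ _ _, MvPolynomial.eval₂Hom_X' _ _ _,
      fun x => MvPolynomial.eval₂Hom_X' _ _ _⟩
  have hψ1 : μf.comp ψ = ev.toRingHom := by
    refine MvPolynomial.ringHom_ext (fun x => ?_) (fun o => ?_)
    · rw [RingHom.comp_apply, ψC, hμf]
      exact (RingHom.congr_fun hA x).trans (evC x).symm
    · rw [RingHom.comp_apply]
      cases o with
      | none => rw [ψN, hμi]; exact evN.symm
      | some x =>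
        rw [ψS, hμf]
        exact (RingHom.congr_fun hBμ _).trans (evS x).symm
  have hψ2 : ψ.comp (MvPolynomial.map A0.subtype) = g.comp ψB := by
    refine MvPolynomial.ringHom_ext (fun x => ?_) (fun o => ?_)
    · rw [RingHom.comp_apply, RingHom.comp_apply, MvPolynomial.map_C, ψC, ψBC, hg]
      exact congrArg _ (hcomp x.1 x.2 (hal x.1 x.2))
    · rw [RingHom.comp_apply, RingHom.comp_apply, MvPolynomial.map_X]
      cases o with
      | none => rw [ψN, ψBN, hgi]
      | some x => rw [ψS, ψBS, hg]
  have hψ3 : γ.comp ψB = ev.toRingHom.comp (MvPolynomial.map A0.subtype) := by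
    refine MvPolynomial.ringHom_ext (fun x => ?_) (fun o => ?_)
    · rw [RingHom.comp_apply, RingHom.comp_apply, MvPolynomial.map_C, ψBC, hγ]
      exact (evC _).symm
    · rw [RingHom.comp_apply, RingHom.comp_apply, MvPolynomial.map_X]
      cases o with
      | none => rw [ψBN, hγi']; exact evN.symm
      | some x => rw [ψBS, hγ]; exact (evS _).symm
  have hker : ∀ q, ev q = 0 → ψ q = 0 := by
    have : RingHom.ker ev.toRingHom ≤ RingHom.ker ψ := by
      have hr' : RingHom.ker ev.toRingHom = Ideal.span (r : Set _) := hr.symm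
      rw [hr', Ideal.span_le]
      intro q hq
      have hq0 : ev q = 0 := by
        have : q ∈ RingHom.ker ev.toRingHom := by rw [hr']; exact Ideal.subset_span hq
        exact this
      obtain ⟨q', hq'⟩ : q ∈ Set.range (MvPolynomial.map A0.subtype) := by
        refine MvPolynomial.mem_range_map_iff_coeffs_subset.2 ?_
        intro x hx
        obtain ⟨n, hn, rfl⟩ := MvPolynomial.mem_coeffs_iff.1 hx
        refine ⟨⟨_, Subring.subset_closure (hl' ?_)⟩, rfl⟩
        exact Finset.mem_insert_of_mem <| Finset.mem_biUnion.2 ⟨q, hq, Finset.mem_image.2 ⟨n, hn, rfl⟩⟩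
      have h1 := RingHom.congr_fun hψ3 q'
      rw [RingHom.comp_apply, RingHom.comp_apply, hq'] at h1
      have h2 : ψB q' = 0 := hγi (by rw [h1, map_zero]; exact hq0)
      have h3 := RingHom.congr_fun hψ2 q'
      rw [RingHom.comp_apply, RingHom.comp_apply, hq', h2, map_zero] at h3
      exact h3
    exact fun q hq => this hq
  have hrange : ∀ c, algebraMap C Cf c ∈ ψ.range := by
    have h1 : (⊤ : Subring C) ≤ ψ.range.comap (algebraMap C Cf) := by
      refine le_trans (fun c _ => hgen c) ((Subring.closure_le).2 ?_)
      have hiA : ∀ x, algebraMap C Cf (iA x) ∈ ψ.range := fun x =>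
        ⟨MvPolynomial.C x, ψC x⟩
      rintro _ (⟨x, rfl⟩ | ⟨x, rfl⟩)
      · exact hiA x
      · have h2 : B ≤ (ψ.range.comap ((algebraMap C Cf).comp iB)).map B.subtype := by
          conv_lhs => rw [hB]
          refine sup_le ((Subring.closure_le).2 ?_) ((Subring.closure_le).2 ?_)
          · intro x hx
            exact ⟨⟨x, hss ⟨x, hx⟩⟩, ⟨MvPolynomial.X (some ⟨x, hx⟩), ψS _⟩, rfl⟩
          · rintro _ ⟨x, hx, rfl⟩
            have h3 := Subring.subset_closure (s := (l' : Set A)) hx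
            refine ⟨⟨al x, hal x h3⟩, ?_, rfl⟩
            change algebraMap C Cf (iB _) ∈ ψ.range
            rw [← hcomp x h3]
            exact hiA x
        obtain ⟨y, hy, hyx⟩ := h2 x.2
        have : y = x := Subtype.ext hyx
        subst this
        exact hy
    exact fun c => h1 trivial
  intro c hc
  obtain ⟨q, hq⟩ := hrange c
  have h1 : ψ q = 0 := hker q (by
    have h2 := RingHom.congr_fun hψ1 q
    rw [RingHom.comp_apply, hq, hμf, hc] at h2
    exact h2.symm)
  rw [h1] at hq
  obtain ⟨⟨_, n, rfl⟩, hn⟩ := (IsLocalization.map_eq_zero_iff (Submonoid.powers (iA a)) Cf c).1 hq.symm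
  exact ⟨n, hn⟩

end

section
open AlgebraicGeometry CategoryTheory CategoryTheory.Limits
namespace SchSite
open Site.Chart
variable {A : Type u} [CommRing A] {Y : Scheme.{u}} {p : Y ⟶ Spec (CommRingCat.of A)} {ι : Type}
  {f : ι → A} [IsSeparated p]

/-- all valuations are on some chart -/
def GCov (M : Set (schSite f p).Chart) (l : Finset A) : Prop :=
  ∀ (K : Type u) [Field K] (φ : Spec (CommRingCat.of K) ⟶ Y) (O : ValuationSubring K),
        (geoPl p f φ O).Has l → ∃ n ∈ M, (geoPl p f φ O).On n

/-- underlying open -/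
noncomputable def Vo (c : (schSite f p).Chart) : Y.Opens := (show Y.affineOpens from c.V).1

lemma Vo_aff (c : (schSite f p).Chart) : IsAffineOpen (Vo c) := (show Y.affineOpens from c.V).2

lemma Vo_le {c d : (schSite f p).Chart} (h : c ≤ d) : Vo c ≤ Vo d := V_le h

/-- inclusion -/
noncomputable def ib (c : (schSite f p).Chart) : CommRingCat.of c.B ⟶ Γ(Y, Vo c) := CommRingCat.ofHom c.B.subtype

lemma rs_ib {c d : (schSite f p).Chart} (h : c ≤ d) :
    CommRingCat.ofHom (rs h) ≫ ib c = ib d ≫ Y.presheaf.map (homOfLE (Vo_le h)).op := rfl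

/-- map to chart -/
noncomputable def uc (c : (schSite f p).Chart) : (Vo c).toScheme ⟶ c.Sp := (Vo c).toSpecΓ ≫ Spec.map (ib c)

lemma uc_Sm {c d : (schSite f p).Chart} (h : c ≤ d) :
    Y.homOfLE (Vo_le h) ≫ uc d = uc c ≫ Sm h := by
  rw [uc, uc, ← Scheme.Opens.toSpecΓ_SpecMap_presheaf_map_assoc, Category.assoc]
  congr 1
  rw [Sm, ← Spec.map_comp, ← Spec.map_comp, rs_ib]

lemma gcov_cov {M : Set (schSite f p).Chart} {l : Finset A} (H : GCov M l) : Cov M l := by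
  intro c hc L _ e O he
  let e0 : Γ(Y, Vo c) ⟶ CommRingCat.of L := CommRingCat.ofHom e
  let φ : Spec (CommRingCat.of L) ⟶ Y := Spec.map e0 ≫ (Vo_aff c).fromSpec
  have hc' : ⊤ ≤ φ ⁻¹ᵁ (Vo c) := by
    refine top_le φ _ ?_
    have : (Vo_aff c).fromSpec (Spec.map e0 (IsLocalRing.closedPoint L)) ∈ Set.range (Vo_aff c).fromSpec := ⟨_, rfl⟩
    rw [(Vo_aff c).range_fromSpec] at this
    exact this
  have hev : evAt φ (Vo c) hc' = e0 := evAt_fromSpec (Vo_aff c) e0 hc'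
  obtain ⟨d, hd, hmem, hB⟩ := H L φ O (by
    intro V h a ha
    have h1 := (evAt_al p φ (show Y.affineOpens from V).1 h).trans (evAt_al p φ (Vo c) hc').symm
    have h2 := congrArg (fun t => t.hom a) (Spec.map_injective h1)
    have h3 : (alc p (Vo c) ≫ evAt φ (Vo c) hc').hom a = e ((schSite f p).al c.V a) := by
      rw [hev]; rfl
    have h4 := (h2.trans h3)
    have h5 := he a ha
    rw [← h4] at h5
    exact h5)
  have hd' : ⊤ ≤ φ ⁻¹ᵁ (Vo d) := hmem
  have hcd : ⊤ ≤ φ ⁻¹ᵁ (Vo c ⊓ Vo d) := le_inf hc' hd'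
  refine ⟨d, hd, (evAt φ (Vo c ⊓ Vo d) hcd).hom, ?_, ?_⟩
  · intro x
    have h1 := (res_evAt φ (inf_le_left : Vo c ⊓ Vo d ≤ Vo c) hcd hc').trans hev
    exact congrArg (fun t => t.hom x) h1
  · intro x hx
    have h1 := (res_evAt φ (inf_le_right : Vo c ⊓ Vo d ≤ Vo d) hcd hd')
    have h2 := congrArg (fun t => t.hom x) h1
    have h3 := hB x hx
    have h4 : (evAt φ (Vo c ⊓ Vo d) hcd).hom ((schSite f p).res inf_le_right x) = (evAt φ (Vo d) hd').hom x := h2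
    exact (congrArg (fun t => t ∈ O) h4).mpr h3

lemma exists_Vo {M : Set (schSite f p).Chart} {l : Finset A} (H : GCov M l) (y : Y) :
    ∃ m ∈ M, y ∈ Vo m := by
  obtain ⟨m, hm, h, -⟩ := H (Y.residueField y) (Y.fromSpecResidueField y) ⊤ (fun _ _ _ _ => trivial)
  refine ⟨m, hm, ?_⟩
  have h1 : ⊤ ≤ (Y.fromSpecResidueField y) ⁻¹ᵁ (Vo m) := h
  have h2 := h1 (show IsLocalRing.closedPoint (Y.residueField y) ∈ ⊤ from trivial)
  have h3 : Y.fromSpecResidueField y (IsLocalRing.closedPoint (Y.residueField y)) ∈ Vo m := h2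
  exact (congrArg (fun t => t ∈ Vo m) (Scheme.fromSpecResidueField_apply y _)).mp h3

variable {M : Set (schSite f p).Chart}

lemma uc_agree (c d : GM M) {W : Scheme.{u}} (a : W ⟶ (Vo c.c).toScheme) (b : W ⟶ (Vo d.c).toScheme)
    (h : a ≫ (Vo c.c).ι = b ≫ (Vo d.c).ι) : a ≫ uc c.c ≫ c.j = b ≫ uc d.c ≫ d.j := by
  have hr : Set.range (a ≫ (Vo c.c).ι) ⊆ Set.range (Vo (c.inf d).c).ι := by
    rintro _ ⟨w, rfl⟩
    rw [Scheme.Opens.range_ι]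
    refine ⟨?_, ?_⟩
    · exact (a w).2
    · rw [h]; exact (b w).2
  let t := IsOpenImmersion.lift (Vo (c.inf d).c).ι (a ≫ (Vo c.c).ι) hr
  have ht : t ≫ (Vo (c.inf d).c).ι = a ≫ (Vo c.c).ι := IsOpenImmersion.lift_fac _ _ _
  have e1 : a = t ≫ Y.homOfLE (Vo_le (GM.infl c d)) := by
    rw [← cancel_mono (Vo c.c).ι, Category.assoc, Scheme.homOfLE_ι, ht]
  have e2 : b = t ≫ Y.homOfLE (Vo_le (GM.infr c d)) := by
    rw [← cancel_mono (Vo d.c).ι, Category.assoc, Scheme.homOfLE_ι, ht, h]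
  rw [e1, e2, Category.assoc, Category.assoc, reassoc_of% uc_Sm (GM.infl c d),
    reassoc_of% uc_Sm (GM.infr c d), GM.Sm_j, GM.Sm_j]

lemma exists_q {l : Finset A} (hA : Atlas M) (H : GCov M l) :
    ∃ q : Y ⟶ GM.X M, ∀ c : GM M, (Vo c.c).ι ≫ q = uc c.c ≫ c.j := by
  have hs : ⨆ m : GM M, Vo m.c = ⊤ := by
    rw [eq_top_iff]
    intro y _
    obtain ⟨m, hm, h⟩ := exists_Vo H y
    exact TopologicalSpace.Opens.mem_iSup.2 ⟨GM.of hA hm, h⟩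
  let 𝒰 : Y.OpenCover := Y.openCoverOfIsOpenCover (fun m : GM M => Vo m.c) hs
  refine ⟨𝒰.glueMorphisms (fun m => uc m.c ≫ m.j) ?_, ?_⟩
  · intro m n
    exact uc_agree m n _ _ pullback.condition
  · intro m
    exact 𝒰.ι_glueMorphisms _ _ m

lemma q_pi {l : Finset A} (hl : ∀ m ∈ M, m.Has l) (hA : Atlas M) (H : GCov M l) (q : Y ⟶ GM.X M)
    (hq : ∀ c : GM M, (Vo c.c).ι ≫ q = uc c.c ≫ c.j) :
    q ≫ GM.pi hl = p ≫ Spec.map (CommRingCat.ofHom (Subring.closure (l : Set A)).subtype) := by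
  have hs : ⨆ m : GM M, Vo m.c = ⊤ := by
    rw [eq_top_iff]
    intro y _
    obtain ⟨m, hm, h⟩ := exists_Vo H y
    exact TopologicalSpace.Opens.mem_iSup.2 ⟨GM.of hA hm, h⟩
  have key : ∀ m : GM M, (Vo m.c).ι ≫ q ≫ GM.pi hl = (Vo m.c).ι ≫ p ≫
      Spec.map (CommRingCat.ofHom (Subring.closure (l : Set A)).subtype) := by
    intro m
    rw [reassoc_of% hq m, GM.j_pi, ← (Vo_aff m.c).toSpecΓ_fromSpec, Category.assoc,
      reassoc_of% fromSpec_p p (Vo_aff m.c), uc, Category.assoc]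
    congr 1
    refine (Spec.map_comp _ _).symm.trans (Eq.trans ?_ (Spec.map_comp _ _))
    rfl
  exact Scheme.Cover.hom_ext (Y.openCoverOfIsOpenCover (fun m : GM M => Vo m.c) hs) _ _ key

lemma mem_Vo (c d : GM M) (y : (Vo d.c).toScheme) (x : c.c.Sp) (h : d.j (uc d.c y) = c.j x) :
    y.1 ∈ Vo c.c := by
  obtain ⟨z, hz1, -⟩ := GM.j_eq h
  have := z.2
  obtain ⟨b, hb, hle⟩ := (GM.tame_le c d) z.asIdeal.ResidueField
    (algebraMap _ z.asIdeal.ResidueField)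
  have h1 : b ∉ (uc d.c y).asIdeal := by
    rw [← hz1, mem_Sm]
    intro h2
    apply hb
    exact (Ideal.algebraMap_residueField_eq_zero).2 h2
  have h2 : (d.c.loc b) ≤ c.c := hle
  refine Vo_le h2 ?_
  have h3 : (Vo d.c).toSpecΓ y ∈ PrimeSpectrum.basicOpen (ib d.c b) := h1
  have h4 : y ∈ (Vo d.c).toSpecΓ ⁻¹ᵁ PrimeSpectrum.basicOpen (ib d.c b) := h3
  rw [Scheme.Opens.toSpecΓ_preimage_basicOpen] at h4
  exact h4

end SchSite

end

section
open AlgebraicGeometry CategoryTheory CategoryTheory.Limits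

lemma chart_pb {A0 A B : Type u} [CommRing A0] [CommRing A] [CommRing B] (β : A0 →+* B) (s : A0 →+* A)
    {X0 : Scheme.{u}} (π : X0 ⟶ Spec (CommRingCat.of A0)) (j : Spec (CommRingCat.of B) ⟶ X0)
    [IsOpenImmersion j] (hj : j ≫ π = Spec.map (CommRingCat.ofHom β)) :
    ∃ (C : Type u) (_ : CommRing C) (iA : A →+* C) (iB : B →+* C), iA.comp s = iB.comp β ∧
      (∀ c, c ∈ Subring.closure (Set.range iA ∪ Set.range iB)) ∧
      (∀ (G : Type u) [CommRing G] (a : A →+* G) (b : B →+* G), a.comp s = b.comp β →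
        ∃ μ : C →+* G, μ.comp iA = a ∧ μ.comp iB = b) ∧
      ∃ w : Spec (CommRingCat.of C) ⟶ pullback π (Spec.map (CommRingCat.ofHom s)),
        IsOpenImmersion w ∧ w ≫ pullback.fst _ _ = Spec.map (CommRingCat.ofHom iB) ≫ j ∧
        w ≫ pullback.snd _ _ = Spec.map (CommRingCat.ofHom iA) ∧
        ∀ x, pullback.fst π (Spec.map (CommRingCat.ofHom s)) x ∈ Set.range j → x ∈ Set.range w := by
  let _ : Algebra A0 B := β.toAlgebra
  let _ : Algebra A0 A := s.toAlgebra
  let iA : A →+* TensorProduct A0 B A := Algebra.TensorProduct.includeRight.toRingHom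
  let iB : B →+* TensorProduct A0 B A := Algebra.TensorProduct.includeLeftRingHom
  have hP := CommRingCat.isPushout_tensorProduct A0 B A
  have hP' : IsPushout (CommRingCat.ofHom β) (CommRingCat.ofHom s) (CommRingCat.ofHom iB)
    (CommRingCat.ofHom iA) := hP
  have hc : iA.comp s = iB.comp β := by
    exact congrArg CommRingCat.Hom.hom hP'.w.symm
  have hS := isPullback_SpecMap_of_isPushout _ _ _ _ hP'
  obtain ⟨w, hw1, hw2⟩ : ∃ w : Spec (CommRingCat.of (TensorProduct A0 B A)) ⟶ pullback π (Spec.map (CommRingCat.ofHom s)),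
      w ≫ pullback.fst _ _ = Spec.map (CommRingCat.ofHom iB) ≫ j ∧
      w ≫ pullback.snd _ _ = Spec.map (CommRingCat.ofHom iA) :=
    ⟨pullback.lift (Spec.map (CommRingCat.ofHom iB) ≫ j) (Spec.map (CommRingCat.ofHom iA)) (by
      rw [Category.assoc, hj]; exact hS.w), pullback.lift_fst _ _ _, pullback.lift_snd _ _ _⟩
  have hS2 : IsPullback (w ≫ pullback.snd _ _) (Spec.map (CommRingCat.ofHom iB))
      (Spec.map (CommRingCat.ofHom s)) (j ≫ π) := by
    rw [hw2, hj]; exact hS.flip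
  have hS3 : IsPullback w (Spec.map (CommRingCat.ofHom iB))
      (pullback.fst π (Spec.map (CommRingCat.ofHom s))) j :=
    IsPullback.of_right hS2 hw1 (IsPullback.of_hasPullback π (Spec.map (CommRingCat.ofHom s))).flip
  refine ⟨TensorProduct A0 B A, inferInstance, iA, iB, hc, ?_, ?_, w, ?_, hw1, hw2, ?_⟩
  · intro c
    induction c with
    | zero => exact zero_mem _
    | add x y hx hy => exact add_mem hx hy
    | tmul x y =>
      have : x ⊗ₜ[A0] y = iB x * iA y := by
        change _ = (x ⊗ₜ[A0] (1 : A)) * ((1 : B) ⊗ₜ[A0] y)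
        rw [Algebra.TensorProduct.tmul_mul_tmul, mul_one, one_mul]
      rw [this]
      exact mul_mem (Subring.subset_closure (Or.inr ⟨x, rfl⟩)) (Subring.subset_closure (Or.inl ⟨y, rfl⟩))
  · intro G _ a b hab
    have hw : CommRingCat.ofHom β ≫ CommRingCat.ofHom b = CommRingCat.ofHom s ≫ CommRingCat.ofHom a := by
      rw [← CommRingCat.ofHom_comp, ← CommRingCat.ofHom_comp, hab]
    refine ⟨(hP'.desc _ _ hw).hom, ?_, ?_⟩
    · exact congrArg CommRingCat.Hom.hom (hP'.inr_desc _ _ hw)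
    · exact congrArg CommRingCat.Hom.hom (hP'.inl_desc _ _ hw)
  · exact MorphismProperty.of_isPullback (P := @IsOpenImmersion) hS3.flip inferInstance
  · rintro x ⟨y, hy⟩
    obtain ⟨z, hz, -⟩ := Scheme.Pullback.exists_preimage_pullback x y hy.symm
    refine ⟨hS3.isoPullback.inv z, ?_⟩
    rw [← hz, ← Scheme.Hom.comp_apply, IsPullback.isoPullback_inv_fst]

lemma loc_oi {C G : Type u} [CommRing C] [CommRing G] (a : C) (μ : C →+* G) (hu : IsUnit (μ a))
    (h1 : ∀ c, μ c = 0 → ∃ n : ℕ, a ^ n * c = 0) (h2 : ∀ x, ∃ (n : ℕ) (c : C), μ c = μ a ^ n * x) :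
    IsOpenImmersion (Spec.map (CommRingCat.ofHom μ)) ∧
    ∀ z : Spec (CommRingCat.of C), a ∉ z.asIdeal → z ∈ Set.range (Spec.map (CommRingCat.ofHom μ)) := by
  let _ : Algebra C G := μ.toAlgebra
  have : IsLocalization.Away a G := by
    refine ⟨⟨?_, ?_, ?_⟩⟩
    · rintro ⟨_, n, rfl⟩
      change IsUnit (μ (a ^ n))
      rw [map_pow]; exact hu.pow n
    · intro x
      obtain ⟨n, c, hc⟩ := h2 x
      refine ⟨(c, ⟨a ^ n, n, rfl⟩), ?_⟩
      change x * μ (a ^ n) = μ c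
      rw [hc, map_pow, mul_comm]
    · intro x y hxy
      obtain ⟨n, hn⟩ := h1 (x - y) (by rw [map_sub]; exact sub_eq_zero.2 hxy)
      exact ⟨⟨a ^ n, n, rfl⟩, by simpa [mul_sub, sub_eq_zero] using hn⟩
  refine ⟨IsOpenImmersion.of_isLocalization a, ?_⟩
  intro z hz
  have h1 := PrimeSpectrum.localization_away_comap_range G a
  have h2 : z ∈ Set.range (PrimeSpectrum.comap (algebraMap C G)) := by
    rw [h1]; exact hz
  exact h2

end

section
open AlgebraicGeometry CategoryTheory CategoryTheory.Limits
namespace SchSite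
open Site.Chart
variable {A : Type u} [CommRing A] {Y : Scheme.{u}} {p : Y ⟶ Spec (CommRingCat.of A)} {ι : Type}
  {f : ι → A} [IsSeparated p]

/-- the chart becomes the right thing after base change -/
def LocR (l : Finset A) (c : (schSite f p).Chart) : Prop :=
  ∀ (C : Type u) [CommRing C] (iA : A →+* C) (iB : c.B →+* C)
      (_ : ∀ x ∈ Subring.closure (l : Set A), ∀ h : (schSite f p).al c.V x ∈ c.B,
        iA x = iB ⟨(schSite f p).al c.V x, h⟩)
      (_ : ∀ c, c ∈ Subring.closure (Set.range iA ∪ Set.range iB))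
      (μ : C →+* (schSite f p).R c.V) (_ : μ.comp iA = (schSite f p).al c.V) (_ : μ.comp iB = c.B.subtype),
      (∀ x, μ x = 0 → ∃ n : ℕ, iA (f c.i) ^ n * x = 0) ∧
        ∀ x, ∃ (n : ℕ) (y : C), μ y = (schSite f p).al c.V (f c.i) ^ n * x

variable {M : Set (schSite f p).Chart}

lemma chart_main {l : Finset A} (hl : ∀ m ∈ M, m.Has l) (hfl : ∀ i, f i ∈ l) (c : GM M) (hc : LocR l c.c)
    (h : Y ⟶ pullback (GM.pi hl) (Spec.map (CommRingCat.ofHom (Subring.closure (l : Set A)).subtype)))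
    (h1 : (Vo c.c).ι ≫ h ≫ pullback.fst _ _ = uc c.c ≫ c.j) (h2 : h ≫ pullback.snd _ _ = p) :
    IsOpenImmersion ((Vo c.c).ι ≫ h) ∧
    ∀ x, pullback.fst (GM.pi hl) (Spec.map (CommRingCat.ofHom (Subring.closure (l : Set A)).subtype)) x ∈ Set.range c.j →
      (∃ i, pullback.snd (GM.pi hl) (Spec.map (CommRingCat.ofHom (Subring.closure (l : Set A)).subtype)) x ∈
        PrimeSpectrum.basicOpen (f i)) → x ∈ Set.range h := by
  obtain ⟨C, _, iA, iB, hAB, hgen, hdesc, w, hw, hw1, hw2, hw3⟩ :=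
    chart_pb (GM.be c.c (GM.has hl c)) (Subring.closure (l : Set A)).subtype (GM.pi hl) c.j (GM.j_pi hl c)
  obtain ⟨μ, hμA, hμB⟩ := hdesc Γ(Y, Vo c.c) (alc p (Vo c.c)).hom (ib c.c).hom rfl
  have hAB' : ∀ x ∈ Subring.closure (l : Set A), ∀ h : (schSite f p).al c.c.V x ∈ c.c.B,
        iA x = iB ⟨(schSite f p).al c.c.V x, h⟩ := fun x hx _ => RingHom.congr_fun hAB ⟨x, hx⟩
  obtain ⟨k1, k2⟩ := hc C iA iB hAB' hgen μ hμA hμB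
  have hμa : ∀ a, μ (iA a) = (alc p (Vo c.c)).hom a := fun a => RingHom.congr_fun hμA a
  have hu : IsUnit (μ (iA (f c.c.i))) := by rw [hμa]; exact c.c.unit
  obtain ⟨o1, o2⟩ := loc_oi (iA (f c.c.i)) μ hu k1 (fun x => by
    obtain ⟨n, y, hy⟩ := k2 x
    exact ⟨n, y, by rw [hμa]; exact hy⟩)
  have heq : (Vo c.c).ι ≫ h = (Vo c.c).toSpecΓ ≫ Spec.map (CommRingCat.ofHom μ) ≫ w := by
    apply pullback.hom_ext
    · rw [Category.assoc, h1, Category.assoc, Category.assoc, hw1, ← Spec.map_comp_assoc, uc, Category.assoc]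
      congr 3
      exact (congrArg CommRingCat.ofHom hμB).symm
    · rw [Category.assoc, h2, Category.assoc, Category.assoc, hw2, ← Spec.map_comp,
        ← (Vo_aff c.c).toSpecΓ_fromSpec, Category.assoc, fromSpec_p]
      congr 2
      exact (congrArg CommRingCat.ofHom hμA).symm
  have hiso : IsIso (Vo c.c).toSpecΓ := by
    rw [← (Vo_aff c.c).isoSpec_hom]; infer_instance
  refine ⟨by rw [heq]; infer_instance, ?_⟩
  rintro x hx ⟨k, hk⟩
  obtain ⟨z, rfl⟩ := hw3 x hx
  have hk' : iA (f k) ∉ z.asIdeal := by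
    rw [← Scheme.Hom.comp_apply, hw2] at hk
    exact hk
  obtain ⟨b, hb, hdiv⟩ := c.c.div k
  have hz : iA (f c.c.i) ∉ z.asIdeal := by
    intro hz
    apply hk'
    have e1 := hAB' (f k) (Subring.subset_closure (hfl k)) (GM.has hl c _ (hfl k))
    have e2 := hAB' (f c.c.i) (Subring.subset_closure (hfl _)) (GM.has hl c _ (hfl _))
    have e3 : iA (f k) = iA (f c.c.i) * iB ⟨b, hb⟩ := by
      rw [e1, e2, ← map_mul]
      exact congrArg iB (Subtype.ext hdiv)
    rw [e3]
    exact Ideal.mul_mem_right _ _ hz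
  obtain ⟨v, hv⟩ := o2 z hz
  refine ⟨(Vo c.c).ι (inv (Vo c.c).toSpecΓ v), ?_⟩
  rw [← hv, ← Scheme.Hom.comp_apply, ← Scheme.Hom.comp_apply, ← Scheme.Hom.comp_apply, heq, IsIso.inv_hom_id_assoc]

theorem geo_main [Finite ι] (T : (Spec (CommRingCat.of A)).Opens)
    (hT : ∀ x : Spec (CommRingCat.of A), x ∈ T ↔ ∃ i, x ∈ PrimeSpectrum.basicOpen (f i))
    (g : Y ⟶ T.toScheme) (hp : g ≫ T.ι = p) {l : Finset A} (hM : M.Finite) (hA : Atlas M)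
    (hl : ∀ m ∈ M, m.Has l) (hfl : ∀ i, f i ∈ l) (hloc : ∀ m ∈ M, LocR l m) (H : GCov M l) :
    ∃ (X : Scheme.{u}) (F : X ⟶ Spec (CommRingCat.of A)), IsProper F ∧ LocallyOfFinitePresentation F ∧
      ∃ e : pullback F T.ι ≅ Y, e.hom ≫ g = pullback.snd F T.ι := by
  obtain ⟨q, hq⟩ := exists_q hA H
  have hqp := q_pi hl hA H q hq
  have hprop : IsProper (GM.pi hl) := GM.proper hl hA hM (gcov_cov H)
  have hfp : LocallyOfFinitePresentation (GM.pi hl) := GM.pi_fp hl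
  let σ := Spec.map (CommRingCat.ofHom (Subring.closure (l : Set A)).subtype)
  obtain ⟨h, e1, e2⟩ : ∃ h : Y ⟶ pullback (GM.pi hl) σ, h ≫ pullback.fst _ _ = q ∧
    h ≫ pullback.snd _ _ = p := ⟨pullback.lift q p hqp, pullback.lift_fst _ _ _, pullback.lift_snd _ _ _⟩
  have key : ∀ m (hm : m ∈ M), IsOpenImmersion ((Vo m).ι ≫ h) ∧
      ∀ x, pullback.fst (GM.pi hl) σ x ∈ Set.range (GM.of hA hm).j →
      (∃ i, pullback.snd (GM.pi hl) σ x ∈ PrimeSpectrum.basicOpen (f i)) → x ∈ Set.range h := fun m hm =>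
    chart_main hl hfl (GM.of hA hm) (hloc m hm) h (by rw [e1]; exact hq _) e2
  have hqv : ∀ m (hm : m ∈ M) (y : (Vo m).toScheme), q y.1 = (GM.of hA hm).j (uc m y) := by
    intro m hm y
    have := congrArg (fun t => t y) (hq (GM.of hA hm))
    exact this
  have hinj : Function.Injective h := by
    intro y y' hyy
    obtain ⟨m, hm, hy⟩ := exists_Vo H y
    obtain ⟨n, hn, hy'⟩ := exists_Vo H y'
    have hqq : q y = q y' := by
      rw [← e1, Scheme.Hom.comp_apply, Scheme.Hom.comp_apply, hyy]
    have h5 : y' ∈ Vo m := mem_Vo (GM.of hA hm) (GM.of hA hn) ⟨y', hy'⟩ (uc m ⟨y, hy⟩)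
      ((hqv n hn ⟨y', hy'⟩).symm.trans (hqq.symm.trans (hqv m hm ⟨y, hy⟩)))
    have := (key m hm).1
    have h6 := ((Vo m).ι ≫ h).isOpenEmbedding.injective (a₁ := ⟨y, hy⟩) (a₂ := ⟨y', h5⟩) hyy
    exact congrArg Subtype.val h6
  have hoi : IsOpenImmersion h := openImm_of_local h hinj (fun y => by
    obtain ⟨m, hm, hy⟩ := exists_Vo H y
    exact ⟨_, (Vo m).ι, ⟨y, hy⟩, inferInstance, rfl, (key m hm).1⟩)
  let F := pullback.snd (GM.pi hl) σ
  have hr : Set.range (pullback.fst F T.ι) = Set.range h := by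
    rw [IsOpenImmersion.range_pullbackFst, Scheme.Opens.opensRange_ι]
    ext x
    have hx : x ∈ ((F ⁻¹ᵁ T : (pullback (GM.pi hl) σ).Opens) : Set (pullback (GM.pi hl) σ : Scheme.{u})) ↔ F x ∈ T := Iff.rfl
    constructor
    · intro hx1
      obtain ⟨m, hm, y, hy⟩ := GM.exists_jM hA (pullback.fst (GM.pi hl) σ x)
      exact (key m hm).2 x ⟨y, hy⟩ ((hT _).1 hx1)
    · rintro ⟨y, rfl⟩
      change F (h y) ∈ T
      rw [← Scheme.Hom.comp_apply, e2, ← hp]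
      exact (g y).2
  have hF1 : IsProper F := inferInstance
  have hF2 : LocallyOfFinitePresentation F := inferInstance
  refine ⟨pullback (GM.pi hl) σ, F, hF1, hF2, IsOpenImmersion.isoOfRangeEq (pullback.fst F T.ι) h hr, ?_⟩
  rw [← cancel_mono T.ι, Category.assoc, hp, ← pullback.condition]
  have h7 := IsOpenImmersion.isoOfRangeEq_hom_fac (pullback.fst F T.ι) h hr
  have h8 : h ≫ F = p := e2
  exact (congrArg (fun t => _ ≫ t) h8.symm).trans ((Category.assoc _ _ _).symm.trans
    (congrArg (fun t => t ≫ F) h7))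
end SchSite

end

section
open AlgebraicGeometry CategoryTheory CategoryTheory.Limits
namespace SchSite
open Site.Chart
variable {A : Type u} [CommRing A] {Y : Scheme.{u}} {p : Y ⟶ Spec (CommRingCat.of A)} {ι : Type}
  {f : ι → A} [IsSeparated p]

lemma exists_locR [LocallyOfFinitePresentation p] (c : (schSite f p).Chart) :
    ∃ l : Finset A, ∀ l', l ⊆ l' → LocR l' (c.enl l') := by
  have hfp : (alc p (Vo c)).hom.FinitePresentation := by
    have h1 : LocallyOfFinitePresentation ((Vo_aff c).fromSpec ≫ p) := inferInstance
    rw [fromSpec_p] at h1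
    exact (LocallyOfFinitePresentation.SpecMap_iff _).1 h1
  have hfp' : ((schSite f p).al c.V).FinitePresentation := hfp
  obtain ⟨s, hs, hB⟩ := c.fg
  have hg := c.good
  have hm := c.fmem
  rw [← hB] at hg hm
  obtain ⟨l, hl⟩ := loc_ring ((schSite f p).al c.V) hfp' s hs (f c.i) c.unit hm hg
  refine ⟨l, fun l' hll C _ iA iB h1 h2 μ h3 h4 => ?_⟩
  exact hl l' hll (c.enl l').B (by rw [hB]; rfl) C iA iB h1 h2 μ h3 h4
end SchSite

open SchSite Site.Chart in
theorem stmt4 {A : Type u} [CommRing A] (T : (Spec (CommRingCat.of A)).Opens)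
    (hT : IsCompact T.carrier) {Y : Scheme.{u}} (g : Y ⟶ T.toScheme)
    (hg₁ : IsProper g) (hg₂ : LocallyOfFinitePresentation g) :
    ∃ (X : Scheme.{u}) (f : X ⟶ Spec (CommRingCat.of A)),
      IsProper f ∧ LocallyOfFinitePresentation f ∧
        ∃ e : pullback f T.ι ≅ Y, e.hom ≫ g = pullback.snd f T.ι := by
  classical
  obtain ⟨n, f, hf⟩ := exists_f T hT
  have : CompactSpace T.toScheme := isCompact_iff_compactSpace.mp hT
  have hqc : QuasiCompact T.ι := quasiCompact_of_compactSpace _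
  obtain ⟨p, hp⟩ : ∃ p, g ≫ T.ι = p := ⟨_, rfl⟩
  have i1 : IsSeparated p := by rw [← hp]; infer_instance
  have i2 : QuasiCompact p := by rw [← hp]; infer_instance
  have i3 : LocallyOfFinitePresentation p := by rw [← hp]; infer_instance
  obtain ⟨l0, M, hM, hA, H⟩ := exists_atlas p f T hf g hp
  choose L hL using fun c : (schSite f p).Chart => exists_locR c
  let l := l0 ∪ hM.toFinset.biUnion L ∪ Finset.univ.image f
  refine geo_main (p := p) (f := f) (M := (fun c => enl c l) '' M) T hf g hp (l := l) (hM.image _)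
    (hA.enl l) ?_ ?_ ?_ ?_
  · rintro _ ⟨m, hm, rfl⟩
    exact enl_has m l
  · intro i
    exact Finset.mem_union_right _ (Finset.mem_image_of_mem _ (Finset.mem_univ i))
  · rintro _ ⟨m, hm, rfl⟩
    refine hL m l ?_
    intro x hx
    exact Finset.mem_union_left _ (Finset.mem_union_right _ (Finset.mem_biUnion.2 ⟨m, hM.mem_toFinset.2 hm, hx⟩))
  · intro K _ φ O h
    obtain ⟨m, hm, h1⟩ := H K φ O (h.subset (fun x hx =>
      Finset.mem_union_left _ (Finset.mem_union_left _ hx)))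
    exact ⟨_, ⟨m, hm, rfl⟩, h1.enl h⟩

end
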